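/- Let f : (ℝ^m,0) → (ℝ^n,0) be a smooth map-germ written in the form f(x) = (x_1,…,x_{m−1}, f_m(x),…,f_n(x)) with (df_i)_0 = 0 for i = m,…,n, and set F = (∂f_m/∂x_m,…,∂f_n/∂x_m) : (ℝ^m,0) → ℝ^{n−m+1}. Then f is an r-Morin singularity at 0 if and only if: (∂^jf_m/∂x_m^j,…,∂^jf_n/∂x_m^j)(0) = 0 for all 1 ≤ j ≤ r, (∂^{r+1}f_m/∂x_m^{r+1},…,∂^{r+1}f_n/∂x_m^{r+1})(0) ≠ 0, and rank d(F, ∂F/∂x_m, …, ∂^{r−1}F/∂x_m^{r−1})_0 = r(n−m+1). -/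

import Mathlib

open Filter Topology Matrix

noncomputable section

/-- The `q`-th component of `f` (`0`-indexed), or `0` if `q` is out of range. -/
def comp {m n : ℕ} (f : (Fin m → ℝ) → (Fin n → ℝ)) (q : ℕ) : (Fin m → ℝ) → ℝ :=
  fun x => if h : q < n then f x ⟨q, h⟩ else 0

/-- The `q`-th coordinate of `x` (`0`-indexed), or `0` if `q` is out of range. -/
def xhat {m : ℕ} (x : Fin m → ℝ) (q : ℕ) : ℝ := if h : q < m then x ⟨q, h⟩ else 0

/-- The partial derivative of `g` at `p` in the `q`-th coordinate direction. -/
def pd {m : ℕ} (g : (Fin m → ℝ) → ℝ) (p : Fin m → ℝ) (q : ℕ) : ℝ :=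
  fderiv ℝ g p (fun l : Fin m => if l.val = q then 1 else 0)

/-- The Jacobian matrix of `f` at `p`; its rank is the rank of `df_p`. -/
def jac {m n : ℕ} (f : (Fin m → ℝ) → (Fin n → ℝ)) (p : Fin m → ℝ) : Matrix (Fin n) (Fin m) ℝ :=
  Matrix.of fun i l => pd (comp f i.val) p l.val

/-- `lam f i` is the paper's `λ_{i+1}` (here `i` is `0`-indexed, `0 ≤ i ≤ n-m`):
the determinant of the `m×m` matrix whose rows are the gradients of
`f_0, …, f_{m-2}, f_{m-1+i}` (`0`-indexed components). -/
def lam {m n : ℕ} (f : (Fin m → ℝ) → (Fin n → ℝ)) (i : ℕ) (p : Fin m → ℝ) : ℝ :=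
  Matrix.det (Matrix.of fun (k l : Fin m) =>
    pd (comp f (if k.val < m - 1 then k.val else m - 1 + i)) p l.val)

/-- `Λ = (λ_1, …, λ_{n-m+1}) : ℝ^m → ℝ^{n-m+1}`. -/
def Lam {m n : ℕ} (f : (Fin m → ℝ) → (Fin n → ℝ)) (p : Fin m → ℝ) : Fin (n - m + 1) → ℝ :=
  fun i => lam f i.val p

/-- The Jacobian matrix of `Λ` at `p`. -/
def dLam {m n : ℕ} (f : (Fin m → ℝ) → (Fin n → ℝ)) (p : Fin m → ℝ) :
    Matrix (Fin (n - m + 1)) (Fin m) ℝ :=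
  Matrix.of fun i l => pd (fun x => Lam f x i) p l.val

/-- `etaIter f η j = η^jΛ`, the `j`-fold iterated directional derivative of `Λ` along `η`. -/
def etaIter {m n : ℕ} (f : (Fin m → ℝ) → (Fin n → ℝ)) (η : (Fin m → ℝ) → (Fin m → ℝ)) :
    ℕ → (Fin m → ℝ) → (Fin (n - m + 1) → ℝ)
  | 0 => Lam f
  | j + 1 => fun p => fderiv ℝ (etaIter f η j) p (η p)

/-- The Jacobian matrix of `(Λ, ηΛ, …, η^jΛ) : ℝ^m → ℝ^{(j+1)(n-m+1)}` at `p`. -/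
def stackJac {m n : ℕ} (f : (Fin m → ℝ) → (Fin n → ℝ)) (η : (Fin m → ℝ) → (Fin m → ℝ))
    (j : ℕ) (p : Fin m → ℝ) : Matrix (Fin (j + 1) × Fin (n - m + 1)) (Fin m) ℝ :=
  Matrix.of fun si l => pd (fun x => etaIter f η si.1.val x si.2) p l.val

/-- A diffeomorphism-germ `(ℝ^k,0) → (ℝ^k,0)`: it fixes `0`, is smooth at `0` and its
differential at `0` is invertible (so by the inverse function theorem it is a germ of a
diffeomorphism). -/
def IsDiffeoGerm {k : ℕ} (σ : (Fin k → ℝ) → (Fin k → ℝ)) : Prop :=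
  σ 0 = 0 ∧ ContDiffAt ℝ (⊤ : ℕ∞) σ 0 ∧ LinearMap.det ((fderiv ℝ σ 0).toLinearMap) ≠ 0

/-- An orientation-preserving diffeomorphism-germ `(ℝ^k,0) → (ℝ^k,0)`. -/
def IsOPDiffeoGerm {k : ℕ} (σ : (Fin k → ℝ) → (Fin k → ℝ)) : Prop :=
  σ 0 = 0 ∧ ContDiffAt ℝ (⊤ : ℕ∞) σ 0 ∧ 0 < LinearMap.det ((fderiv ℝ σ 0).toLinearMap)

/-- `A`-equivalence of map-germs at `0`. -/
def AEquiv {m n : ℕ} (f g : (Fin m → ℝ) → (Fin n → ℝ)) : Prop :=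
  ∃ (φ : (Fin m → ℝ) → (Fin m → ℝ)) (Φ : (Fin n → ℝ) → (Fin n → ℝ)),
    IsDiffeoGerm φ ∧ IsDiffeoGerm Φ ∧ ∀ᶠ x in 𝓝 0, Φ (f (φ x)) = g x

/-- The Morin normal form `h_{0,r} : (ℝ^m,0) → (ℝ^n,0)` (all indices `0`-indexed):
`h_{0,r}(x) = (x_1, …, x_{m-1}, h_1(x), …, h_{n-m+1}(x))` with
`h_i(x) = Σ_{j=1}^r x_{(i-1)r+j} x_m^j` for `i = 1, …, n-m` and
`h_{n-m+1}(x) = Σ_{j=1}^{r-1} x_{(n-m)r+j} x_m^j + x_m^{r+1}`. -/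
def hMorinNF (m n r : ℕ) : (Fin m → ℝ) → (Fin n → ℝ) := fun x k =>
  if k.val < m - 1 then xhat x k.val
  else if k.val - (m - 1) < n - m then
    ∑ j ∈ Finset.range r, xhat x ((k.val - (m - 1)) * r + j) * (xhat x (m - 1)) ^ (j + 1)
  else
    (∑ j ∈ Finset.range (r - 1), xhat x ((n - m) * r + j) * (xhat x (m - 1)) ^ (j + 1))
      + (xhat x (m - 1)) ^ (r + 1)

/-- The normal form `h_{r,(ε₁,ε₂)}(x) = (ε₁x_1, x_2, …, x_{m-1},
ε₁x_1x_m + Σ_{j=2}^r x_jx_m^j, h_2(x), …, h_{n-m}(x), ε₂h_{n-m+1}(x))`. -/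
def hSign (m n r : ℕ) (e1 e2 : ℝ) : (Fin m → ℝ) → (Fin n → ℝ) := fun x k =>
  if k.val = 0 then e1 * xhat x 0
  else if k.val < m - 1 then xhat x k.val
  else if k.val = m - 1 then
    e1 * xhat x 0 * xhat x (m - 1)
      + ∑ j ∈ Finset.Ico 1 r, xhat x j * (xhat x (m - 1)) ^ (j + 1)
  else if k.val - (m - 1) < n - m then
    ∑ j ∈ Finset.range r, xhat x ((k.val - (m - 1)) * r + j) * (xhat x (m - 1)) ^ (j + 1)
  else
    e2 * ((∑ j ∈ Finset.range (r - 1), xhat x ((n - m) * r + j) * (xhat x (m - 1)) ^ (j + 1))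
      + (xhat x (m - 1)) ^ (r + 1))

/-- The partial derivative in the last (`x_m`) coordinate direction. -/
def Dl {m : ℕ} (g : (Fin m → ℝ) → ℝ) : (Fin m → ℝ) → ℝ :=
  fun x => fderiv ℝ g x (fun l : Fin m => if l.val = m - 1 then 1 else 0)

/-- `j`-fold iterated partial derivative in the last coordinate direction. -/
def DlIter {m : ℕ} (g : (Fin m → ℝ) → ℝ) : ℕ → (Fin m → ℝ) → ℝ
  | 0 => g
  | j + 1 => Dl (DlIter g j)

/-- A sequence of smooth functions all of whose derivatives are bounded, uniformly in the point
and polynomially in the index. -/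
def Tempered {E F : Type} [NormedAddCommGroup E] [NormedSpace ℝ E] [NormedAddCommGroup F]
    [NormedSpace ℝ F] (u : ℕ → E → F) : Prop :=
  (∀ k, ContDiff ℝ (⊤ : ℕ∞) (u k)) ∧ ∀ n : ℕ, ∃ (C : ℝ) (M : ℕ), ∀ k x,
    ‖iteratedFDeriv ℝ n (u k) x‖ ≤ C * ((k : ℝ) + 1) ^ M

namespace Tempered

variable {E F G : Type} [NormedAddCommGroup E] [NormedSpace ℝ E] [NormedAddCommGroup F]
  [NormedSpace ℝ F] [NormedAddCommGroup G] [NormedSpace ℝ G]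

theorem uniform_bound {u : ℕ → E → F} (hu : Tempered u) (N : ℕ) :
    ∃ (C : ℝ) (M : ℕ), 0 ≤ C ∧ ∀ n ≤ N, ∀ k x,
      ‖iteratedFDeriv ℝ n (u k) x‖ ≤ C * ((k : ℝ) + 1) ^ M := by
  choose C M h using hu.2
  refine ⟨∑ i ∈ Finset.range (N + 1), |C i|, ∑ i ∈ Finset.range (N + 1), M i,
    Finset.sum_nonneg fun _ _ => abs_nonneg _, fun n hn k x => (h n k x).trans ?_⟩
  have hmem : n ∈ Finset.range (N + 1) := by simpa [Nat.lt_succ_iff] using hn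
  have h1 : (1 : ℝ) ≤ (k : ℝ) + 1 := by have := Nat.cast_nonneg (α := ℝ) k; linarith
  refine mul_le_mul ((le_abs_self _).trans
    (Finset.single_le_sum (f := fun i => |C i|) (fun _ _ => abs_nonneg _) hmem))
    (pow_le_pow_right₀ h1 (Finset.single_le_sum (fun _ _ => Nat.zero_le _) hmem)) (by positivity)
    (Finset.sum_nonneg fun _ _ => abs_nonneg _)

theorem of_bounded {f : E → F} (hf : ContDiff ℝ (⊤ : ℕ∞) f)
    (hb : ∀ n : ℕ, ∃ C, ∀ x, ‖iteratedFDeriv ℝ n f x‖ ≤ C) : Tempered fun _ => f :=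
  ⟨fun _ => hf, fun n => by
    obtain ⟨C, hC⟩ := hb n
    exact ⟨C, 0, fun k x => by simpa using hC x⟩⟩

theorem const {c : ℕ → F} {C : ℝ} {M : ℕ} (h : ∀ k, ‖c k‖ ≤ C * ((k : ℝ) + 1) ^ M) :
    Tempered fun k (_ : E) => c k :=
  ⟨fun _ => contDiff_const, fun n => by
    rcases Nat.eq_zero_or_pos n with rfl | hn
    · exact ⟨C, M, fun k x => by simpa using h k⟩
    · exact ⟨0, 0, fun k x => by simp [iteratedFDeriv_const_of_ne hn.ne']⟩⟩

theorem const' (c : F) : Tempered fun _ (_ : E) => c :=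
  const (C := ‖c‖) (M := 0) fun k => by simp

theorem add {u v : ℕ → E → F} (hu : Tempered u) (hv : Tempered v) :
    Tempered fun k x => u k x + v k x :=
  ⟨fun k => (hu.1 k).add (hv.1 k), fun n => by
    obtain ⟨C, M, hC, h⟩ := hu.uniform_bound n
    obtain ⟨D, P, hD, h'⟩ := hv.uniform_bound n
    refine ⟨C + D, M + P, fun k x => ?_⟩
    have h1 : (1 : ℝ) ≤ (k : ℝ) + 1 := by have := Nat.cast_nonneg (α := ℝ) k; linarith
    have e := iteratedFDeriv_add_apply (x := x) ((hu.1 k).contDiffAt.of_le (m := n) (mod_cast le_top))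
      ((hv.1 k).contDiffAt.of_le (m := n) (mod_cast le_top))
    change ‖iteratedFDeriv ℝ n (u k + v k) x‖ ≤ _
    rw [e, add_mul]
    refine (norm_add_le _ _).trans (add_le_add ((h n le_rfl k x).trans ?_)
      ((h' n le_rfl k x).trans ?_)) <;>
    exact mul_le_mul_of_nonneg_left (pow_le_pow_right₀ h1 (by omega)) ‹_›⟩

theorem mul {A : Type} [NormedRing A] [NormedAlgebra ℝ A] {u v : ℕ → E → A} (hu : Tempered u)
    (hv : Tempered v) : Tempered fun k x => u k x * v k x :=
  ⟨fun k => (hu.1 k).mul (hv.1 k), fun n => by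
    obtain ⟨C, M, hC, h⟩ := hu.uniform_bound n
    obtain ⟨D, P, hD, h'⟩ := hv.uniform_bound n
    refine ⟨∑ i ∈ Finset.range (n + 1), (n.choose i : ℝ) * (C * D), M + P, fun k x => ?_⟩
    refine (norm_iteratedFDeriv_mul_le (hu.1 k) (hv.1 k) x (mod_cast le_top)).trans ?_
    rw [Finset.sum_mul]
    refine Finset.sum_le_sum fun i hi => ?_
    have hi' : i ≤ n := by simpa [Nat.lt_succ_iff] using hi
    rw [mul_assoc, mul_assoc]
    refine mul_le_mul_of_nonneg_left ?_ (by positivity)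
    calc _ ≤ (C * ((k : ℝ) + 1) ^ M) * (D * ((k : ℝ) + 1) ^ P) :=
          mul_le_mul (h i hi' k x) (h' _ (Nat.sub_le _ _) k x) (norm_nonneg _) (by positivity)
      _ = _ := by ring⟩

theorem sum {ι : Type} (s : Finset ι) {u : ι → ℕ → E → F} (hu : ∀ i ∈ s, Tempered (u i)) :
    Tempered fun k x => ∑ i ∈ s, u i k x := by
  classical
  induction s using Finset.induction_on with
  | empty => simpa using const' (0 : F)
  | insert a s ha ih =>
    simp only [Finset.sum_insert ha]
    exact (hu a (by simp)).add (ih fun i hi => hu i (by simp [hi]))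

theorem prod {ι : Type} {A : Type} [NormedCommRing A] [NormedAlgebra ℝ A] (s : Finset ι)
    {u : ι → ℕ → E → A} (hu : ∀ i ∈ s, Tempered (u i)) :
    Tempered fun k x => ∏ i ∈ s, u i k x := by
  classical
  induction s using Finset.induction_on with
  | empty => simpa using const' (1 : A)
  | insert a s ha ih =>
    simp only [Finset.prod_insert ha]
    exact (hu a (by simp)).mul (ih fun i hi => hu i (by simp [hi]))

theorem clm_comp {u : ℕ → E → F} (hu : Tempered u) (L : F →L[ℝ] G) :
    Tempered fun k x => L (u k x) :=
  ⟨fun k => L.contDiff.comp (hu.1 k), fun n => by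
    obtain ⟨C, M, h⟩ := hu.2 n
    refine ⟨‖L‖ * C, M, fun k x => ?_⟩
    rw [mul_assoc]
    exact (L.norm_iteratedFDeriv_comp_left ((hu.1 k).contDiffAt.of_le (mod_cast le_top)) le_rfl).trans
      (mul_le_mul_of_nonneg_left (h k x) (norm_nonneg _))⟩

theorem comp_clm {u : ℕ → F → G} (hu : Tempered u) (L : E →L[ℝ] F) :
    Tempered fun k x => u k (L x) :=
  ⟨fun k => (hu.1 k).comp L.contDiff, fun n => by
    obtain ⟨C, M, h⟩ := hu.2 n
    refine ⟨C * ‖L‖ ^ n, M, fun k x => ?_⟩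
    have e := L.iteratedFDeriv_comp_right (hu.1 k) x (i := n) (mod_cast le_top)
    change ‖iteratedFDeriv ℝ n (u k ∘ L) x‖ ≤ _
    rw [e]
    refine (ContinuousMultilinearMap.norm_compContinuousLinearMap_le _ _).trans ?_
    simp only [Finset.prod_const, Finset.card_univ, Fintype.card_fin]
    calc _ ≤ (C * ((k : ℝ) + 1) ^ M) * ‖L‖ ^ n :=
          mul_le_mul_of_nonneg_right (h k _) (by positivity)
      _ = _ := by ring⟩

theorem comp_bounded {u : ℕ → E → F} (hu : Tempered u) {σ : F → G} (hσ : ContDiff ℝ (⊤ : ℕ∞) σ)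
    (hb : ∀ n : ℕ, ∃ C, ∀ x, ‖iteratedFDeriv ℝ n σ x‖ ≤ C) : Tempered fun k x => σ (u k x) :=
  ⟨fun k => hσ.comp (hu.1 k), fun n => by
    obtain ⟨C, M, hC, h⟩ := hu.uniform_bound n
    obtain ⟨D, P, hD, h'⟩ := (of_bounded hσ hb).uniform_bound n
    refine ⟨n.factorial * D * (C + 1) ^ n, M * n, fun k x => ?_⟩
    have h1 : (1 : ℝ) ≤ (k : ℝ) + 1 := by have := Nat.cast_nonneg (α := ℝ) k; linarith
    have key := norm_iteratedFDeriv_comp_le (N := (⊤ : ℕ∞)) hσ (hu.1 k) (n := n) (mod_cast le_top) x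
      (C := D) (D := (C + 1) * ((k : ℝ) + 1) ^ M)
      (fun i hi => by simpa using h' i hi 0 (u k x)) (fun i hi hin => ?_)
    · refine key.trans (le_of_eq ?_)
      rw [mul_pow, ← pow_mul]; ring
    · have h2 : (1 : ℝ) ≤ (C + 1) * ((k : ℝ) + 1) ^ M := by
        nlinarith [one_le_pow₀ h1 (n := M)]
      refine (h i hin k x).trans ((mul_le_mul_of_nonneg_right (by linarith) (by positivity)).trans
        (le_self_pow₀ h2 (by omega)))⟩

end Tempered

/-- Differentiation under the integral sign, with control of all derivatives. -/
theorem contDiff_integral_and_bound {E : Type} [NormedAddCommGroup E] [NormedSpace ℝ E] (a b : ℝ) (n : ℕ) :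
    ∀ {F : Type} [NormedAddCommGroup F] [NormedSpace ℝ F]
      {g : ℝ × E → F}, ContDiff ℝ (⊤ : ℕ∞) g →
      (∀ j : ℕ, ∃ C, ∀ p, ‖iteratedFDeriv ℝ j g p‖ ≤ C) →
      ContDiff ℝ n (fun x => ∫ t in a..b, g (t, x)) ∧
      ∀ C, (∀ p, ‖iteratedFDeriv ℝ n g p‖ ≤ C) → ∀ x,
        ‖iteratedFDeriv ℝ n (fun x => ∫ t in a..b, g (t, x)) x‖ ≤ C * |b - a| := by
  have hder : ∀ {F : Type} [NormedAddCommGroup F] [NormedSpace ℝ F]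
      {g : ℝ × E → F}, ContDiff ℝ (⊤ : ℕ∞) g →
      (∀ j : ℕ, ∃ C, ∀ p, ‖iteratedFDeriv ℝ j g p‖ ≤ C) → ∀ x,
      HasFDerivAt (fun x => ∫ t in a..b, g (t, x))
        (∫ t in a..b, (fderiv ℝ g (t, x)).comp (ContinuousLinearMap.inr ℝ ℝ E)) x := by
    intro F _ _ g hg hb x
    obtain ⟨C, hC⟩ := hb 1
    have hcont : ∀ y : E, Continuous fun t : ℝ => g (t, y) := fun y =>
      hg.continuous.comp (by fun_prop)
    have hfc : Continuous (fderiv ℝ g) := hg.continuous_fderiv (by simp)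
    have hcont' : Continuous fun t : ℝ =>
        (fderiv ℝ g (t, x)).comp (ContinuousLinearMap.inr ℝ ℝ E) :=
      ((ContinuousLinearMap.compL ℝ E (ℝ × E) F).flip (ContinuousLinearMap.inr ℝ ℝ E)).continuous.comp
        (hfc.comp (by fun_prop))
    refine intervalIntegral.hasFDerivAt_integral_of_dominated_of_fderiv_le
      (bound := fun _ => C * ‖ContinuousLinearMap.inr ℝ ℝ E‖) (s := Set.univ)
      (F := fun y t => g (t, y))
      (F' := fun y t => (fderiv ℝ g (t, y)).comp (ContinuousLinearMap.inr ℝ ℝ E)) univ_mem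
      (Eventually.of_forall fun y => (hcont y).aestronglyMeasurable)
      ((hcont x).intervalIntegrable _ _) hcont'.aestronglyMeasurable
      (MeasureTheory.ae_of_all _ fun t _ y _ => ?_) (by simp) (MeasureTheory.ae_of_all _ fun t _ y _ => ?_)
    · refine (ContinuousLinearMap.opNorm_comp_le _ _).trans
        (mul_le_mul_of_nonneg_right ?_ (norm_nonneg _))
      rw [← norm_iteratedFDeriv_one]; exact hC _
    · have h1 := (hg.differentiable (by simp) (t, y)).hasFDerivAt
      exact h1.comp y (hasFDerivAt_prodMk_right t y)
  induction n with
  | zero =>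
    intro F _ _ g hg hb
    refine ⟨?_, fun C hC x => ?_⟩
    · rw [Nat.cast_zero, contDiff_zero]
      exact continuous_iff_continuousAt.2 fun x => (hder hg hb x).continuousAt
    · simp only [norm_iteratedFDeriv_zero] at hC ⊢
      exact intervalIntegral.norm_integral_le_of_norm_le_const fun t _ => hC _
  | succ n ih =>
    intro F _ _ g hg hb
    let L : ((ℝ × E) →L[ℝ] F) →L[ℝ] (E →L[ℝ] F) :=
      (ContinuousLinearMap.compL ℝ E (ℝ × E) F).flip (ContinuousLinearMap.inr ℝ ℝ E)
    have hL : ‖L‖ ≤ 1 := by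
      refine ContinuousLinearMap.opNorm_le_bound _ zero_le_one fun φ => ?_
      rw [one_mul]
      refine ContinuousLinearMap.opNorm_le_bound _ (norm_nonneg _) fun y => ?_
      change ‖φ (0, y)‖ ≤ _
      refine (φ.le_opNorm _).trans (mul_le_mul_of_nonneg_left ?_ (norm_nonneg _))
      simp [Prod.norm_def]
    have hg' : ContDiff ℝ (⊤ : ℕ∞) (fderiv ℝ g) := hg.fderiv_right (by simp)
    have hbound : ∀ (j : ℕ) (C : ℝ), (∀ p, ‖iteratedFDeriv ℝ (j + 1) g p‖ ≤ C) →
        ∀ p, ‖iteratedFDeriv ℝ j (fun p => L (fderiv ℝ g p)) p‖ ≤ C := fun j C hC p => by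
      refine (L.norm_iteratedFDeriv_comp_left 
        (hg'.contDiffAt.of_le (mod_cast le_top)) le_rfl).trans ?_
      rw [norm_iteratedFDeriv_fderiv]
      exact (mul_le_of_le_one_left (norm_nonneg _) hL).trans (hC p)
    have hI := ih (g := fun p => L (fderiv ℝ g p)) (L.contDiff.comp hg') fun j => by
      obtain ⟨C, hC⟩ := hb (j + 1)
      exact ⟨C, hbound j C hC⟩
    have hfd : fderiv ℝ (fun x => ∫ t in a..b, g (t, x)) =
        fun x => ∫ t in a..b, L (fderiv ℝ g (t, x)) := funext fun x => (hder hg hb x).fderiv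
    refine ⟨?_, fun C hC x => ?_⟩
    · rw [Nat.cast_succ, contDiff_succ_iff_fderiv]
      refine ⟨fun x => (hder hg hb x).differentiableAt, by simp, ?_⟩
      rw [hfd]; exact hI.1
    · rw [← norm_iteratedFDeriv_fderiv, hfd]
      exact hI.2 C (hbound n C hC) x

theorem Tempered.integral {E F : Type} [NormedAddCommGroup E] [NormedSpace ℝ E]
    [NormedAddCommGroup F] [NormedSpace ℝ F] (a b : ℝ) {u : ℕ → ℝ × E → F} (hu : Tempered u) :
    Tempered fun k x => ∫ t in a..b, u k (t, x) := by
  have hb : ∀ k (j : ℕ), ∃ C, ∀ p, ‖iteratedFDeriv ℝ j (u k) p‖ ≤ C := fun k j => by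
    obtain ⟨C, M, h⟩ := hu.2 j
    exact ⟨_, h k⟩
  refine ⟨fun k => contDiff_infty.2 fun n => (contDiff_integral_and_bound a b n (hu.1 k) (hb k)).1,
    fun n => ?_⟩
  obtain ⟨C, M, h⟩ := hu.2 n
  refine ⟨C * |b - a|, M, fun k x => ?_⟩
  refine ((contDiff_integral_and_bound a b n (hu.1 k) (hb k)).2 _ (h k) x).trans (le_of_eq (by ring))

theorem bounded_iteratedFDeriv_of_hasCompactSupport {E F : Type} [NormedAddCommGroup E]
    [NormedSpace ℝ E] [NormedAddCommGroup F] [NormedSpace ℝ F] {f : E → F}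
    (hf : ContDiff ℝ (⊤ : ℕ∞) f) (hc : HasCompactSupport f) (n : ℕ) :
    ∃ C, ∀ x, ‖iteratedFDeriv ℝ n f x‖ ≤ C :=
  (hc.iteratedFDeriv n).exists_bound_of_continuous
    (hf.continuous_iteratedFDeriv (mod_cast le_top))

theorem norm_det_le {ι : Type} [Fintype ι] [DecidableEq ι] {A : Matrix ι ι ℂ} {B : ℝ}
    (h : ∀ i j, ‖A i j‖ ≤ B) : ‖A.det‖ ≤ (Fintype.card ι).factorial * B ^ Fintype.card ι := by
  have := Matrix.det_le (abv := NormedField.toAbsoluteValue ℂ) (A := A) (x := B) h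
  rw [nsmul_eq_mul] at this
  exact this

theorem norm_adjugate_le {ι : Type} [Fintype ι] [DecidableEq ι] {A : Matrix ι ι ℂ} {B : ℝ}
    (hB : 1 ≤ B) (h : ∀ i j, ‖A i j‖ ≤ B) (i j : ι) :
    ‖A.adjugate i j‖ ≤ (Fintype.card ι).factorial * B ^ Fintype.card ι := by
  rw [Matrix.adjugate_apply]
  refine norm_det_le fun a b => ?_
  rw [Matrix.updateRow_apply]
  split_ifs with hab
  · rw [Pi.single_apply]; split_ifs <;> simp <;> linarith
  · exact h a b

/-- The matrix of `X ↦ W X Wᴴ`. -/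
def steinMatrix {d : ℕ} (W : Matrix (Fin d) (Fin d) ℂ) :
    Matrix (Fin d × Fin d) (Fin d × Fin d) ℂ :=
  Matrix.of fun a b => W a.1 b.1 * star (W a.2 b.2)

theorem steinMatrix_mulVec {d : ℕ} (W : Matrix (Fin d) (Fin d) ℂ) (u : Fin d → ℂ) :
    steinMatrix W *ᵥ (fun a => u a.1 * star (u a.2)) =
      fun a => (W *ᵥ u) a.1 * star ((W *ᵥ u) a.2) := by
  funext a
  simp only [steinMatrix, Matrix.mulVec, dotProduct, Matrix.of_apply, Fintype.sum_prod_type,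
    star_sum, star_mul', Finset.sum_mul_sum]
  exact Finset.sum_congr rfl fun i _ => Finset.sum_congr rfl fun j _ => by ring

theorem stein_resolvent_bound {d : ℕ} {B R ε : ℝ} (hB : 1 ≤ B) (hR : 1 ≤ R)
    {W : Matrix (Fin d) (Fin d) ℂ} (hW : ∀ i j, ‖W i j‖ ≤ B) {z : ℂ} (hz : ‖z‖ ≤ R)
    (hε : 0 < ε) (hε1 : ε ≤ 1)
    (hp : ε ≤ ‖((steinMatrix W).charpoly.eval ((‖z‖ : ℂ) ^ 2))‖) :
    ε ^ d ≤ d.factorial * (((d * d).factorial * (R ^ 2 + B * B) ^ (d * d)) * (d * d) *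
      (2 * R + 1) + 1) ^ d * ‖(scalar (Fin d) z - W).det‖ := by
  set M := scalar (Fin d) z - W with hM
  set N := scalar (Fin d × Fin d) ((‖z‖ : ℂ) ^ 2) - steinMatrix W with hN
  set K : ℝ := (d * d).factorial * (R ^ 2 + B * B) ^ (d * d) with hK
  rw [Matrix.eval_charpoly] at hp
  have hK0 : 0 ≤ K := by positivity
  have hzz : (‖z‖ : ℂ) ^ 2 = z * star z := by
    rw [Complex.star_def, Complex.mul_conj, Complex.normSq_eq_norm_sq]; push_cast; rfl
  have hNadj : ∀ a b, ‖N.adjugate a b‖ ≤ K := fun a b => by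
    refine (norm_adjugate_le (B := R ^ 2 + B * B) (by nlinarith) (fun i j => ?_) a b).trans
      (le_of_eq (by simp [hK]))
    rw [hN, Matrix.sub_apply]
    refine (norm_sub_le _ _).trans (add_le_add ?_ ?_)
    · rw [Matrix.scalar_apply, Matrix.diagonal_apply]
      split_ifs
      · simp only [norm_pow, Complex.norm_real, norm_norm]
        exact pow_le_pow_left₀ (norm_nonneg _) hz 2
      · simp; positivity
    · simp only [steinMatrix, Matrix.of_apply, norm_mul, norm_star]
      exact mul_le_mul (hW _ _) (hW _ _) (norm_nonneg _) (by linarith)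
  have key : ∀ u e : Fin d → ℂ, M *ᵥ u = e → ∀ i, N.det * (u i * star (u i)) =
      ∑ a : Fin d × Fin d, N.adjugate (i, i) a *
        (z * u a.1 * star (e a.2) + e a.1 * star (z * u a.2) - e a.1 * star (e a.2)) := by
    intro u e he i
    have hWu : W *ᵥ u = fun a => z * u a - e a := by
      rw [← he, hM, Matrix.sub_mulVec]
      funext a
      simp [Matrix.scalar_apply]
    have h1 : N *ᵥ (fun a => u a.1 * star (u a.2)) = fun a : Fin d × Fin d =>
        z * u a.1 * star (e a.2) + e a.1 * star (z * u a.2) - e a.1 * star (e a.2) := by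
      rw [hN, Matrix.sub_mulVec, steinMatrix_mulVec, hWu]
      funext a
      simp only [Matrix.scalar_apply, Pi.sub_apply, Matrix.mulVec_diagonal, hzz, star_sub,
        star_mul']
      ring
    have h2 := congrArg (fun v => (N.adjugate *ᵥ v) (i, i)) h1
    simp only [Matrix.mulVec_mulVec, Matrix.adjugate_mul, Matrix.smul_mulVec, Matrix.one_mulVec,
      Pi.smul_apply, smul_eq_mul] at h2
    rw [h2]; rfl
  have hNdet : N.det ≠ 0 := fun h => by rw [h, norm_zero] at hp; linarith
  have hMdet : M.det ≠ 0 := fun h => by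
    obtain ⟨u, hu, hMu⟩ := Matrix.exists_mulVec_eq_zero_iff.2 h
    obtain ⟨i, hi⟩ := Function.ne_iff.1 hu
    have := key u 0 hMu i
    simp [hNdet] at this
    exact hi this
  have hinv : ∀ i b, ‖M⁻¹ i b‖ ≤ (K * (d * d) * (2 * R + 1) + 1) / ε := fun i b => by
    set u : Fin d → ℂ := fun a => M⁻¹ a b with hu
    have hMu : M *ᵥ u = Pi.single b 1 := by
      have : M *ᵥ u = fun a => (M * M⁻¹) a b := rfl
      rw [this, Matrix.mul_nonsing_inv _ (isUnit_iff_ne_zero.2 hMdet)]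
      funext a; simp [Matrix.one_apply, Pi.single_apply]
    have hsingle : ∀ a, ‖(Pi.single b 1 : Fin d → ℂ) a‖ ≤ 1 := fun a => by
      rw [Pi.single_apply]; split_ifs <;> simp
    have : Nonempty (Fin d) := ⟨b⟩
    obtain ⟨i₀, hi₀⟩ := Finite.exists_max fun a => ‖u a‖
    refine (hi₀ i).trans ?_
    set U := ‖u i₀‖
    have hU0 : 0 ≤ U := norm_nonneg _
    have h1 : ε * U ^ 2 ≤ K * (d * d) * (2 * R * U + 1) := by
      have := congrArg norm (key u _ hMu i₀)
      rw [norm_mul, norm_mul, norm_star, ← sq] at this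
      refine (mul_le_mul_of_nonneg_right hp (sq_nonneg _)).trans ?_
      rw [this]
      refine (norm_sum_le_of_le _ (f := fun a => _) (n := fun _ => K * (2 * R * U + 1)) fun a _ => ?_).trans
        (le_of_eq (by simp; ring))
      rw [norm_mul]
      refine mul_le_mul (hNadj _ _) ?_ (norm_nonneg _) hK0
      have hzU : ∀ a, ‖z * u a‖ ≤ R * U := fun a => by
        rw [norm_mul]; exact mul_le_mul hz (hi₀ a) (norm_nonneg _) (by linarith)
      have e1 : ‖z * u a.1 * star ((Pi.single b 1 : Fin d → ℂ) a.2)‖ ≤ R * U * 1 := by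
        rw [norm_mul, norm_star]
        exact mul_le_mul (hzU _) (hsingle _) (norm_nonneg _) (by positivity)
      have e2 : ‖(Pi.single b 1 : Fin d → ℂ) a.1 * star (z * u a.2)‖ ≤ 1 * (R * U) := by
        rw [norm_mul, norm_star]
        exact mul_le_mul (hsingle _) (hzU _) (norm_nonneg _) (by positivity)
      have e3 : ‖(Pi.single b 1 : Fin d → ℂ) a.1 * star ((Pi.single b 1 : Fin d → ℂ) a.2)‖ ≤ 1 * 1 := by
        rw [norm_mul, norm_star]
        exact mul_le_mul (hsingle _) (hsingle _) (norm_nonneg _) (by positivity)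
      refine (norm_sub_le _ _).trans ?_
      have := norm_add_le (z * u a.1 * star ((Pi.single b 1 : Fin d → ℂ) a.2))
        ((Pi.single b 1 : Fin d → ℂ) a.1 * star (z * u a.2))
      linarith
    rw [le_div_iff₀ hε]
    have hKd : 0 ≤ K * (d * d) := by positivity
    rcases le_total U 1 with hU | hU
    · nlinarith [mul_nonneg hKd (by linarith : (0 : ℝ) ≤ 2 * R + 1)]
    · have h2 : U * (ε * U) ≤ U * (K * (d * d) * (2 * R + 1)) := by
        have : K * (d * d) * (2 * R * U + 1) ≤ K * (d * d) * (2 * R * U + U) :=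
          mul_le_mul_of_nonneg_left (by linarith) hKd
        nlinarith
      have := le_of_mul_le_mul_left h2 (by linarith)
      linarith
  have hdet := norm_det_le hinv
  have hone : ‖M.det‖ * ‖(M⁻¹).det‖ = 1 := by
    rw [← norm_mul, ← Matrix.det_mul, Matrix.mul_nonsing_inv _ (isUnit_iff_ne_zero.2 hMdet)]
    simp
  rw [Fintype.card_fin, div_pow, ← mul_div_assoc, le_div_iff₀ (by positivity)] at hdet
  calc ε ^ d = ‖M.det‖ * (‖(M⁻¹).det‖ * ε ^ d) := by rw [← mul_assoc, hone, one_mul]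
    _ ≤ ‖M.det‖ * _ := mul_le_mul_of_nonneg_left hdet (norm_nonneg _)
    _ = _ := by ring

/-- A monic polynomial of degree `n` cannot be small at all of `n + 1` separated points. -/
theorem exists_large_value_of_monic {n : ℕ} {p : Polynomial ℂ} (hp : p.Monic)
    (hn : p.natDegree = n) {x : ℕ → ℂ} {δ : ℝ} (hδ : 0 < δ)
    (hx : ∀ i j, i ≠ j → δ ≤ ‖x i - x j‖) :
    ∃ h ∈ Finset.range (n + 1), δ ^ n / (n + 1) ≤ ‖p.eval (x h)‖ := by
  by_contra! hcon
  have hinj : Set.InjOn x (Finset.range (n + 1) : Set ℕ) := fun i _ j _ hij => by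
    by_contra hne
    have := hx i j hne
    rw [hij, sub_self, norm_zero] at this
    linarith
  have h1 := Lagrange.leadingCoeff_eq_sum (s := Finset.range (n + 1)) hinj (P := p) (by
    rw [Polynomial.degree_eq_natDegree hp.ne_zero, hn]; simp)
  rw [hp.leadingCoeff] at h1
  have h2 : ‖(1 : ℂ)‖ < ∑ i ∈ Finset.range (n + 1), (1 : ℝ) / (n + 1) := by
    rw [h1]
    refine (norm_sum_le _ _).trans_lt (Finset.sum_lt_sum_of_nonempty ⟨0, by simp⟩ fun i hi => ?_)
    have hprod : δ ^ n ≤ ‖∏ j ∈ (Finset.range (n + 1)).erase i, (x i - x j)‖ := by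
      rw [norm_prod]
      calc δ ^ n = ∏ j ∈ (Finset.range (n + 1)).erase i, δ := by
            rw [Finset.prod_const, Finset.card_erase_of_mem hi, Finset.card_range]; simp
        _ ≤ _ := Finset.prod_le_prod (fun _ _ => hδ.le) fun j hj =>
          hx i j (Finset.ne_of_mem_erase hj).symm
    have hpos : 0 < δ ^ n := by positivity
    rw [norm_div, div_lt_iff₀ (hpos.trans_le hprod)]
    refine (hcon i hi).trans_le ?_
    rw [one_div, div_eq_inv_mul]
    exact mul_le_mul_of_nonneg_left hprod (by positivity)
  simp at h2
  rw [mul_inv_cancel₀ (by positivity)] at h2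
  exact lt_irrefl _ h2

/-- A smooth step function, `0` for `s ≤ 1 / 2` and `1` for `1 ≤ s`. -/
def smoothStep (s : ℝ) : ℝ := Real.smoothTransition (2 * s - 1)

theorem contDiff_smoothStep : ContDiff ℝ (⊤ : ℕ∞) smoothStep :=
  Real.smoothTransition.contDiff.comp (by fun_prop)

theorem smoothStep_of_le {s : ℝ} (h : s ≤ 1 / 2) : smoothStep s = 0 :=
  Real.smoothTransition.zero_of_nonpos (by linarith)

theorem smoothStep_of_ge {s : ℝ} (h : 1 ≤ s) : smoothStep s = 1 :=
  Real.smoothTransition.one_of_one_le (by linarith)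

/-- A smooth function equal to `s⁻¹` for `1 ≤ s`. -/
def smoothInv (s : ℝ) : ℝ := smoothStep s * s⁻¹

theorem smoothInv_of_ge {s : ℝ} (h : 1 ≤ s) : smoothInv s = s⁻¹ := by
  rw [smoothInv, smoothStep_of_ge h, one_mul]

theorem contDiff_smoothInv : ContDiff ℝ (⊤ : ℕ∞) smoothInv := by
  refine contDiff_iff_contDiffAt.2 fun s => ?_
  rcases lt_or_ge s (1 / 2) with h | h
  · refine (contDiffAt_const (c := (0 : ℝ))).congr_of_eventuallyEq ?_
    filter_upwards [gt_mem_nhds h] with t ht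
    rw [smoothInv, smoothStep_of_le ht.le, zero_mul]
  · exact contDiff_smoothStep.contDiffAt.mul (contDiffAt_inv ℝ (by linarith))

/-- Boundedness of the derivatives of a function vanishing on the left and explicit on the right. -/
theorem bounded_iteratedFDeriv_of_right {f g : ℝ → ℝ} (hf : ContDiff ℝ (⊤ : ℕ∞) f)
    (h0 : ∀ s ≤ 1 / 2, f s = 0) (h1 : ∀ s, 1 ≤ s → f s = g s) {n : ℕ} {C : ℝ}
    (hg : ∀ s, 1 ≤ s → |iteratedDeriv n g s| ≤ C) : ∃ C, ∀ s, ‖iteratedFDeriv ℝ n f s‖ ≤ C := by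
  obtain ⟨B, hB⟩ := (isCompact_Icc (a := (0 : ℝ)) (b := 2)).exists_bound_of_continuousOn
    (hf.continuous_iteratedFDeriv (m := n) (mod_cast le_top)).continuousOn
  refine ⟨max B (max C 0), fun s => ?_⟩
  rcases le_or_gt 0 s with hs | hs
  · rcases le_or_gt s 1 with hs1 | hs1
    · exact (hB s ⟨hs, by linarith⟩).trans (le_max_left _ _)
    · have e : f =ᶠ[𝓝 s] g := by filter_upwards [lt_mem_nhds hs1] with t ht using h1 t ht.le
      rw [(e.iteratedFDeriv ℝ n).eq_of_nhds, norm_iteratedFDeriv_eq_norm_iteratedDeriv]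
      exact (hg s hs1.le).trans ((le_max_left _ _).trans (le_max_right _ _))
  · have e : f =ᶠ[𝓝 s] fun _ => 0 := by
      filter_upwards [gt_mem_nhds hs] with t ht using h0 t (by linarith)
    rw [(e.iteratedFDeriv ℝ n).eq_of_nhds]
    have : iteratedFDeriv ℝ n (fun _ : ℝ => (0 : ℝ)) s = 0 := by simp
    rw [this, norm_zero]
    exact (le_max_right _ _).trans (le_max_right _ _)

theorem bounded_smoothStep (n : ℕ) : ∃ C, ∀ s, ‖iteratedFDeriv ℝ n smoothStep s‖ ≤ C :=
  bounded_iteratedFDeriv_of_right (g := fun _ => 1) (C := 1) contDiff_smoothStep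
    (fun _ => smoothStep_of_le) (fun _ => smoothStep_of_ge) fun s _ => by
    rw [iteratedDeriv_const]; split_ifs <;> simp

theorem bounded_smoothInv (n : ℕ) : ∃ C, ∀ s, ‖iteratedFDeriv ℝ n smoothInv s‖ ≤ C :=
  bounded_iteratedFDeriv_of_right (g := fun s => s⁻¹) (C := n.factorial) contDiff_smoothInv
    (fun s hs => by rw [smoothInv, smoothStep_of_le hs, zero_mul]) (fun _ => smoothInv_of_ge)
    fun s hs => by
    rw [iteratedDeriv_eq_iterate, iter_deriv_inv, abs_mul, abs_mul, abs_pow, abs_neg, abs_one, one_pow, one_mul,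
      Nat.abs_cast]
    refine mul_le_of_le_one_right (by positivity) ?_
    rw [abs_zpow, abs_of_pos (by linarith)]
    exact zpow_le_one_of_nonpos₀ hs (by omega)

theorem iteratedDeriv_cexp_ofReal (c : ℂ) (n : ℕ) :
    iteratedDeriv n (fun θ : ℝ => Complex.exp (c * θ)) = fun θ : ℝ => c ^ n * Complex.exp (c * θ) := by
  induction n with
  | zero => simp
  | succ n ih =>
    rw [iteratedDeriv_succ, ih]
    funext θ
    have h : HasDerivAt (fun θ : ℝ => Complex.exp (c * θ)) (Complex.exp (c * θ) * (c * 1)) θ :=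
      (((hasDerivAt_id (θ : ℂ)).const_mul c).cexp).comp_ofReal
    rw [(h.const_mul (c ^ n)).deriv]; ring

namespace Tempered

variable {E : Type} [NormedAddCommGroup E] [NormedSpace ℝ E]

theorem pow {A : Type} [NormedCommRing A] [NormedAlgebra ℝ A] {u : ℕ → E → A} (hu : Tempered u)
    (n : ℕ) : Tempered fun k x => u k x ^ n := by
  simpa using prod (Finset.range n) (u := fun _ => u) fun _ _ => hu

theorem sub {F : Type} [NormedAddCommGroup F] [NormedSpace ℝ F] {u v : ℕ → E → F}
    (hu : Tempered u) (hv : Tempered v) : Tempered fun k x => u k x - v k x := by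
  simpa [sub_eq_add_neg] using hu.add (hv.clm_comp (-ContinuousLinearMap.id ℝ F))

theorem ofReal {u : ℕ → E → ℝ} (hu : Tempered u) : Tempered fun k x => (u k x : ℂ) :=
  hu.clm_comp Complex.ofRealCLM

theorem conj {u : ℕ → E → ℂ} (hu : Tempered u) : Tempered fun k x => star (u k x) :=
  hu.clm_comp Complex.conjCLE.toContinuousLinearMap

theorem normSq {u : ℕ → E → ℂ} (hu : Tempered u) : Tempered fun k x => Complex.normSq (u k x) := by
  have h := (hu.mul hu.conj).clm_comp Complex.reCLM
  refine (funext fun k => funext fun x => ?_ : _ = fun k x => Complex.normSq (u k x)) ▸ h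
  simp [Complex.normSq_apply]

theorem det {ι : Type} [Fintype ι] [DecidableEq ι] {A : ℕ → E → Matrix ι ι ℂ}
    (hA : ∀ i j, Tempered fun k x => A k x i j) : Tempered fun k x => (A k x).det := by
  simp only [Matrix.det_apply']
  exact sum _ fun τ _ => (const' _).mul (prod _ fun i _ => hA _ _)

theorem adjugate {ι : Type} [Fintype ι] [DecidableEq ι] {A : ℕ → E → Matrix ι ι ℂ}
    (hA : ∀ i j, Tempered fun k x => A k x i j) (i j : ι) :
    Tempered fun k x => (A k x).adjugate i j := by
  simp only [Matrix.adjugate_apply]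
  refine det fun a b => ?_
  simp only [Matrix.updateRow_apply]
  split_ifs
  · exact const' _
  · exact hA a b

theorem scalar_sub {ι : Type} [Fintype ι] [DecidableEq ι] {A : ℕ → E → Matrix ι ι ℂ} {z : ℕ → E → ℂ}
    (hz : Tempered z) (hA : ∀ i j, Tempered fun k x => A k x i j) (i j : ι) :
    Tempered fun k x => (Matrix.scalar ι (z k x) - A k x) i j := by
  simp only [Matrix.sub_apply, Matrix.scalar_apply, Matrix.diagonal_apply]
  refine sub ?_ (hA i j)
  split_ifs
  · exact hz
  · exact const' _

theorem cexp_mul (a : ℕ) : Tempered fun (k : ℕ) (θ : ℝ) =>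
    Complex.exp (((k : ℂ) * a + 1) * θ * Complex.I) := by
  have e : ∀ k : ℕ, (fun θ : ℝ => Complex.exp (((k : ℂ) * a + 1) * θ * Complex.I)) =
      fun θ : ℝ => Complex.exp ((((k : ℝ) * a + 1 : ℝ) * Complex.I : ℂ) * θ) := fun k => by
    funext θ; congr 1; push_cast; ring
  refine ⟨fun k => ?_, fun n => ⟨((a : ℝ) + 1) ^ n, n, fun k θ => ?_⟩⟩
  · beta_reduce
    rw [e]
    exact Complex.contDiff_exp.comp (contDiff_const.mul Complex.ofRealCLM.contDiff)
  · beta_reduce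
    rw [e, norm_iteratedFDeriv_eq_norm_iteratedDeriv, iteratedDeriv_cexp_ofReal, norm_mul, norm_pow]
    have h1 : ‖Complex.exp ((((k : ℝ) * a + 1 : ℝ) * Complex.I : ℂ) * θ)‖ = 1 := by
      rw [Complex.norm_exp]; simp
    rw [h1, mul_one, ← mul_pow, norm_mul, Complex.norm_I, mul_one, Complex.norm_real,
      Real.norm_of_nonneg (by positivity)]
    gcongr
    have := Nat.cast_nonneg (α := ℝ) k
    have := Nat.cast_nonneg (α := ℝ) a
    nlinarith

end Tempered

theorem sum_smooth_partition (η : ℕ → ℝ) (D : ℕ) :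
    ∑ h ∈ Finset.range D, η h * ∏ l ∈ Finset.range h, (1 - η l) =
      1 - ∏ h ∈ Finset.range D, (1 - η h) := by
  induction D with
  | zero => simp
  | succ D ih => rw [Finset.sum_range_succ, ih, Finset.prod_range_succ]; ring

/-- Cauchy's formula for powers, as an angular integral. -/
theorem integral_pow_div_sub {ρ : ℝ} {w : ℂ} (hw : ‖w‖ < ρ) (k : ℕ) :
    (1 / (2 * Real.pi) : ℂ) * ∫ θ in (0 : ℝ)..2 * Real.pi,
      ((ρ : ℂ) * Complex.exp (θ * Complex.I)) ^ (k + 1) / (ρ * Complex.exp (θ * Complex.I) - w)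
      = w ^ k := by
  have h := (Differentiable.diffContOnCl (𝕜 := ℂ) (f := fun z : ℂ => z ^ k) (s := Metric.ball (0 : ℂ) ρ)
    (by fun_prop)).circleIntegral_sub_inv_smul (w := w) (by simpa using hw)
  rw [circleIntegral] at h
  simp only [deriv_circleMap, circleMap, zero_add, smul_eq_mul] at h
  have e : ∀ θ : ℝ, (ρ : ℂ) * Complex.exp (θ * Complex.I) * Complex.I *
      ((ρ * Complex.exp (θ * Complex.I) - w)⁻¹ * (ρ * Complex.exp (θ * Complex.I)) ^ k) =
      Complex.I * (((ρ : ℂ) * Complex.exp (θ * Complex.I)) ^ (k + 1) /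
        (ρ * Complex.exp (θ * Complex.I) - w)) := fun θ => by rw [pow_succ]; ring
  simp only [e, intervalIntegral.integral_const_mul] at h
  have h2 : (∫ θ in (0 : ℝ)..2 * Real.pi, ((ρ : ℂ) * Complex.exp (θ * Complex.I)) ^ (k + 1) /
        (ρ * Complex.exp (θ * Complex.I) - w)) = 2 * Real.pi * w ^ k := by
    apply mul_left_cancel₀ Complex.I_ne_zero
    rw [h]; ring
  rw [h2]
  have : (Real.pi : ℂ) ≠ 0 := mod_cast Real.pi_ne_zero
  field_simp

theorem Tempered.steinMatrix {E : Type} [NormedAddCommGroup E] [NormedSpace ℝ E] {d : ℕ}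
    {W : ℕ → E → Matrix (Fin d) (Fin d) ℂ} (hW : ∀ i j, Tempered fun k x => W k x i j) (a b) :
    Tempered fun k x => _root_.steinMatrix (W k x) a b := by
  simp only [_root_.steinMatrix, Matrix.of_apply]
  exact (hW _ _).mul (hW _ _).conj

theorem dotProduct_adjugate_mulVec {d : ℕ} {W : Matrix (Fin d) (Fin d) ℂ} {v e : Fin d → ℂ}
    {w z : ℂ} (hv : v ᵥ* W = w • v) :
    (z - w) * (v ⬝ᵥ ((scalar (Fin d) z - W).adjugate *ᵥ e)) =
      (scalar (Fin d) z - W).det * (v ⬝ᵥ e) := by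
  set M := scalar (Fin d) z - W with hM
  have h1 : v ᵥ* M = (z - w) • v := by
    rw [hM, Matrix.vecMul_sub, hv, sub_smul]
    congr 1
    funext i
    simp [Matrix.scalar_apply, Matrix.vecMul_diagonal, mul_comm]
  rw [← smul_eq_mul, ← smul_dotProduct, ← h1, ← Matrix.dotProduct_mulVec, Matrix.mulVec_mulVec,
    Matrix.mul_adjugate, Matrix.smul_mulVec, Matrix.one_mulVec, dotProduct_smul, smul_eq_mul]

/-- Powers `w ^ k` of an eigenvalue in the unit disc are computed by temperate functions of the
matrix, even though other eigenvalues may be outside the disc. -/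
theorem exists_tempered_power {Λ : Type} [NormedAddCommGroup Λ] [NormedSpace ℝ Λ] {d : ℕ}
    {W : Λ → Matrix (Fin d) (Fin d) ℂ} (hW : ∀ i j, Tempered fun _ x => W x i j) (e : Fin d → ℂ) :
    ∃ c : ℕ → Λ → Fin d → ℂ, (∀ j, Tempered fun k x => c k x j) ∧
      ∀ x v w, ‖w‖ ≤ 1 → v ᵥ* W x = w • v → ∀ k, v ⬝ᵥ c k x = w ^ k * (v ⬝ᵥ e) := by
  obtain ⟨B, hB1, hB⟩ : ∃ B : ℝ, 1 ≤ B ∧ ∀ x i j, ‖W x i j‖ ≤ B := by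
    have : ∀ i j, ∃ B : ℝ, ∀ x, ‖W x i j‖ ≤ B := fun i j => by
      obtain ⟨C, M, h⟩ := (hW i j).2 0
      exact ⟨C, fun x => by simpa using h 0 x⟩
    choose B hB using this
    refine ⟨1 + ∑ i, ∑ j, |B i j|, ?_, fun x i j => ?_⟩
    · have : 0 ≤ ∑ i, ∑ j, |B i j| :=
        Finset.sum_nonneg fun _ _ => Finset.sum_nonneg fun _ _ => abs_nonneg _
      linarith
    · have h1 := Finset.single_le_sum (f := fun j => |B i j|) (fun _ _ => abs_nonneg _)
        (Finset.mem_univ j)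
      have h2 := Finset.single_le_sum (f := fun i => ∑ j, |B i j|)
        (fun _ _ => Finset.sum_nonneg fun _ _ => abs_nonneg _) (Finset.mem_univ i)
      have h3 := hB i j x
      have h4 := le_abs_self (B i j)
      exact (h3.trans h4).trans ((h1.trans h2).trans (by linarith))
  set D : ℕ := d * d + 1 with hD
  set R : ℝ := D + 1 with hR
  have hR1 : 1 ≤ R := by rw [hR]; linarith [Nat.cast_nonneg (α := ℝ) D]
  set Q : ℝ := d.factorial * (((d * d).factorial * (R ^ 2 + B * B) ^ (d * d)) * (d * d) *
      (2 * R + 1) + 1) ^ d with hQ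
  have hQ0 : 0 ≤ Q := by positivity
  set ρ : ℕ → ℕ → ℝ := fun h k => 1 + (h + 1) / (k + 1) with hρ
  have hρ1 : ∀ h k, 1 < ρ h k := fun h k => by
    have : (0 : ℝ) < (h + 1) / (k + 1) := by positivity
    simp only [hρ]; linarith
  have hρR : ∀ h < D, ∀ k, ρ h k ≤ R := fun h hh k => by
    have : ((h : ℝ) + 1) / (k + 1) ≤ D := by
      refine (div_le_self (by positivity) (by simp)).trans ?_
      exact_mod_cast hh
    simp only [hρ, hR]; linarith
  set P : ℕ → ℕ → Λ → ℂ := fun h k x => (steinMatrix (W x)).charpoly.eval ((ρ h k : ℂ) ^ 2) with hP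
  set ε : ℕ → ℝ := fun k => (D * ((k : ℝ) + 1) ^ (d * d))⁻¹ with hε
  have hD1 : (1 : ℝ) ≤ D := by rw [hD]; push_cast; nlinarith [Nat.cast_nonneg (α := ℝ) d]
  have hk1 : ∀ k : ℕ, (1 : ℝ) ≤ (k : ℝ) + 1 := fun k => by
    have := Nat.cast_nonneg (α := ℝ) k; linarith
  have hε0 : ∀ k, 0 < ε k := fun k => by simp only [hε]; positivity
  have hε1 : ∀ k, ε k ≤ 1 := fun k => by
    simp only [hε]
    exact inv_le_one_of_one_le₀ (one_le_mul_of_one_le_of_one_le hD1 (one_le_pow₀ (hk1 k)))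
  set η : ℕ → ℕ → Λ → ℝ := fun h k x =>
    smoothStep ((D * ((k : ℝ) + 1) ^ (d * d)) ^ 2 * Complex.normSq (P h k x)) with hη
  set ψ : ℕ → ℕ → Λ → ℝ := fun h k x => η h k x * ∏ l ∈ Finset.range h, (1 - η l k x) with hψ
  set L : ℕ → ℝ := fun k => (Q * (2 * (D * ((k : ℝ) + 1) ^ (d * d))) ^ d) ^ 2 with hL
  set z : ℕ → ℕ → ℝ × Λ → ℂ := fun h k p => ρ h k * Complex.exp (p.1 * Complex.I) with hz
  set A : ℕ → ℕ → ℝ × Λ → Matrix (Fin d) (Fin d) ℂ := fun h k p =>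
    scalar (Fin d) (z h k p) - W p.2 with hA
  set I : ℕ → Fin d → ℕ → ℝ × Λ → ℂ := fun h j k p =>
    z h k p ^ (k + 1) * ((A h k p).adjugate *ᵥ e) j * star (A h k p).det *
      (L k * smoothInv (L k * Complex.normSq (A h k p).det) : ℝ) with hI
  have hnormz : ∀ h k p, ‖z h k p‖ = ρ h k := fun h k p => by
    simp only [hz, norm_mul, Complex.norm_exp_ofReal_mul_I, mul_one, Complex.norm_real]
    exact Real.norm_of_nonneg (by linarith [hρ1 h k])
  -- some weight is active
  have hsum : ∀ k x, ∑ h ∈ Finset.range D, ψ h k x = 1 := fun k x => by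
    rw [sum_smooth_partition (fun h => η h k x)]
    obtain ⟨h, hh, hle⟩ := exists_large_value_of_monic (p := (steinMatrix (W x)).charpoly)
      (n := d * d) (Matrix.charpoly_monic _) (by simp [Matrix.charpoly_natDegree_eq_dim])
      (x := fun h => (ρ h k : ℂ) ^ 2) (δ := 1 / ((k : ℝ) + 1)) (by positivity) (fun i j hij => by
        have e1 : ((ρ i k : ℂ) ^ 2 - (ρ j k : ℂ) ^ 2) =
            (((i : ℝ) - j) / (k + 1) * (ρ i k + ρ j k) : ℝ) := by
          simp only [hρ]; push_cast; ring
        rw [e1, Complex.norm_real, Real.norm_eq_abs, abs_mul, abs_div,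
          abs_of_pos (by positivity : (0 : ℝ) < k + 1),
          abs_of_pos (by linarith [hρ1 i k, hρ1 j k] : 0 < ρ i k + ρ j k)]
        have e2 : (1 : ℝ) ≤ |(i : ℝ) - j| := by
          have : (1 : ℤ) ≤ |(i : ℤ) - j| := Int.one_le_abs (by omega)
          exact_mod_cast this
        have e3 : 1 / ((k : ℝ) + 1) ≤ |(i : ℝ) - j| / (k + 1) := by gcongr
        refine e3.trans (le_mul_of_one_le_right (by positivity) ?_)
        linarith [hρ1 i k, hρ1 j k])
    have h1 : η h k x = 1 := by
      simp only [hη]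
      refine smoothStep_of_ge ?_
      rw [Complex.normSq_eq_norm_sq, ← mul_pow]
      refine one_le_pow₀ ?_
      have e1 : (1 / ((k : ℝ) + 1)) ^ (d * d) / ((d * d : ℕ) + 1) =
          (D * ((k : ℝ) + 1) ^ (d * d))⁻¹ := by
        rw [hD]; push_cast; rw [one_div, inv_pow, mul_inv, div_eq_inv_mul]
      rw [e1] at hle
      rw [← inv_le_iff_one_le_mul₀' (by positivity)]
      exact hle
    rw [Finset.prod_eq_zero hh (by rw [h1, sub_self]), sub_zero]
  -- on the support of the weight the truncated inverse is exact
  have hgood : ∀ h < D, ∀ k x θ, ψ h k x ≠ 0 →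
      1 ≤ L k * Complex.normSq (A h k (θ, x)).det := fun h hh k x θ hne => by
    have h1 : η h k x ≠ 0 := left_ne_zero_of_mul hne
    have h2 : 1 / 2 < (D * ((k : ℝ) + 1) ^ (d * d)) ^ 2 * Complex.normSq (P h k x) := by
      by_contra hcon
      exact h1 (smoothStep_of_le (not_lt.1 hcon))
    have h3 : ε k / 2 ≤ ‖P h k x‖ := by
      rw [Complex.normSq_eq_norm_sq, ← mul_pow] at h2
      have h4 : (1 / 2 : ℝ) ≤ D * ((k : ℝ) + 1) ^ (d * d) * ‖P h k x‖ := by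
        have : (0 : ℝ) ≤ D * ((k : ℝ) + 1) ^ (d * d) * ‖P h k x‖ := by positivity
        nlinarith
      simp only [hε]
      rw [inv_eq_one_div, div_div, div_le_iff₀ (by positivity)]
      linarith
    have h5 := stein_resolvent_bound hB1 hR1 (hB x) (z := z h k (θ, x))
      ((hnormz _ _ _).le.trans (hρR h hh k)) (ε := ε k / 2) (by linarith [hε0 k])
      (by linarith [hε0 k, hε1 k]) (by rw [hnormz]; exact h3)
    rw [Complex.normSq_eq_norm_sq]
    simp only [hL]
    rw [← mul_pow]
    refine one_le_pow₀ ?_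
    have h6 : (2 * (D * ((k : ℝ) + 1) ^ (d * d))) ^ d * (ε k / 2) ^ d = 1 := by
      rw [← mul_pow]
      simp only [hε]
      rw [show (2 * (D * ((k : ℝ) + 1) ^ (d * d))) * ((D * ((k : ℝ) + 1) ^ (d * d))⁻¹ / 2) = 1 by
        field_simp, one_pow]
    calc (1 : ℝ) = (2 * (D * ((k : ℝ) + 1) ^ (d * d))) ^ d * (ε k / 2) ^ d := h6.symm
      _ ≤ (2 * (D * ((k : ℝ) + 1) ^ (d * d))) ^ d * (Q * ‖(A h k (θ, x)).det‖) :=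
        mul_le_mul_of_nonneg_left h5 (by positivity)
      _ = _ := by ring
  have hLpoly : ∀ k, L k = Q ^ 2 * (2 * D) ^ (2 * d) * ((k : ℝ) + 1) ^ (d * d * d * 2) := fun k => by
    have e1 : ∀ q D a : ℝ, (q * (2 * (D * a ^ (d * d))) ^ d) ^ 2 =
        q ^ 2 * (2 * D) ^ (2 * d) * a ^ (d * d * d * 2) := fun q D a => by
      simp only [mul_pow, ← pow_mul]; ring
    exact e1 _ _ _
  have tL : ∀ {E : Type} [NormedAddCommGroup E] [NormedSpace ℝ E],
      Tempered fun k (_ : E) => L k := fun {E} _ _ =>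
    Tempered.const (C := Q ^ 2 * (2 * D) ^ (2 * d)) (M := d * d * d * 2) fun k => by
      rw [Real.norm_of_nonneg (by simp only [hL]; positivity), hLpoly]
  have tW2 : ∀ i j, Tempered fun (_ : ℕ) (p : ℝ × Λ) => W p.2 i j := fun i j =>
    (hW i j).comp_clm (ContinuousLinearMap.snd ℝ ℝ Λ)
  have tρ : ∀ h < D, ∀ {E : Type} [NormedAddCommGroup E] [NormedSpace ℝ E],
      Tempered fun k (_ : E) => (ρ h k : ℂ) := fun h hh {E} _ _ =>
    Tempered.const (C := R) (M := 0) fun k => by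
      rw [Complex.norm_real, Real.norm_of_nonneg (by linarith [hρ1 h k]), pow_zero, mul_one]
      exact hρR h hh k
  have tz : ∀ h < D, Tempered (z h) := fun h hh => by
    have := (tρ h hh (E := ℝ × Λ)).mul
      ((Tempered.cexp_mul 0).comp_clm (ContinuousLinearMap.fst ℝ ℝ Λ))
    simpa [hz] using this
  have tzp : ∀ h < D, Tempered fun k p => z h k p ^ (k + 1) := fun h hh => by
    have h1 : Tempered fun k (_ : ℝ × Λ) => ((ρ h k ^ (k + 1) : ℝ) : ℂ) :=
      Tempered.const (C := Real.exp (D * 1)) (M := 0) fun k => by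
        rw [Complex.norm_real, Real.norm_of_nonneg (pow_nonneg (by linarith [hρ1 h k]) _), pow_zero,
          mul_one]
        have e1 : ρ h k ≤ Real.exp ((h + 1) / (k + 1)) := by
          have := Real.add_one_le_exp (((h : ℝ) + 1) / (k + 1))
          simp only [hρ]; linarith
        refine (pow_le_pow_left₀ (by linarith [hρ1 h k]) e1 _).trans ?_
        rw [← Real.exp_nat_mul, Real.exp_le_exp]
        push_cast
        rw [mul_div_cancel₀ _ (by positivity), mul_one]
        exact_mod_cast hh
    have h2 := h1.mul ((Tempered.cexp_mul 1).comp_clm (ContinuousLinearMap.fst ℝ ℝ Λ))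
    refine (funext fun k => funext fun p => ?_ : _ = fun k p => z h k p ^ (k + 1)) ▸ h2
    simp only [hz, mul_pow, ContinuousLinearMap.coe_fst']
    rw [← Complex.exp_nat_mul]
    push_cast
    ring_nf
  have tA : ∀ h < D, ∀ i j, Tempered fun k p => A h k p i j := fun h hh i j =>
    Tempered.scalar_sub (tz h hh) tW2 i j
  have tI : ∀ h < D, ∀ j, Tempered (I h j) := fun h hh j => by
    have tdet := Tempered.det (tA h hh)
    refine (((tzp h hh).mul ?_).mul tdet.conj).mul
      (Tempered.ofReal ((tL.mul ((tL.mul tdet.normSq).comp_bounded contDiff_smoothInv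
        bounded_smoothInv))))
    simp only [Matrix.mulVec, dotProduct]
    exact Tempered.sum _ fun i _ => (Tempered.adjugate (tA h hh) _ _).mul (Tempered.const' _)
  have tP : ∀ h < D, Tempered (P h) := fun h hh => by
    simp only [hP, Matrix.eval_charpoly]
    exact Tempered.det (Tempered.scalar_sub ((tρ h hh).pow 2) (Tempered.steinMatrix hW))
  have tη : ∀ h < D, Tempered (η h) := fun h hh => by
    refine Tempered.comp_bounded (Tempered.mul (Tempered.const (C := D ^ 2) (M := d * d * 2)
      fun k => le_of_eq ?_) (tP h hh).normSq) contDiff_smoothStep bounded_smoothStep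
    rw [Real.norm_of_nonneg (by positivity), mul_pow, ← pow_mul]
  have tψ : ∀ h < D, Tempered (ψ h) := fun h hh =>
    (tη h hh).mul (Tempered.prod _ fun l hl => (Tempered.const' _).sub
      (tη l ((Finset.mem_range.1 hl).trans hh)))
  refine ⟨fun k x j => ∑ h ∈ Finset.range D, (ψ h k x : ℂ) * ((1 / (2 * Real.pi) : ℂ) *
    ∫ θ in (0 : ℝ)..2 * Real.pi, I h j k (θ, x)), fun j => Tempered.sum _ fun h hh =>
      (tψ h (Finset.mem_range.1 hh)).ofReal.mul ((Tempered.const' _).mul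
        ((tI h (Finset.mem_range.1 hh) j).integral _ _)), fun x v w hw hv k => ?_⟩
  have hmain : ∀ h ∈ Finset.range D, ∑ j, v j * ((ψ h k x : ℂ) * ((1 / (2 * Real.pi) : ℂ) *
      ∫ θ in (0 : ℝ)..2 * Real.pi, I h j k (θ, x))) = ψ h k x * (w ^ k * (v ⬝ᵥ e)) := by
    intro h hh
    have hh := Finset.mem_range.1 hh
    by_cases hne : ψ h k x = 0
    · simp [hne]
    have hintv : ∀ j ∈ Finset.univ, IntervalIntegrable (fun θ => v j * I h j k (θ, x))
        MeasureTheory.volume 0 (2 * Real.pi) := fun j _ =>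
      (continuous_const.mul (((tI h hh j).1 k).continuous.comp
        (by fun_prop : Continuous fun θ : ℝ => (θ, x)))).intervalIntegrable _ _
    have e1 : ∑ j, v j * ((ψ h k x : ℂ) * ((1 / (2 * Real.pi) : ℂ) *
        ∫ θ in (0 : ℝ)..2 * Real.pi, I h j k (θ, x))) =
        ψ h k x * ((1 / (2 * Real.pi) : ℂ) * ∫ θ in (0 : ℝ)..2 * Real.pi,
          ∑ j, v j * I h j k (θ, x)) := by
      rw [intervalIntegral.integral_finsetSum hintv, Finset.mul_sum, Finset.mul_sum]
      refine Finset.sum_congr rfl fun j _ => ?_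
      rw [intervalIntegral.integral_const_mul]; ring
    have e2 : ∀ θ : ℝ, ∑ j, v j * I h j k (θ, x) =
        (((ρ h k : ℂ) * Complex.exp (θ * Complex.I)) ^ (k + 1) /
          (ρ h k * Complex.exp (θ * Complex.I) - w)) * (v ⬝ᵥ e) := fun θ => by
      have hg := hgood h hh k x θ hne
      have hdet : (A h k (θ, x)).det ≠ 0 := fun h0 => by
        rw [h0] at hg; simp at hg; linarith
      have hLne : L k ≠ 0 := fun h0 => by rw [h0] at hg; simp at hg; linarith
      have hzw : z h k (θ, x) - w ≠ 0 := fun h0 => by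
        have := hnormz h k (θ, x)
        rw [sub_eq_zero.1 h0] at this
        linarith [hρ1 h k]
      have hadj := dotProduct_adjugate_mulVec (e := e) (z := z h k (θ, x)) hv
      have h7 : ((L k * smoothInv (L k * Complex.normSq (A h k (θ, x)).det) : ℝ) : ℂ) =
          ((A h k (θ, x)).det * star (A h k (θ, x)).det)⁻¹ := by
        rw [smoothInv_of_ge hg, Complex.star_def, Complex.mul_conj, ← Complex.ofReal_inv, mul_inv,
          mul_inv_cancel_left₀ hLne]
      have h8 : ∑ j, v j * I h j k (θ, x) = z h k (θ, x) ^ (k + 1) *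
          (v ⬝ᵥ ((A h k (θ, x)).adjugate *ᵥ e)) * star (A h k (θ, x)).det *
          (L k * smoothInv (L k * Complex.normSq (A h k (θ, x)).det) : ℝ) := by
        simp only [hI, dotProduct, Finset.mul_sum, Finset.sum_mul]
        exact Finset.sum_congr rfl fun j _ => by ring
      change _ = z h k (θ, x) ^ (k + 1) / (z h k (θ, x) - w) * (v ⬝ᵥ e)
      rw [h8, h7]
      have hdet' : star (A h k (θ, x)).det ≠ 0 := star_ne_zero.2 hdet
      have h9 : v ⬝ᵥ ((A h k (θ, x)).adjugate *ᵥ e) =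
          (A h k (θ, x)).det * (v ⬝ᵥ e) / (z h k (θ, x) - w) := by
        rw [eq_div_iff hzw, mul_comm]; exact hadj
      rw [h9]
      field_simp
    rw [e1]
    simp only [e2, intervalIntegral.integral_mul_const]
    rw [← mul_assoc (1 / (2 * Real.pi) : ℂ), integral_pow_div_sub (hw.trans_lt (hρ1 h k))]
  calc _ = ∑ h ∈ Finset.range D, ∑ j, v j * ((ψ h k x : ℂ) * ((1 / (2 * Real.pi) : ℂ) *
      ∫ θ in (0 : ℝ)..2 * Real.pi, I h j k (θ, x))) := by
        simp only [dotProduct, Finset.mul_sum]; rw [Finset.sum_comm]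
    _ = ∑ h ∈ Finset.range D, ψ h k x * (w ^ k * (v ⬝ᵥ e)) := Finset.sum_congr rfl hmain
    _ = _ := by
      rw [← Finset.sum_mul, ← Complex.ofReal_sum, hsum, Complex.ofReal_one, one_mul]

/-- The Fourier integral in the first variable. -/
def fourierInt {E : Type} (H : ℝ × E → ℂ) (k : ℕ) (x : E) : ℂ :=
  ∫ t in (-Real.pi)..Real.pi, Complex.exp (-(k * Complex.I) * t) * H (t, x)

section FourierInt

variable {E : Type} [NormedAddCommGroup E] [NormedSpace ℝ E]

theorem contDiff_cexp_fst (c : ℂ) : ContDiff ℝ (⊤ : ℕ∞) fun p : ℝ × E => Complex.exp (c * (p.1 : ℂ)) :=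
  Complex.contDiff_exp.comp (contDiff_const.mul (Complex.ofRealCLM.contDiff.comp contDiff_fst))

theorem norm_iteratedFDeriv_cexp_fst_le (k n : ℕ) (p : ℝ × E) :
    ‖iteratedFDeriv ℝ n (fun p : ℝ × E => Complex.exp (-(k * Complex.I) * (p.1 : ℂ))) p‖ ≤
      ((k : ℝ) + 1) ^ n := by
  have hsm : ContDiff ℝ (⊤ : ℕ∞) fun t : ℝ => Complex.exp (-(k * Complex.I) * (t : ℂ)) :=
    Complex.contDiff_exp.comp (contDiff_const.mul Complex.ofRealCLM.contDiff)
  have e := (ContinuousLinearMap.fst ℝ ℝ E).iteratedFDeriv_comp_right hsm p (i := n) (mod_cast le_top)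
  change ‖iteratedFDeriv ℝ n ((fun t : ℝ => Complex.exp (-(k * Complex.I) * (t : ℂ))) ∘
    ContinuousLinearMap.fst ℝ ℝ E) p‖ ≤ _
  rw [e]
  refine (ContinuousMultilinearMap.norm_compContinuousLinearMap_le _ _).trans ?_
  rw [norm_iteratedFDeriv_eq_norm_iteratedDeriv, iteratedDeriv_cexp_ofReal]
  simp only [Finset.prod_const, Finset.card_univ, Fintype.card_fin]
  have h1 : ‖(-(k * Complex.I)) ^ n * Complex.exp (-(k * Complex.I) *
      ((ContinuousLinearMap.fst ℝ ℝ E p : ℝ) : ℂ))‖ = (k : ℝ) ^ n := by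
    rw [norm_mul, Complex.norm_exp]; simp
  rw [h1]
  refine (mul_le_of_le_one_right (by positivity)
    (pow_le_one₀ (norm_nonneg _) (ContinuousLinearMap.norm_fst_le ℝ ℝ E))).trans ?_
  gcongr
  linarith

theorem fourierInt_bound {H : ℝ × E → ℂ} (hH : ContDiff ℝ (⊤ : ℕ∞) H) (hc : HasCompactSupport H) :
    (∀ k, ContDiff ℝ (⊤ : ℕ∞) (fourierInt H k)) ∧ ∀ n, ∃ C, ∀ k x,
      ‖iteratedFDeriv ℝ n (fourierInt H k) x‖ ≤ C * ((k : ℝ) + 1) ^ n := by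
  have hg : ∀ k : ℕ, ContDiff ℝ (⊤ : ℕ∞)
      fun p : ℝ × E => Complex.exp (-(k * Complex.I) * (p.1 : ℂ)) * H p :=
    fun k => (contDiff_cexp_fst _).mul hH
  have hb : ∀ n : ℕ, ∃ C, ∀ (k : ℕ) (p : ℝ × E), ‖iteratedFDeriv ℝ n
      (fun p : ℝ × E => Complex.exp (-(k * Complex.I) * (p.1 : ℂ)) * H p) p‖ ≤
        C * ((k : ℝ) + 1) ^ n := fun n => by
    choose C hC using bounded_iteratedFDeriv_of_hasCompactSupport hH hc
    refine ⟨∑ i ∈ Finset.range (n + 1), (n.choose i : ℝ) * C (n - i), fun k p => ?_⟩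
    refine (norm_iteratedFDeriv_mul_le (contDiff_cexp_fst _) hH p (mod_cast le_top)).trans ?_
    rw [Finset.sum_mul]
    refine Finset.sum_le_sum fun i hi => ?_
    have h1 : (1 : ℝ) ≤ (k : ℝ) + 1 := by have := Nat.cast_nonneg (α := ℝ) k; linarith
    have h2 : ‖iteratedFDeriv ℝ i (fun p : ℝ × E => Complex.exp (-(k * Complex.I) * (p.1 : ℂ))) p‖ ≤
        ((k : ℝ) + 1) ^ n := (norm_iteratedFDeriv_cexp_fst_le k i p).trans
          (pow_le_pow_right₀ h1 (by simpa [Nat.lt_succ_iff] using hi))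
    calc _ ≤ (n.choose i : ℝ) * ((k : ℝ) + 1) ^ n * C (n - i) := by
          gcongr; exact hC _ _
      _ = _ := by ring
  have hb' : ∀ k n : ℕ, ∃ C, ∀ p : ℝ × E, ‖iteratedFDeriv ℝ n
      (fun p : ℝ × E => Complex.exp (-(k * Complex.I) * (p.1 : ℂ)) * H p) p‖ ≤ C := fun k n => by
    obtain ⟨C, hC⟩ := hb n
    exact ⟨_, hC k⟩
  refine ⟨fun k => contDiff_infty.2 fun n =>
    (contDiff_integral_and_bound _ _ n (hg k) (hb' k)).1, fun n => ?_⟩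
  obtain ⟨C, hC⟩ := hb n
  refine ⟨C * |Real.pi - -Real.pi|, fun k x => ?_⟩
  refine ((contDiff_integral_and_bound (-Real.pi) Real.pi n (hg k) (hb' k)).2 _ (hC k) x).trans
    (le_of_eq (by ring))

/-- The operator `H ↦ H + ∂H/∂t`. -/
def oneAddDt (H : ℝ × E → ℂ) (p : ℝ × E) : ℂ := H p + fderiv ℝ H p (1, 0)

theorem tsupport_oneAddDt (H : ℝ × E → ℂ) : tsupport (oneAddDt H) ⊆ tsupport H := by
  refine closure_minimal (fun p hp => ?_) (isClosed_tsupport _)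
  by_contra hcon
  refine hp ?_
  have h1 : fderiv ℝ H p = 0 := by
    by_contra h
    exact hcon (tsupport_fderiv_subset ℝ (subset_tsupport _ h))
  rw [oneAddDt, h1, image_eq_zero_of_notMem_tsupport hcon]
  simp

theorem contDiff_oneAddDt {H : ℝ × E → ℂ} (hH : ContDiff ℝ (⊤ : ℕ∞) H) :
    ContDiff ℝ (⊤ : ℕ∞) (oneAddDt H) :=
  hH.add ((hH.fderiv_right (by simp)).clm_apply contDiff_const)

theorem fourierInt_oneAddDt {H : ℝ × E → ℂ} (hH : ContDiff ℝ (⊤ : ℕ∞) H)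
    (hS : tsupport H ⊆ {p | |p.1| < 3}) (k : ℕ) (x : E) :
    fourierInt (oneAddDt H) k x = (1 + k * Complex.I) * fourierInt H k x := by
  have hpath : ∀ t : ℝ, HasDerivAt (fun t : ℝ => (t, x)) ((1, 0) : ℝ × E) t := fun t =>
    (hasDerivAt_id t).prodMk (hasDerivAt_const t x)
  have hd : ∀ t : ℝ, HasDerivAt (fun t : ℝ => Complex.exp (-(k * Complex.I) * t) * H (t, x))
      (Complex.exp (-(k * Complex.I) * t) * (-(k * Complex.I) * 1) * H (t, x) +
        Complex.exp (-(k * Complex.I) * t) * fderiv ℝ H (t, x) (1, 0)) t := fun t =>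
    ((((hasDerivAt_id (t : ℂ)).const_mul (-(k * Complex.I))).cexp).comp_ofReal).mul
      (((hH.differentiable (by simp) (t, x)).hasFDerivAt).comp_hasDerivAt t (hpath t))
  have hpc : Continuous fun t : ℝ => (t, x) := by fun_prop
  have hec : Continuous fun t : ℝ => Complex.exp (-(k * Complex.I) * t) := by fun_prop
  have hHc : Continuous fun t : ℝ => H (t, x) := hH.continuous.comp hpc
  have hDc : Continuous fun t : ℝ => fderiv ℝ H (t, x) (1, 0) :=
    (((hH.fderiv_right (m := 0) (by simp)).clm_apply contDiff_const).continuous).comp hpc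
  have hz : ∀ t : ℝ, 3 ≤ |t| → H (t, x) = 0 := fun t ht =>
    image_eq_zero_of_notMem_tsupport fun h => not_lt.2 ht (hS h)
  have hpi : (3 : ℝ) ≤ |Real.pi| := by
    rw [abs_of_pos Real.pi_pos]; exact Real.pi_gt_three.le
  have h0 := intervalIntegral.integral_eq_sub_of_hasDerivAt (a := -Real.pi) (b := Real.pi)
    (fun t _ => hd t) (by
      refine Continuous.intervalIntegrable ?_ _ _
      exact ((hec.mul continuous_const).mul hHc).add (hec.mul hDc))
  rw [hz _ hpi, hz (-Real.pi) (by rwa [abs_neg]), mul_zero, mul_zero, sub_zero] at h0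
  have e : ∀ t : ℝ, Complex.exp (-(k * Complex.I) * t) * oneAddDt H (t, x) =
      (1 + k * Complex.I) * (Complex.exp (-(k * Complex.I) * t) * H (t, x)) +
      (Complex.exp (-(k * Complex.I) * t) * (-(k * Complex.I) * 1) * H (t, x) +
        Complex.exp (-(k * Complex.I) * t) * fderiv ℝ H (t, x) (1, 0)) := fun t => by
    rw [oneAddDt]; ring
  rw [fourierInt, fourierInt]
  simp only [e]
  rw [intervalIntegral.integral_add, h0, add_zero, intervalIntegral.integral_const_mul]
  · exact ((continuous_const.mul (hec.mul hHc))).intervalIntegrable _ _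
  · exact (((hec.mul continuous_const).mul hHc).add (hec.mul hDc)).intervalIntegrable _ _

/-- Fourier integrals of test functions decay rapidly, with all derivatives. -/
theorem fourierInt_rapid {H : ℝ × E → ℂ} (hH : ContDiff ℝ (⊤ : ℕ∞) H) (hc : HasCompactSupport H)
    (hS : tsupport H ⊆ {p | |p.1| < 3}) (n P : ℕ) : ∃ C, 0 ≤ C ∧ ∀ k x,
      ‖iteratedFDeriv ℝ n (fourierInt H k) x‖ * ((k : ℝ) + 1) ^ P ≤ C := by
  have key : ∀ L : ℕ, ∃ G : ℝ × E → ℂ, ContDiff ℝ (⊤ : ℕ∞) G ∧ HasCompactSupport G ∧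
      tsupport G ⊆ {p | |p.1| < 3} ∧
      ∀ k x, fourierInt G k x = (1 + k * Complex.I) ^ L * fourierInt H k x := fun L => by
    induction L with
    | zero => exact ⟨H, hH, hc, hS, by simp⟩
    | succ L ih =>
      obtain ⟨G, h1, h2, h3, h4⟩ := ih
      refine ⟨oneAddDt G, contDiff_oneAddDt h1,
        h2.mono' ((subset_tsupport _).trans (tsupport_oneAddDt G)),
        (tsupport_oneAddDt G).trans h3, fun k x => ?_⟩
      rw [fourierInt_oneAddDt h1 h3, h4]; ring
  obtain ⟨G, h1, h2, h3, h4⟩ := key (n + P)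
  obtain ⟨hs, hb⟩ := fourierInt_bound h1 h2
  obtain ⟨C, hC⟩ := hb n
  have hC0 : 0 ≤ C := by simpa using (norm_nonneg _).trans (hC 0 0)
  refine ⟨2 ^ (n + P) * C, by positivity, fun k x => ?_⟩
  have hk0 : (0 : ℝ) ≤ k := Nat.cast_nonneg k
  have hnorm : ((k : ℝ) + 1) / 2 ≤ ‖(1 + k * Complex.I : ℂ)‖ := by
    have e1 := Complex.abs_re_le_norm (1 + k * Complex.I : ℂ)
    have e2 := Complex.abs_im_le_norm (1 + k * Complex.I : ℂ)
    simp at e1 e2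
    linarith
  have h5 : iteratedFDeriv ℝ n (fourierInt G k) x =
      ((1 + k * Complex.I) ^ (n + P) : ℂ) • iteratedFDeriv ℝ n (fourierInt H k) x := by
    have : fourierInt G k = ((1 + k * Complex.I) ^ (n + P) : ℂ) • fourierInt H k := by
      funext y; rw [h4]; rfl
    rw [this]
    exact iteratedFDeriv_const_smul_apply
      (((fourierInt_bound hH hc).1 k).contDiffAt.of_le (mod_cast le_top))
  have h6 := hC k x
  rw [h5, norm_smul, norm_pow] at h6
  have h7 : (((k : ℝ) + 1) / 2) ^ (n + P) * ‖iteratedFDeriv ℝ n (fourierInt H k) x‖ ≤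
      C * ((k : ℝ) + 1) ^ n :=
    (mul_le_mul_of_nonneg_right (pow_le_pow_left₀ (by positivity) hnorm _) (norm_nonneg _)).trans h6
  rw [div_pow, div_mul_eq_mul_div, div_le_iff₀ (by positivity), pow_add, mul_assoc] at h7
  have h8 : (0 : ℝ) < ((k : ℝ) + 1) ^ n := by positivity
  refine le_of_mul_le_mul_left (a := ((k : ℝ) + 1) ^ n) ?_ h8
  linarith

end FourierInt

section Division

variable {E : Type} [NormedAddCommGroup E] [NormedSpace ℝ E]

theorem summable_inv_succ_sq : Summable fun k : ℕ => (((k : ℝ) + 1) ^ 2)⁻¹ := by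
  have h := (summable_nat_add_iff 1).2 (Real.summable_nat_pow_inv.2 one_lt_two)
  simpa using h

theorem hasSum_fourierInt {G : ℝ × E → ℝ} (hG : ContDiff ℝ (⊤ : ℕ∞) G) (hc : HasCompactSupport G)
    (hS : tsupport G ⊆ {p | |p.1| < 3}) {t : ℝ} (ht : |t| < 3) (x : E) :
    HasSum (fun k : ℕ => ((fourierInt (fun p => (G p : ℂ)) k x / Real.pi) *
      Complex.exp (t * Complex.I) ^ k).re)
      (G (t, x) + (fourierInt (fun p => (G p : ℂ)) 0 x).re / (2 * Real.pi)) := by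
  set H : ℝ × E → ℂ := fun p => (G p : ℂ) with hH
  have hHs : ContDiff ℝ (⊤ : ℕ∞) H := Complex.ofRealCLM.contDiff.comp hG
  have hHc : HasCompactSupport H := hc.comp_left Complex.ofReal_zero
  have hHS : tsupport H ⊆ {p | |p.1| < 3} :=
    (closure_mono fun p hp => by simpa [hH] using hp).trans hS
  have hz : ∀ t : ℝ, 3 ≤ |t| → H (t, x) = 0 := fun t ht =>
    image_eq_zero_of_notMem_tsupport fun h => not_lt.2 ht (hHS h)
  have hpi : (3 : ℝ) ≤ |Real.pi| := by
    rw [abs_of_pos Real.pi_pos]; exact Real.pi_gt_three.le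
  have hpi0 : (Real.pi : ℂ) ≠ 0 := mod_cast Real.pi_ne_zero
  have : Fact (0 < 2 * Real.pi) := ⟨by positivity⟩
  have hcont : Continuous fun t : ℝ => H (t, x) := hHs.continuous.comp (by fun_prop)
  set f : C(AddCircle (2 * Real.pi), ℂ) :=
    ⟨AddCircle.liftIco (2 * Real.pi) (-Real.pi) (fun t => H (t, x)),
      AddCircle.liftIco_continuous (by
        rw [hz (-Real.pi) (by rwa [abs_neg]), hz _ (by rw [show -Real.pi + 2 * Real.pi = Real.pi by ring]; exact hpi)])
        hcont.continuousOn⟩ with hf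
  have hcoef : ∀ n : ℤ, fourierCoeff f n = (1 / (2 * Real.pi) : ℂ) *
      ∫ t in (-Real.pi)..Real.pi, Complex.exp (-(n * Complex.I) * t) * H (t, x) := fun n => by
    simp only [hf, ContinuousMap.coe_mk]
    rw [fourierCoeff_liftIco_eq, fourierCoeffOn_eq_integral,
      show -Real.pi + 2 * Real.pi = Real.pi by ring]
    have e1 : ∀ t : ℝ, fourier (-n) (t : AddCircle (Real.pi - -Real.pi)) • H (t, x) =
        Complex.exp (-(n * Complex.I) * t) * H (t, x) := fun t => by
      rw [fourier_coe_apply, smul_eq_mul]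
      congr 2
      push_cast
      field_simp
      ring
    simp only [e1]
    rw [Complex.real_smul]
    push_cast
    ring
  have hpos : ∀ k : ℕ, fourierCoeff f (k : ℤ) = fourierInt H k x / (2 * Real.pi) := fun k => by
    rw [hcoef, fourierInt]; push_cast; ring
  have hneg : ∀ k : ℕ, fourierCoeff f (-(k : ℤ)) = star (fourierInt H k x / (2 * Real.pi)) := fun k => by
    rw [hcoef, fourierInt, star_div₀, Complex.star_def]
    have e2 : (starRingEnd ℂ) (∫ t in (-Real.pi)..Real.pi, Complex.exp (-(k * Complex.I) * t) * H (t, x)) =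
        ∫ t in (-Real.pi)..Real.pi, Complex.exp (-((-(k : ℤ) : ℤ) * Complex.I) * t) * H (t, x) := by
      have e3 : ∀ t : ℝ, Complex.exp (-((-(k : ℤ) : ℤ) * Complex.I) * t) * H (t, x) =
          (starRingEnd ℂ) (Complex.exp (-(k * Complex.I) * t) * H (t, x)) := fun t => by
        rw [map_mul, ← Complex.exp_conj]
        simp [hH]
      simp only [e3]
      exact (Complex.conjCLE.toContinuousLinearMap.intervalIntegral_comp_comm
        (((by fun_prop : Continuous fun t : ℝ => Complex.exp (-(k * Complex.I) * t)).mul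
          hcont).intervalIntegrable _ _)).symm
    rw [e2, map_mul, map_ofNat, Complex.conj_ofReal]
    push_cast
    ring
  obtain ⟨C, hC0, hC⟩ := fourierInt_rapid hHs hHc hHS 0 2
  have hb : ∀ k : ℕ, ‖fourierInt H k x / (2 * Real.pi)‖ ≤ C / (2 * Real.pi) * (((k : ℝ) + 1) ^ 2)⁻¹ :=
    fun k => by
    have := hC k x
    rw [norm_iteratedFDeriv_zero, ← le_div_iff₀ (by positivity)] at this
    rw [norm_div, show ‖(2 * Real.pi : ℂ)‖ = 2 * Real.pi by
      simp [abs_of_pos Real.pi_pos], div_mul_eq_mul_div, ← div_eq_mul_inv]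
    gcongr
  have hsum : Summable (fourierCoeff f) := by
    refine Summable.of_nat_of_neg ?_ ?_
    · simp only [hpos]
      exact Summable.of_norm_bounded (summable_inv_succ_sq.mul_left _) hb
    · simp only [hneg]
      exact Summable.of_norm_bounded (summable_inv_succ_sq.mul_left _) fun k => by
        rw [norm_star]; exact hb k
  have hmain := (has_pointwise_sum_fourier_series_of_summable hsum (t : AddCircle (2 * Real.pi))).nat_add_neg
  have hft : f (t : AddCircle (2 * Real.pi)) = H (t, x) := by
    have htpi := abs_lt.1 (ht.trans Real.pi_gt_three)
    exact AddCircle.liftIco_coe_apply (p := 2 * Real.pi) (a := -Real.pi) (f := fun t => H (t, x)) ⟨htpi.1.le, by linarith [htpi.2]⟩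
  rw [hft] at hmain
  have hre := Complex.hasSum_re hmain
  have hfour : ∀ k : ℕ, fourier (k : ℤ) (t : AddCircle (2 * Real.pi)) =
      Complex.exp (t * Complex.I) ^ k := fun k => by
    rw [fourier_coe_apply, ← Complex.exp_nat_mul]
    congr 1
    push_cast
    field_simp
  convert hre using 1
  · funext k
    rw [hpos, hneg, fourier_neg, hfour, Complex.star_def, smul_eq_mul, smul_eq_mul, ← map_mul,
      Complex.add_re, Complex.conj_re, ← two_mul, ← Complex.re_ofReal_mul]
    congr 1
    push_cast
    field_simp
  · have h0 := hpos 0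
    rw [Nat.cast_zero] at h0
    rw [h0, fourier_zero, smul_eq_mul, mul_one, Complex.add_re]
    congr 1
    rw [show (2 * Real.pi : ℂ) = ((2 * Real.pi : ℝ) : ℂ) by push_cast; ring, Complex.div_ofReal_re]

theorem contDiff_tsum_mul {Λ : Type} [NormedAddCommGroup Λ] [NormedSpace ℝ Λ] {b : ℕ → E → ℂ}
    (hb : ∀ k, ContDiff ℝ (⊤ : ℕ∞) (b k))
    (hr : ∀ n P, ∃ C, 0 ≤ C ∧ ∀ (k : ℕ) x, ‖iteratedFDeriv ℝ n (b k) x‖ * ((k : ℝ) + 1) ^ P ≤ C)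
    {c : ℕ → Λ → ℂ} (hc : Tempered c) :
    (∀ p : E × Λ, Summable fun k => (b k p.1 * c k p.2).re) ∧
      ContDiff ℝ (⊤ : ℕ∞) fun p : E × Λ => ∑' k, (b k p.1 * c k p.2).re := by
  have hb' : ∀ k, ContDiff ℝ (⊤ : ℕ∞) fun p : E × Λ => b k p.1 := fun k => (hb k).comp contDiff_fst
  have hc' := hc.comp_clm (ContinuousLinearMap.snd ℝ E Λ)
  have hbd : ∀ n P, ∃ C, 0 ≤ C ∧ ∀ (k : ℕ) (p : E × Λ),
      ‖iteratedFDeriv ℝ n (fun p : E × Λ => b k p.1) p‖ * ((k : ℝ) + 1) ^ P ≤ C := fun n P => by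
    obtain ⟨C, hC0, hC⟩ := hr n P
    refine ⟨C, hC0, fun k p => (mul_le_mul_of_nonneg_right ?_ (by positivity)).trans (hC k p.1)⟩
    have e := (ContinuousLinearMap.fst ℝ E Λ).iteratedFDeriv_comp_right (hb k) p (i := n)
      (mod_cast le_top)
    change ‖iteratedFDeriv ℝ n (b k ∘ ContinuousLinearMap.fst ℝ E Λ) p‖ ≤ _
    rw [e]
    refine (ContinuousMultilinearMap.norm_compContinuousLinearMap_le _ _).trans ?_
    simp only [Finset.prod_const, Finset.card_univ, Fintype.card_fin]
    exact mul_le_of_le_one_right (norm_nonneg _)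
      (pow_le_one₀ (norm_nonneg _) (ContinuousLinearMap.norm_fst_le ℝ E Λ))
  have hsm : ∀ k, ContDiff ℝ (⊤ : ℕ∞) fun p : E × Λ => (b k p.1 * c k p.2).re := fun k =>
    Complex.reCLM.contDiff.comp ((hb' k).mul (hc'.1 k))
  have hbound : ∀ n, ∃ C, ∀ (k : ℕ) (p : E × Λ),
      ‖iteratedFDeriv ℝ n (fun p : E × Λ => (b k p.1 * c k p.2).re) p‖ ≤
        C * (((k : ℝ) + 1) ^ 2)⁻¹ := fun n => by
    obtain ⟨D, M, hD0, hD⟩ := hc'.uniform_bound n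
    choose C hC0 hC using fun i => hbd i (M + 2)
    refine ⟨∑ i ∈ Finset.range (n + 1), (n.choose i : ℝ) * C i * D, fun k p => ?_⟩
    have e := Complex.reCLM.norm_iteratedFDeriv_comp_left (n := n)
      (((hb' k).mul (hc'.1 k)).contDiffAt (x := p)) (mod_cast le_top)
    refine e.trans ((mul_le_of_le_one_left (norm_nonneg _) Complex.reCLM_norm.le).trans ?_)
    refine (norm_iteratedFDeriv_mul_le (hb' k) (hc'.1 k) p (mod_cast le_top)).trans ?_
    rw [Finset.sum_mul]
    refine Finset.sum_le_sum fun i _ => ?_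
    rw [← div_eq_mul_inv, le_div_iff₀ (by positivity)]
    calc _ ≤ (n.choose i : ℝ) * ‖iteratedFDeriv ℝ i (fun p : E × Λ => b k p.1) p‖ *
          (D * ((k : ℝ) + 1) ^ M) * ((k : ℝ) + 1) ^ 2 := by
          gcongr; exact hD _ (Nat.sub_le _ _) _ _
      _ = (n.choose i : ℝ) * (‖iteratedFDeriv ℝ i (fun p : E × Λ => b k p.1) p‖ *
          ((k : ℝ) + 1) ^ (M + 2)) * D := by ring
      _ ≤ _ := by gcongr; exact hC i k p
  choose C hC using hbound
  refine ⟨fun p => Summable.of_norm_bounded (summable_inv_succ_sq.mul_left (C 0)) fun k => ?_,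
    contDiff_tsum (v := fun n (k : ℕ) => C n * (((k : ℝ) + 1) ^ 2)⁻¹) hsm
      (fun n _ => summable_inv_succ_sq.mul_left _) fun n k p _ => hC n k p⟩
  simpa using hC 0 k p

end Division

section MatrixExp

attribute [local instance] Matrix.linftyOpNormedRing Matrix.linftyOpNormedAlgebra

theorem vecMul_exp_of_eigenvector {d : ℕ} {A : Matrix (Fin d) (Fin d) ℂ} {v : Fin d → ℂ} {a : ℂ}
    (h : v ᵥ* A = a • v) : v ᵥ* NormedSpace.exp A = Complex.exp a • v := by
  have hpow : ∀ n : ℕ, v ᵥ* A ^ n = a ^ n • v := fun n => by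
    induction n with
    | zero => simp
    | succ n ih => rw [pow_succ, ← Matrix.vecMul_vecMul, ih, Matrix.smul_vecMul, h, smul_smul, pow_succ]
  let L : Matrix (Fin d) (Fin d) ℂ →ₗ[ℂ] (Fin d → ℂ) := Matrix.vecMulBilin ℂ ℂ v
  have h1 := (NormedSpace.exp_series_hasSum_exp' (𝕂 := ℂ) A).mapL L.toContinuousLinearMap
  have h2 := (NormedSpace.exp_series_hasSum_exp' (𝕂 := ℂ) a).smul_const v
  rw [← Complex.exp_eq_exp_ℂ] at h2
  have h3 : (fun n : ℕ => L.toContinuousLinearMap ((n.factorial : ℂ)⁻¹ • A ^ n)) =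
      fun n : ℕ => ((n.factorial : ℂ)⁻¹ • a ^ n) • v := funext fun n => by
    change v ᵥ* ((n.factorial : ℂ)⁻¹ • A ^ n) = _
    rw [Matrix.vecMul_smul, hpow, smul_smul, smul_eq_mul]
  rw [h3] at h1
  exact h1.unique h2

theorem contDiff_exp_entry {Λ : Type} [NormedAddCommGroup Λ] [NormedSpace ℝ Λ] {d : ℕ}
    (N : Matrix (Fin d) (Fin d) ℂ) (B : Fin d → Matrix (Fin d) (Fin d) ℂ) {ζ : Λ → Fin d → ℂ}
    (hζ : ContDiff ℝ (⊤ : ℕ∞) ζ) (i j : Fin d) :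
    ContDiff ℝ (⊤ : ℕ∞) fun x => NormedSpace.exp (N + ∑ l, ζ x l • B l) i j := by
  let L : Matrix (Fin d) (Fin d) ℂ →ₗ[ℝ] ℂ := Matrix.entryLinearMap ℝ ℂ i j
  have h1 : ContDiff ℝ (⊤ : ℕ∞) fun x => N + ∑ l, ζ x l • B l :=
    contDiff_const.add (ContDiff.sum fun l _ => ((contDiff_pi.1 hζ) l).smul contDiff_const)
  have h2 : ContDiff ℝ (⊤ : ℕ∞) (NormedSpace.exp : Matrix (Fin d) (Fin d) ℂ → _) :=
    contDiff_iff_contDiffAt.2 fun A => (NormedSpace.exp_analytic (𝕂 := ℝ) A).contDiffAt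
  exact L.toContinuousLinearMap.contDiff.comp (h2.comp h1)

end MatrixExp

/-- The companion matrix of `t ^ (d + 1) + ∑ μ j * t ^ j`, acting on row vectors. -/
def companion {d : ℕ} (μ : Fin (d + 1) → ℂ) : Matrix (Fin (d + 1)) (Fin (d + 1)) ℂ :=
  (Matrix.of fun i j => if i.val = j.val + 1 then 1 else 0) +
    ∑ l, μ l • Matrix.of fun i j => if i = l ∧ j = Fin.last d then -1 else 0

theorem vecMul_companion {d : ℕ} {μ : Fin (d + 1) → ℂ} {t : ℂ}
    (h : t ^ (d + 1) + ∑ j, μ j * t ^ j.val = 0) :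
    (fun j : Fin (d + 1) => t ^ j.val) ᵥ* companion μ = t • fun j : Fin (d + 1) => t ^ j.val := by
  funext j
  simp only [companion, Matrix.vecMul, dotProduct, Matrix.add_apply, Matrix.sum_apply,
    Matrix.smul_apply, Matrix.of_apply, smul_eq_mul, Pi.smul_apply, mul_add, Finset.sum_add_distrib]
  rcases Fin.eq_castSucc_or_eq_last j with ⟨i, rfl⟩ | rfl
  · have h1 : ∀ x : Fin (d + 1), (x.val = (Fin.castSucc i).val + 1) ↔ x = i.succ := fun x => by
      rw [Fin.ext_iff]; simp
    simp only [h1]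
    simp [Fin.castSucc_ne_last, pow_succ, mul_comm]
  · have h1 : ∀ x : Fin (d + 1), ¬ (x.val = (Fin.last d).val + 1) := fun x => by
      have := x.isLt
      rw [Fin.val_last]; omega
    simp only [h1]
    simp [mul_comm]
    linear_combination -h

section Division

variable {E : Type} [NormedAddCommGroup E] [NormedSpace ℝ E] [FiniteDimensional ℝ E]

/-- Smooth division by the generic monic polynomial. -/
theorem exists_generic_division {F : ℝ × E → ℝ} (hF : ContDiff ℝ (⊤ : ℕ∞) F) (d : ℕ) :
    ∃ r : Fin (d + 1) → E × (Fin (d + 1) → ℝ) → ℝ, (∀ j, ContDiff ℝ (⊤ : ℕ∞) (r j)) ∧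
      ∀ᶠ p : ℝ × E × (Fin (d + 1) → ℝ) in 𝓝 0,
        p.1 ^ (d + 1) + ∑ j, p.2.2 j * p.1 ^ j.val = 0 →
        F (p.1, p.2.1) = ∑ j, r j p.2 * p.1 ^ j.val := by
  let χ : ContDiffBump (0 : ℝ × E) := ⟨1, 2, one_pos, one_lt_two⟩
  set G : ℝ × E → ℝ := fun p => χ p * F p with hG
  have hGs : ContDiff ℝ (⊤ : ℕ∞) G := χ.contDiff.mul hF
  have hGc : HasCompactSupport G := χ.hasCompactSupport.mul_right
  have hGS : tsupport G ⊆ {p | |p.1| < 3} := fun p hp => by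
    have h1 := closure_mono (Function.support_mul_subset_left χ F) hp
    have h2 : p ∈ Metric.closedBall (0 : ℝ × E) 2 := by
      rw [← χ.tsupport_eq]; exact h1
    rw [mem_closedBall_zero_iff] at h2
    have h3 := (norm_fst_le p).trans h2
    rw [Real.norm_eq_abs] at h3
    exact h3.trans_lt (by norm_num)
  let β : ContDiffBump (0 : Fin (d + 1) → ℝ) := ⟨1, 2, one_pos, one_lt_two⟩
  set ζ : (Fin (d + 1) → ℝ) → Fin (d + 1) → ℂ := fun μ l => (β μ * μ l : ℝ) with hζ
  have hζs : ContDiff ℝ (⊤ : ℕ∞) ζ := contDiff_pi.2 fun l =>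
    Complex.ofRealCLM.contDiff.comp (β.contDiff.mul (contDiff_apply ℝ ℝ l))
  set W : (Fin (d + 1) → ℝ) → Matrix (Fin (d + 1)) (Fin (d + 1)) ℂ :=
    fun μ => NormedSpace.exp (Complex.I • companion (ζ μ)) with hW
  have hWs : ∀ i j, ContDiff ℝ (⊤ : ℕ∞) fun μ => W μ i j := fun i j => by
    have := contDiff_exp_entry (Complex.I • Matrix.of fun i j : Fin (d + 1) => if i.val = j.val + 1 then 1 else 0)
      (fun l => Complex.I • Matrix.of fun i j : Fin (d + 1) => if i = l ∧ j = Fin.last d then -1 else 0) hζs i j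
    refine (congrArg (ContDiff ℝ (⊤ : ℕ∞)) (funext fun μ => ?_)).mp this
    simp only [hW, companion, smul_add, Finset.smul_sum]
    simp only [smul_comm Complex.I]
  have hWt : ∀ i j, Tempered fun _ μ => W μ i j := fun i j => by
    have hd : ContDiff ℝ (⊤ : ℕ∞) fun μ => W μ i j - NormedSpace.exp (Complex.I • companion 0) i j :=
      (hWs i j).sub contDiff_const
    have hdc : HasCompactSupport fun μ => W μ i j - NormedSpace.exp (Complex.I • companion 0) i j :=
      β.hasCompactSupport.mono fun μ hμ => by
        intro h0
        refine hμ ?_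
        have : ζ μ = 0 := by funext l; simp [hζ, h0]
        simp only [hW, this, sub_self]
    have := (Tempered.of_bounded hd (bounded_iteratedFDeriv_of_hasCompactSupport hd hdc)).add
      (Tempered.const' (NormedSpace.exp (Complex.I • companion 0) i j))
    simpa using this
  obtain ⟨c, hct, hc⟩ := exists_tempered_power hWt (Pi.single 0 1)
  set b : ℕ → E → ℂ := fun k x => fourierInt (fun p => (G p : ℂ)) k x / Real.pi with hb
  set H : ℝ × E → ℂ := fun p => (G p : ℂ) with hH
  have hHs : ContDiff ℝ (⊤ : ℕ∞) H := Complex.ofRealCLM.contDiff.comp hGs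
  have hHc : HasCompactSupport H := hGc.comp_left Complex.ofReal_zero
  have hHS : tsupport H ⊆ {p | |p.1| < 3} :=
    (closure_mono fun p hp => by simpa [hH] using hp).trans hGS
  have hfs := (fourierInt_bound hHs hHc).1
  have hbs : ∀ k, ContDiff ℝ (⊤ : ℕ∞) (b k) := fun k => (hfs k).div_const _
  have hbr : ∀ n P, ∃ C, 0 ≤ C ∧ ∀ (k : ℕ) x, ‖iteratedFDeriv ℝ n (b k) x‖ * ((k : ℝ) + 1) ^ P ≤ C :=
    fun n P => by
    obtain ⟨C, hC0, hC⟩ := fourierInt_rapid hHs hHc hHS n P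
    refine ⟨‖(Real.pi : ℂ)⁻¹‖ * C, by positivity, fun k x => ?_⟩
    have e : b k = (Real.pi : ℂ)⁻¹ • fourierInt H k := by
      funext y; simp only [hb, Pi.smul_apply, smul_eq_mul]; rw [div_eq_inv_mul]
    have e2 : iteratedFDeriv ℝ n (b k) x = (Real.pi : ℂ)⁻¹ • iteratedFDeriv ℝ n (fourierInt H k) x := by
      rw [e]; exact iteratedFDeriv_const_smul_apply ((hfs k).contDiffAt.of_le (mod_cast le_top))
    rw [e2, norm_smul, mul_assoc]
    exact mul_le_mul_of_nonneg_left (hC k x) (norm_nonneg _)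
  have hmul := fun j => contDiff_tsum_mul hbs hbr (hct j)
  refine ⟨fun j p => (∑' k, (b k p.1 * c k p.2 j).re) -
    if j = 0 then (fourierInt H 0 p.1).re / (2 * Real.pi) else 0, fun j => (hmul j).2.sub ?_, ?_⟩
  · split_ifs
    · exact (Complex.reCLM.contDiff.comp ((hfs 0).comp contDiff_fst)).div_const _
    · exact contDiff_const
  have hnear : ∀ᶠ p : ℝ × E × (Fin (d + 1) → ℝ) in 𝓝 0, ‖p‖ < 1 := by
    filter_upwards [Metric.ball_mem_nhds (0 : ℝ × E × (Fin (d + 1) → ℝ)) one_pos] with p hp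
    simpa using hp
  filter_upwards [hnear]
  rintro ⟨t, x, μ⟩ hp hroot
  simp only [Prod.norm_def, max_lt_iff, Real.norm_eq_abs] at hp hroot ⊢
  have hζμ : ζ μ = fun l => (μ l : ℂ) := by
    funext l
    simp only [hζ]
    rw [β.one_of_mem_closedBall (by simpa using hp.2.2.le), one_mul]
  have hGF : G (t, x) = F (t, x) := by
    simp only [hG]
    rw [χ.one_of_mem_closedBall (by
      rw [mem_closedBall_zero_iff, Prod.norm_def]; exact max_le hp.1.le hp.2.1.le), one_mul]
  have heig := vecMul_companion (μ := ζ μ) (t := t) (by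
    rw [hζμ]
    have := congrArg (fun s : ℝ => (s : ℂ)) hroot
    push_cast at this
    exact this)
  have hWe : (fun j : Fin (d + 1) => (t : ℂ) ^ j.val) ᵥ* W μ =
      Complex.exp (t * Complex.I) • fun j : Fin (d + 1) => (t : ℂ) ^ j.val := by
    rw [mul_comm]
    exact vecMul_exp_of_eigenvector (by rw [Matrix.vecMul_smul, heig, smul_smul])
  have hck := hc μ _ _ (Complex.norm_exp_ofReal_mul_I t).le hWe
  have hser := hasSum_fourierInt hGs hGc hGS (hp.1.trans (by norm_num)) x
  have hser2 : HasSum (fun k : ℕ => ∑ j : Fin (d + 1), (b k x * c k μ j).re * t ^ j.val)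
      (∑ j : Fin (d + 1), (∑' k, (b k x * c k μ j).re) * t ^ j.val) :=
    hasSum_sum fun j _ => ((hmul j).1 (x, μ)).hasSum.mul_right _
  have hterm : ∀ k : ℕ, ∑ j : Fin (d + 1), (b k x * c k μ j).re * t ^ j.val =
      (b k x * Complex.exp (t * Complex.I) ^ k).re := fun k => by
    have h1 := hck k
    have h2 : (fun j : Fin (d + 1) => (t : ℂ) ^ j.val) ⬝ᵥ (Pi.single 0 1 : Fin (d + 1) → ℂ) = 1 := by
      simp
    rw [h2, mul_one] at h1
    rw [← h1, dotProduct, Finset.mul_sum, Complex.re_sum]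
    refine Finset.sum_congr rfl fun j _ => ?_
    rw [mul_comm _ (t ^ j.val), ← Complex.re_ofReal_mul]
    congr 1
    push_cast
    ring
  simp only [hterm] at hser2
  have huniq := hser.unique hser2
  rw [hGF] at huniq
  simp only [sub_mul, Finset.sum_sub_distrib]
  rw [← huniq]
  simp [hH]

end Division

section Jets

open Asymptotics

theorem poly_eq_zero_of_isBigO {k : ℕ} {a : ℕ → ℝ}
    (h : (fun t : ℝ => ∑ j ∈ Finset.range k, a j * t ^ j) =O[𝓝[≠] 0] fun t => t ^ k) :
    ∀ j < k, a j = 0 := by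
  induction k generalizing a with
  | zero => intro j hj; omega
  | succ k ih =>
    have hpow : Tendsto (fun t : ℝ => t ^ (k + 1)) (𝓝[≠] 0) (𝓝 0) := by
      have : Tendsto (fun t : ℝ => t ^ (k + 1)) (𝓝 0) (𝓝 (0 ^ (k + 1))) :=
        (continuous_pow (k + 1)).tendsto 0
      rw [zero_pow (by omega)] at this
      exact this.mono_left nhdsWithin_le_nhds
    have h1 := h.trans_tendsto hpow
    have h2 : Tendsto (fun t : ℝ => ∑ j ∈ Finset.range (k + 1), a j * t ^ j) (𝓝[≠] 0) (𝓝 (a 0)) := by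
      have hc : Continuous fun t : ℝ => ∑ j ∈ Finset.range (k + 1), a j * t ^ j := by fun_prop
      have := (hc.tendsto 0).mono_left (nhdsWithin_le_nhds (s := {0}ᶜ))
      simpa [Finset.sum_range_succ'] using this
    have h0 : a 0 = 0 := tendsto_nhds_unique h2 h1
    have h3 : (fun t : ℝ => ∑ j ∈ Finset.range k, a (j + 1) * t ^ j) =O[𝓝[≠] 0] fun t => t ^ k := by
      obtain ⟨C, hC⟩ := h.bound
      refine IsBigO.of_bound C ?_
      filter_upwards [hC, self_mem_nhdsWithin] with t ht ht0
      rw [Finset.sum_range_succ'] at ht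
      have e : ∑ j ∈ Finset.range k, a (j + 1) * t ^ (j + 1) + a 0 * t ^ 0 =
          t * ∑ j ∈ Finset.range k, a (j + 1) * t ^ j := by
        rw [h0, zero_mul, add_zero, Finset.mul_sum]
        exact Finset.sum_congr rfl fun j _ => by ring
      rw [e, norm_mul, pow_succ', norm_mul, mul_left_comm] at ht
      exact le_of_mul_le_mul_left ht (norm_pos_iff.2 ht0)
    intro j hj
    cases j with
    | zero => exact h0
    | succ j => exact ih h3 j (by omega)

theorem taylor_isBigO {u : ℝ → ℝ} {k : ℕ} (hu : ContDiffAt ℝ k u 0) :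
    (fun t : ℝ => u t - ∑ j ∈ Finset.range k, iteratedDeriv j u 0 / j.factorial * t ^ j)
      =O[𝓝 0] fun t => t ^ k := by
  obtain ⟨s, hs, hus⟩ := hu.contDiffOn (m := k) le_rfl (by simp)
  obtain ⟨ε, hε, hball⟩ := Metric.mem_nhds_iff.1 hs
  have h1 := taylor_isLittleO (convex_ball (0 : ℝ) ε) (Metric.mem_ball_self hε)
    (hus.mono hball)
  rw [nhdsWithin_eq_nhds.2 (Metric.ball_mem_nhds _ hε)] at h1
  have h2 : ∀ t, taylorWithinEval u k (Metric.ball 0 ε) 0 t =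
      ∑ j ∈ Finset.range k, iteratedDeriv j u 0 / j.factorial * t ^ j
        + iteratedDeriv k u 0 / k.factorial * t ^ k := fun t => by
    rw [taylor_within_apply, ← Finset.sum_range_succ
      (fun j => iteratedDeriv j u 0 / j.factorial * t ^ j)]
    refine Finset.sum_congr rfl fun j _ => ?_
    rw [iteratedDerivWithin_of_isOpen Metric.isOpen_ball (Metric.mem_ball_self hε), sub_zero,
      smul_eq_mul]
    ring
  have h3 : (fun t : ℝ => iteratedDeriv k u 0 / k.factorial * t ^ k) =O[𝓝 0] fun t => t ^ k :=
    isBigO_const_mul_self _ _ _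
  simp only [sub_zero] at h1
  refine (h1.isBigO.add h3).congr_left fun t => ?_
  rw [h2]; ring

theorem iteratedDeriv_eq_of_isBigO {u : ℝ → ℝ} {k : ℕ} {a : ℕ → ℝ} (hu : ContDiffAt ℝ k u 0)
    (h : (fun t : ℝ => u t - ∑ j ∈ Finset.range k, a j * t ^ j) =O[𝓝 0] fun t => t ^ k) :
    ∀ j < k, iteratedDeriv j u 0 = j.factorial * a j := fun j hj => by
  have h1 := (h.sub (taylor_isBigO hu)).mono (nhdsWithin_le_nhds (s := {0}ᶜ))
  have h2 := poly_eq_zero_of_isBigO (a := fun j => iteratedDeriv j u 0 / j.factorial - a j)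
    (h1.congr_left fun t => by
      simp only [sub_mul, Finset.sum_sub_distrib]; ring) j hj
  have : (j.factorial : ℝ) ≠ 0 := by positivity
  field_simp at h2
  linarith

theorem iteratedDeriv_eq_zero_of_isBigO {u : ℝ → ℝ} {k : ℕ} (hu : ContDiffAt ℝ k u 0)
    (h : u =O[𝓝 0] fun t => t ^ k) : ∀ j < k, iteratedDeriv j u 0 = 0 := fun j hj => by
  simpa using iteratedDeriv_eq_of_isBigO (a := 0) hu (by simpa using h) j hj

theorem isBigO_of_iteratedDeriv_eq_zero {u : ℝ → ℝ} {k : ℕ} (hu : ContDiffAt ℝ k u 0)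
    (h : ∀ j < k, iteratedDeriv j u 0 = 0) : u =O[𝓝 0] fun t => t ^ k :=
  (taylor_isBigO hu).congr_left fun t => by
    rw [Finset.sum_eq_zero fun j hj => by rw [h j (Finset.mem_range.1 hj), zero_div, zero_mul],
      sub_zero]

end Jets

theorem exists_local_inverse {V : Type*} [NormedAddCommGroup V] [NormedSpace ℝ V]
    [FiniteDimensional ℝ V] {R : V → V} (hR : ContDiffAt ℝ (⊤ : ℕ∞) R 0) (h0 : R 0 = 0)
    (hinj : ∀ v, fderiv ℝ R 0 v = 0 → v = 0) :
    ∃ S : V → V, ContDiffAt ℝ (⊤ : ℕ∞) S 0 ∧ S 0 = 0 ∧ (∀ᶠ x in 𝓝 0, S (R x) = x) ∧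
      ∀ᶠ y in 𝓝 0, R (S y) = y := by
  have hV : CompleteSpace V := FiniteDimensional.complete ℝ V
  let e := (LinearEquiv.ofInjectiveEndo (fderiv ℝ R 0).toLinearMap
    ((injective_iff_map_eq_zero _).2 hinj)).toContinuousLinearEquiv
  have hn : ((⊤ : ℕ∞) : WithTop ℕ∞) ≠ 0 := by simp
  have he : HasFDerivAt R (e : V →L[ℝ] V) 0 := by
    convert (hR.differentiableAt hn).hasFDerivAt
    ext v
    rfl
  have hs := hR.hasStrictFDerivAt' he hn
  refine ⟨hR.localInverse he hn, ?_, ?_, hs.eventually_left_inverse, ?_⟩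
  · simpa [h0] using hR.to_localInverse he hn
  · simpa [h0] using hR.localInverse_apply_image he hn
  · have := hs.eventually_right_inverse
    rw [h0] at this
    exact this

section Preparation

open Asymptotics

variable {E : Type} [NormedAddCommGroup E] [NormedSpace ℝ E]

theorem isBigO_pow_of_le {a b : ℕ} (h : a ≤ b) : (fun t : ℝ => t ^ b) =O[𝓝 0] fun t => t ^ a :=
  IsBigO.of_bound 1 (by
    filter_upwards [Metric.ball_mem_nhds (0 : ℝ) one_pos] with t ht
    rw [norm_pow, norm_pow, one_mul]
    exact pow_le_pow_of_le_one (norm_nonneg _) (mem_ball_zero_iff.1 ht).le h)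

theorem fin_poly_eq_zero_of_isBigO {k : ℕ} {a : Fin k → ℝ}
    (h : (fun t : ℝ => ∑ j, a j * t ^ j.val) =O[𝓝 0] fun t => t ^ k) : a = 0 := by
  have h1 := poly_eq_zero_of_isBigO (a := fun j => if hj : j < k then a ⟨j, hj⟩ else 0)
    ((h.mono (nhdsWithin_le_nhds (s := {0}ᶜ))).congr_left fun t => by
      rw [← Fin.sum_univ_eq_sum_range (fun j => (if hj : j < k then a ⟨j, hj⟩ else 0) * t ^ j)]
      simp)
  funext j
  simpa using h1 j j.isLt

/-- If `r` are the coefficients of the remainder of a generic division of `g`, and `g` has order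
exactly `d + 1` along the first axis, then `(x, μ) ↦ (x, r (x, μ))` is a local diffeomorphism. -/
theorem generic_remainder_regular {d : ℕ} {g : ℝ × E → ℝ} (hg : ContDiff ℝ (⊤ : ℕ∞) g)
    (h0 : ∀ j ≤ d, iteratedDeriv j (fun t => g (t, 0)) 0 = 0)
    (h1 : iteratedDeriv (d + 1) (fun t => g (t, 0)) 0 ≠ 0)
    {r : Fin (d + 1) → E × (Fin (d + 1) → ℝ) → ℝ} (hr : ∀ j, ContDiff ℝ (⊤ : ℕ∞) (r j))
    (hdiv : ∀ᶠ p : ℝ × E × (Fin (d + 1) → ℝ) in 𝓝 0,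
        p.1 ^ (d + 1) + ∑ j, p.2.2 j * p.1 ^ j.val = 0 →
        g (p.1, p.2.1) = ∑ j, r j p.2 * p.1 ^ j.val) :
    (∀ j, r j 0 = 0) ∧ fderiv ℝ (r 0) 0 (0, Pi.single 0 1) ≠ 0 ∧
      ∀ v, (∀ j, fderiv ℝ (r j) 0 (0, v) = 0) → v = 0 := by
  set e : Fin (d + 1) → ℝ := Pi.single 0 1 with he
  have hn : ((⊤ : ℕ∞) : WithTop ℕ∞) ≠ 0 := by simp
  have hes : ∀ (c t : ℝ), ∑ j : Fin (d + 1), (c • e) j * t ^ j.val = c := fun c t => by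
    rw [Finset.sum_eq_single 0] <;> simp +contextual [he]
  have hgt : ContDiff ℝ (⊤ : ℕ∞) fun t => g (t, 0) :=
    hg.comp (contDiff_id.prodMk contDiff_const)
  have hgO : (fun t => g (t, 0)) =O[𝓝 0] fun t => t ^ (d + 1) :=
    isBigO_of_iteratedDeriv_eq_zero (hgt.contDiffAt.of_le (mod_cast le_top))
      fun j hj => h0 j (by omega)
  have hpow : Tendsto (fun t : ℝ => -t ^ (d + 1)) (𝓝 0) (𝓝 0) := by
    have : Continuous fun t : ℝ => -t ^ (d + 1) := by fun_prop
    simpa using this.tendsto 0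
  have hw : ∀ j, ContDiff ℝ (⊤ : ℕ∞) fun y : ℝ => r j (0, y • e) := fun j =>
    (hr j).comp (contDiff_const.prodMk (contDiff_id.smul contDiff_const))
  have hwd : ∀ j, HasDerivAt (fun y : ℝ => r j (0, y • e)) (fderiv ℝ (r j) 0 (0, e)) 0 := fun j => by
    have ha : HasDerivAt (fun y : ℝ => ((0 : E), y • e)) (0, e) 0 :=
      (hasDerivAt_const _ _).prodMk (by simpa using (hasDerivAt_id (0 : ℝ)).smul_const e)
    have hb : HasFDerivAt (r j) (fderiv ℝ (r j) 0) ((0 : E), (0 : ℝ) • e) := by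
      rw [zero_smul]
      exact ((hr j).differentiable hn 0).hasFDerivAt
    exact hb.comp_hasDerivAt 0 ha
  have hrO : ∀ j, (fun t : ℝ => r j (0, (-t ^ (d + 1)) • e) - r j 0) =O[𝓝 0] fun t => t ^ (d + 1) :=
    fun j => by
    have := (hwd j).isBigO_sub.comp_tendsto hpow
    refine (this.trans (isBigO_of_le _ fun t => ?_)).congr_left fun t => ?_
    · simp
    · simp [Prod.mk_zero_zero]
  have hline : ∀ᶠ t in 𝓝 (0 : ℝ), g (t, 0) = ∑ j, r j (0, (-t ^ (d + 1)) • e) * t ^ j.val := by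
    have hc : Tendsto (fun t : ℝ => (t, (0 : E), (-t ^ (d + 1)) • e)) (𝓝 0) (𝓝 0) := by
      have : Continuous fun t : ℝ => (t, (0 : E), (-t ^ (d + 1)) • e) := by fun_prop
      simpa [Prod.mk_zero_zero] using this.tendsto 0
    filter_upwards [hc.eventually hdiv] with t ht
    exact ht (by rw [hes]; ring)
  have hpO : ∀ j : ℕ, (fun t : ℝ => t ^ j) =O[𝓝 0] fun _ => (1 : ℝ) := fun j => by
    simpa using isBigO_pow_of_le (Nat.zero_le j)
  have hr0 : ∀ j, r j 0 = 0 := by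
    refine congrFun (fin_poly_eq_zero_of_isBigO (a := fun j => r j 0) ?_)
    have hs : (fun t : ℝ => ∑ j : Fin (d + 1), (r j (0, (-t ^ (d + 1)) • e) - r j 0) * t ^ j.val)
        =O[𝓝 0] fun t => t ^ (d + 1) :=
      IsBigO.fun_sum fun j _ => by simpa using (hrO j).mul (hpO j)
    refine (hgO.sub hs).congr' ?_ EventuallyEq.rfl
    filter_upwards [hline] with t ht
    rw [ht, ← Finset.sum_sub_distrib]
    exact Finset.sum_congr rfl fun j _ => by ring
  simp only [hr0, sub_zero] at hrO
  have ha : fderiv ℝ (r 0) 0 (0, e) ≠ 0 := fun ha => by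
    refine h1 (iteratedDeriv_eq_zero_of_isBigO (k := d + 2)
      (hgt.contDiffAt.of_le (WithTop.coe_le_coe.2 le_top)) ?_ (d + 1) (by omega))
    have hq : (fun y : ℝ => r 0 (0, y • e)) =O[𝓝 0] fun y => y ^ 2 := by
      refine isBigO_of_iteratedDeriv_eq_zero ((hw 0).contDiffAt.of_le (WithTop.coe_le_coe.2 le_top)) fun j hj => ?_
      interval_cases j
      · simpa [Prod.mk_zero_zero] using hr0 0
      · rw [iteratedDeriv_one, (hwd 0).deriv, ha]
    have hq2 := hq.comp_tendsto hpow
    have hs : (fun t : ℝ => ∑ j : Fin (d + 1), r j (0, (-t ^ (d + 1)) • e) * t ^ j.val)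
        =O[𝓝 0] fun t => t ^ (d + 2) := by
      refine IsBigO.fun_sum fun j _ => ?_
      rcases Fin.eq_zero_or_eq_succ j with rfl | ⟨i, rfl⟩
      · simp only [Fin.val_zero, pow_zero, mul_one]
        refine hq2.trans ((isBigO_of_le _ fun t => ?_).trans
          (isBigO_pow_of_le (show d + 2 ≤ (d + 1) * 2 by omega)))
        simp [pow_mul]
      · refine ((hrO i.succ).mul (isBigO_pow_of_le (show 1 ≤ i.succ.val by simp))).congr_right
          fun t => by ring
    exact hs.congr' (hline.mono fun t ht => ht.symm) EventuallyEq.rfl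
  refine ⟨hr0, ha, fun v hv => ?_⟩
  refine fin_poly_eq_zero_of_isBigO ?_
  set V : ℝ → ℝ := fun t => ∑ j : Fin (d + 1), v j * t ^ j.val with hV
  set B : Fin (d + 1) → ℝ → (E × (Fin (d + 1) → ℝ)) →L[ℝ] ℝ :=
    fun j t => fderiv ℝ (r j) (0, (-t ^ (d + 1)) • e) with hB
  have hid : ∀ᶠ t in 𝓝 (0 : ℝ), ∑ j, B j t (0, v - V t • e) * t ^ j.val = 0 := by
    have hc : Tendsto (fun q : ℝ × ℝ => (q.1, (0 : E), q.2 • v - (q.1 ^ (d + 1) + q.2 * V q.1) • e))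
        (𝓝 (0, 0)) (𝓝 0) := by
      have : Continuous fun q : ℝ × ℝ =>
          (q.1, (0 : E), q.2 • v - (q.1 ^ (d + 1) + q.2 * V q.1) • e) := by fun_prop
      simpa [Prod.mk_zero_zero] using this.tendsto (0, 0)
    filter_upwards [(hc.eventually hdiv).curry_nhds] with t ht
    have hconst : (fun s : ℝ => ∑ j, r j (0, s • v - (t ^ (d + 1) + s * V t) • e) * t ^ j.val)
        =ᶠ[𝓝 0] fun _ => g (t, 0) := by
      filter_upwards [ht] with s hs
      refine (hs ?_).symm
      simp only [Pi.sub_apply, sub_mul, Finset.sum_sub_distrib, hes]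
      simp only [hV, Pi.smul_apply, smul_eq_mul, Finset.mul_sum, mul_assoc]
      ring
    have hd : HasDerivAt (fun s : ℝ => ∑ j, r j (0, s • v - (t ^ (d + 1) + s * V t) • e) * t ^ j.val)
        (∑ j, B j t (0, v - V t • e) * t ^ j.val) 0 := by
      refine HasDerivAt.fun_sum fun j _ => HasDerivAt.mul_const ?_ _
      have ha : HasDerivAt (fun s : ℝ => ((0 : E), s • v - (t ^ (d + 1) + s * V t) • e))
          (0, v - V t • e) 0 := by
        refine (hasDerivAt_const _ _).prodMk ?_
        have h1 := (hasDerivAt_id (0 : ℝ)).smul_const v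
        have h2 := (((hasDerivAt_id (0 : ℝ)).mul_const (V t)).const_add (t ^ (d + 1))).smul_const e
        simpa using h1.fun_sub h2
      have hb : HasFDerivAt (r j) (B j t)
          ((0 : E), (0 : ℝ) • v - (t ^ (d + 1) + 0 * V t) • e) := by
        have : (0 : ℝ) • v - (t ^ (d + 1) + 0 * V t) • e = (-t ^ (d + 1)) • e := by
          simp
        rw [this]
        exact ((hr j).differentiable hn _).hasFDerivAt
      exact hb.comp_hasDerivAt 0 ha
    exact hd.unique ((hasDerivAt_const _ _).congr_of_eventuallyEq hconst)
  have hBO : ∀ j, (fun t => B j t (0, v)) =O[𝓝 0] fun t => t ^ (d + 1) := fun j => by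
    have hds : DifferentiableAt ℝ (fun p => fderiv ℝ (r j) p (0, v)) 0 := by
      have : ContDiff ℝ (⊤ : ℕ∞) fun p => fderiv ℝ (r j) p (0, v) :=
        ((hr j).fderiv_right (m := (⊤ : ℕ∞)) (by simp)).clm_apply contDiff_const
      exact this.differentiable hn 0
    have hc : Tendsto (fun t : ℝ => ((0 : E), (-t ^ (d + 1)) • e)) (𝓝 0) (𝓝 0) := by
      have : Continuous fun t : ℝ => ((0 : E), (-t ^ (d + 1)) • e) := by fun_prop
      simpa [Prod.mk_zero_zero] using this.tendsto 0
    have h2 := hds.isBigO_sub.comp_tendsto hc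
    simp only [Function.comp_def, hv, sub_zero] at h2
    refine h2.trans (IsBigO.of_bound ‖e‖ (Eventually.of_forall fun t => ?_))
    rw [Prod.norm_mk, norm_smul, norm_zero, norm_neg, max_eq_right (by positivity), mul_comm]
  have hS1 : (fun t => ∑ j, B j t (0, v) * t ^ j.val) =O[𝓝 0] fun t => t ^ (d + 1) :=
    IsBigO.fun_sum fun j _ => by simpa using (hBO j).mul (hpO j)
  set D : ℝ → ℝ := fun t => ∑ j, B j t (0, e) * t ^ j.val with hD
  have hVD : (fun t => V t * D t) =O[𝓝 0] fun t => t ^ (d + 1) := by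
    refine hS1.congr' ?_ EventuallyEq.rfl
    filter_upwards [hid] with t ht
    have e1 : ∀ j, B j t (0, v - V t • e) = B j t (0, v) - V t * B j t (0, e) := fun j => by
      have : ((0 : E), v - V t • e) = (0, v) - V t • ((0 : E), e) := by simp
      rw [this, map_sub, map_smul, smul_eq_mul]
    simp only [e1, sub_mul, Finset.sum_sub_distrib] at ht
    simp only [hD, Finset.mul_sum, ← mul_assoc]
    linarith
  have hDc : Continuous D := by
    refine continuous_finsetSum _ fun j _ => Continuous.mul ?_ (by fun_prop)
    have h2 : Continuous (fderiv ℝ (r j)) := (hr j).continuous_fderiv hn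
    exact (h2.comp (by fun_prop)).clm_apply continuous_const
  have hD0 : D 0 ≠ 0 := by
    have : D 0 = fderiv ℝ (r 0) 0 (0, e) := by
      simp only [hD]
      rw [Finset.sum_eq_single 0] <;> simp +contextual [hB, Prod.mk_zero_zero]
    rwa [this]
  have hinv : (fun t => (D t)⁻¹) =O[𝓝 0] fun _ => (1 : ℝ) :=
    ((hDc.tendsto 0).inv₀ hD0).isBigO_one ℝ
  have := hVD.mul hinv
  simp only [mul_one] at this
  refine this.congr' ?_ EventuallyEq.rfl
  filter_upwards [(hDc.tendsto 0).eventually_ne hD0] with t ht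
  field_simp

/-- Malgrange's preparation theorem for a function of order exactly `d + 1` in the first variable:
every smooth function is a combination of `1, t, …, t ^ d` with coefficients in `(x, g (t, x))`. -/
theorem exists_malgrange_division [FiniteDimensional ℝ E] {d : ℕ} {g : ℝ × E → ℝ}
    (hg : ContDiff ℝ (⊤ : ℕ∞) g)
    (h0 : ∀ j ≤ d, iteratedDeriv j (fun t => g (t, 0)) 0 = 0)
    (h1 : iteratedDeriv (d + 1) (fun t => g (t, 0)) 0 ≠ 0)
    {G : ℝ × E → ℝ} (hG : ContDiff ℝ (⊤ : ℕ∞) G) :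
    ∃ c : Fin (d + 1) → E × ℝ → ℝ, (∀ j, ContDiffAt ℝ (⊤ : ℕ∞) (c j) 0) ∧
      ∀ᶠ p : ℝ × E in 𝓝 0, G p = ∑ j, c j (p.2, g p) * p.1 ^ j.val := by
  obtain ⟨r, hr, hdiv⟩ := exists_generic_division hg d
  obtain ⟨q, hq, hdivG⟩ := exists_generic_division hG d
  obtain ⟨hr0, ha, hreg⟩ := generic_remainder_regular hg h0 h1 hr hdiv
  have hn : ((⊤ : ℕ∞) : WithTop ℕ∞) ≠ 0 := by simp
  set e : Fin (d + 1) → ℝ := Pi.single 0 1 with he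
  have hes : ∀ (c t : ℝ), ∑ j : Fin (d + 1), (c • e) j * t ^ j.val = c := fun c t => by
    rw [Finset.sum_eq_single 0] <;> simp +contextual [he]
  let R : E × (Fin (d + 1) → ℝ) → E × (Fin (d + 1) → ℝ) := fun p => (p.1, fun j => r j p)
  have hR : ContDiff ℝ (⊤ : ℕ∞) R := contDiff_fst.prodMk (contDiff_pi.2 hr)
  have hR0 : R 0 = 0 := Prod.ext rfl (funext hr0)
  have hRd : HasFDerivAt R ((ContinuousLinearMap.fst ℝ _ _).prod
      (ContinuousLinearMap.pi fun j => fderiv ℝ (r j) 0)) 0 :=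
    hasFDerivAt_fst.prodMk (hasFDerivAt_pi.2 fun j => ((hr j).differentiable hn 0).hasFDerivAt)
  obtain ⟨S, hS, hS0, -, hRS⟩ := exists_local_inverse hR.contDiffAt hR0 fun v hv => by
    rw [hRd.fderiv] at hv
    have hv1 : v.1 = 0 := congrArg Prod.fst hv
    have hv2 : ∀ j, fderiv ℝ (r j) 0 v = 0 := fun j => congrFun (congrArg Prod.snd hv) j
    refine Prod.ext hv1 (hreg v.2 fun j => ?_)
    rw [← hv2 j, ← hv1]
  let I : E × ℝ → E × (Fin (d + 1) → ℝ) := fun p => (p.1, p.2 • e)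
  have hI : ContDiff ℝ (⊤ : ℕ∞) I := contDiff_fst.prodMk (contDiff_snd.smul contDiff_const)
  have hI0 : I 0 = 0 := Prod.ext rfl (zero_smul ℝ e)
  have hSI : ContDiffAt ℝ (⊤ : ℕ∞) (fun p => (S (I p)).2) 0 :=
    (ContDiffAt.comp (g := S) 0 (by rwa [hI0]) hI.contDiffAt).snd
  refine ⟨fun j p => q j (p.1, (S (I p)).2), fun j =>
    (hq j).contDiffAt.comp 0 (contDiffAt_fst.prodMk hSI), ?_⟩
  have hg0 : g 0 = 0 := by simpa [Prod.mk_zero_zero] using h0 0 (Nat.zero_le d)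
  have hgI : Tendsto (fun p : ℝ × E => I (p.2, g p)) (𝓝 0) (𝓝 0) := by
    have : Continuous fun p : ℝ × E => I (p.2, g p) :=
      hI.continuous.comp (continuous_snd.prodMk hg.continuous)
    have h := this.tendsto 0
    rwa [hg0, show ((0 : ℝ × E).2, (0 : ℝ)) = 0 from rfl, hI0] at h
  have hμ : Tendsto (fun p : ℝ × E => (S (I (p.2, g p))).2) (𝓝 0) (𝓝 0) := by
    have := (continuous_snd.continuousAt.comp hS.continuousAt).tendsto
    simp only [Function.comp_def, hS0] at this
    exact this.comp hgI
  have hfst : Tendsto (fun p : ℝ × E => p.1) (𝓝 0) (𝓝 0) := continuous_fst.tendsto 0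
  have hsnd : Tendsto (fun p : ℝ × E => p.2) (𝓝 0) (𝓝 0) := continuous_snd.tendsto 0
  have hT : Tendsto (fun p : ℝ × E => (p.1, p.2, (S (I (p.2, g p))).2)) (𝓝 0) (𝓝 0) :=
    hfst.prodMk_nhds (hsnd.prodMk_nhds hμ)
  let π : ℝ × E → ℝ := fun p => p.1 ^ (d + 1) + ∑ j, (S (I (p.2, g p))).2 j * p.1 ^ j.val
  have hπ : Tendsto π (𝓝 0) (𝓝 0) := by
    have hc : Continuous fun z : ℝ × E × (Fin (d + 1) → ℝ) =>
      z.1 ^ (d + 1) + ∑ j, z.2.2 j * z.1 ^ j.val := by fun_prop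
    have := (hc.tendsto 0).comp hT
    simpa [Function.comp_def] using this
  have hT' : Tendsto (fun p : ℝ × E => (p.1, p.2, (S (I (p.2, g p))).2 - π p • e)) (𝓝 0) (𝓝 0) := by
    refine hfst.prodMk_nhds (hsnd.prodMk_nhds ?_)
    simpa using hμ.sub (hπ.smul_const e)
  let K : ℝ × E × (Fin (d + 1) → ℝ) → ℝ := fun z => ∑ j, r j z.2 * z.1 ^ j.val
  have hK : ContDiff ℝ (⊤ : ℕ∞) K :=
    ContDiff.sum fun j _ => ((hr j).comp contDiff_snd).mul (contDiff_fst.pow _)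
  have hKs := (hK.contDiffAt (x := 0)).hasStrictFDerivAt hn
  have hKe : fderiv ℝ K 0 (0, 0, e) = fderiv ℝ (r 0) 0 (0, e) := by
    have h1 := (hK.differentiable hn 0).hasFDerivAt.comp_hasDerivAt_of_eq (0 : ℝ)
      (((hasDerivAt_id (0 : ℝ)).smul_const ((0 : ℝ), (0 : E), e))) (by simp)
    have h2 := ((hr 0).differentiable hn 0).hasFDerivAt.comp_hasDerivAt_of_eq (0 : ℝ)
      (((hasDerivAt_id (0 : ℝ)).smul_const ((0 : E), e))) (by simp)
    have h3 : (K ∘ fun y : ℝ => id y • ((0 : ℝ), (0 : E), e)) =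
        r 0 ∘ fun y : ℝ => id y • ((0 : E), e) := funext fun y => by
      simp only [Function.comp_apply, K]
      rw [Finset.sum_eq_single 0] <;> simp +contextual
    rw [h3] at h1
    simpa using h1.unique h2
  have hlo := (hKs.isLittleO.comp_tendsto (hT.prodMk_nhds hT')).bound
    (c := ‖fderiv ℝ (r 0) 0 (0, e)‖ / (2 * (‖e‖ + 1))) (by
      have := norm_pos_iff.2 ha
      positivity)
  filter_upwards [hgI.eventually hRS, hT.eventually hdivG, hT'.eventually hdiv, hlo]
    with p hp1 hp2 hp3 hp4
  set μ := (S (I (p.2, g p))).2 with hμd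
  have hx : (S (I (p.2, g p))).1 = p.2 := congrArg Prod.fst hp1
  have hSe : S (I (p.2, g p)) = (p.2, μ) := Prod.ext hx rfl
  have hrμ : ∀ j, r j (p.2, μ) = (g p • e) j := fun j => by
    rw [← hSe]; exact congrFun (congrArg Prod.snd hp1) j
  have hK1 : K (p.1, p.2, μ) = g p := by
    simp only [K, hrμ, hes]
  have hK2 : K (p.1, p.2, μ - π p • e) = g p := by
    refine (hp3 ?_).symm
    simp only [Pi.sub_apply, sub_mul, Finset.sum_sub_distrib, hes]
    simp only [π, ← hμd]
    ring
  have hπ0 : π p = 0 := by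
    by_contra hne
    simp only [Function.comp_apply] at hp4
    have hdiff : (p.1, p.2, μ) - (p.1, p.2, μ - π p • e) = π p • ((0 : ℝ), (0 : E), e) := by
      simp
    rw [hK1, hK2, hdiff, map_smul, hKe, sub_self, zero_sub, norm_neg, norm_smul, norm_smul,
      mul_left_comm] at hp4
    have h5 := le_of_mul_le_mul_left hp4 (norm_pos_iff.2 hne)
    have h6 : ‖((0 : ℝ), (0 : E), e)‖ = ‖e‖ := by simp [Prod.norm_mk]
    rw [h6, div_mul_eq_mul_div, le_div_iff₀ (by positivity)] at h5
    have := norm_pos_iff.2 ha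
    nlinarith [norm_nonneg e]
  exact hp2 hπ0

end Preparation

section PreparationJets

open Asymptotics

variable {E : Type} [NormedAddCommGroup E] [NormedSpace ℝ E]

/-- First order information on the coefficients in the preparation theorem. -/
theorem malgrange_coeff_jets {d : ℕ} {g G : ℝ × E → ℝ}
    (hg : ContDiff ℝ (⊤ : ℕ∞) g) (hG : ContDiff ℝ (⊤ : ℕ∞) G)
    (hg0 : ∀ j ≤ d, iteratedDeriv j (fun t => g (t, 0)) 0 = 0)
    (hG0 : ∀ j ≤ d, iteratedDeriv j (fun t => G (t, 0)) 0 = 0)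
    {K : Fin (d + 1) → E × ℝ → ℝ} (hK : ∀ j, ContDiffAt ℝ (⊤ : ℕ∞) (K j) 0)
    (hGK : ∀ᶠ p : ℝ × E in 𝓝 0, G p = ∑ j, K j (p.2, g p) * p.1 ^ j.val) :
    (∀ j, K j 0 = 0) ∧
    iteratedDeriv (d + 1) (fun t => G (t, 0)) 0 =
      fderiv ℝ (K 0) 0 (0, 1) * iteratedDeriv (d + 1) (fun t => g (t, 0)) 0 ∧
    ∀ ξ : E, (fun t : ℝ => fderiv ℝ G (t, 0) (0, ξ) -
      (∑ j, fderiv ℝ (K j) 0 (ξ, 0) * t ^ j.val +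
        (∑ j, fderiv ℝ (K j) 0 (0, 1) * t ^ j.val) * fderiv ℝ g (t, 0) (0, ξ)))
      =O[𝓝 0] fun t => t ^ (d + 1) := by
  have hn : ((⊤ : ℕ∞) : WithTop ℕ∞) ≠ 0 := by simp
  have hline : ∀ {u : ℝ × E → ℝ}, ContDiff ℝ (⊤ : ℕ∞) u → ContDiff ℝ (⊤ : ℕ∞) fun t => u (t, 0) :=
    fun hu => hu.comp (contDiff_id.prodMk contDiff_const)
  have hgO : (fun t => g (t, 0)) =O[𝓝 0] fun t => t ^ (d + 1) :=
    isBigO_of_iteratedDeriv_eq_zero ((hline hg).contDiffAt.of_le (WithTop.coe_le_coe.2 le_top))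
      fun j hj => hg0 j (by omega)
  have hGO : (fun t => G (t, 0)) =O[𝓝 0] fun t => t ^ (d + 1) :=
    isBigO_of_iteratedDeriv_eq_zero ((hline hG).contDiffAt.of_le (WithTop.coe_le_coe.2 le_top))
      fun j hj => hG0 j (by omega)
  have hg00 : g (0, 0) = 0 := by simpa using hg0 0 (Nat.zero_le d)
  have hpO : ∀ j : ℕ, (fun t : ℝ => t ^ j) =O[𝓝 0] fun _ => (1 : ℝ) := fun j => by
    simpa using isBigO_pow_of_le (Nat.zero_le j)
  have hz : Tendsto (fun t : ℝ => (t, (0 : E))) (𝓝 0) (𝓝 0) := by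
    have : Continuous fun t : ℝ => (t, (0 : E)) := by fun_prop
    simpa [Prod.mk_zero_zero] using this.tendsto 0
  have hzg : Tendsto (fun t : ℝ => ((0 : E), g (t, 0))) (𝓝 0) (𝓝 0) := by
    have : Continuous fun t : ℝ => ((0 : E), g (t, 0)) := continuous_const.prodMk (hline hg).continuous
    have h := this.tendsto 0
    rw [hg00] at h
    exact h
  have hzgO : (fun t : ℝ => ((0 : E), g (t, 0))) =O[𝓝 0] fun t => t ^ (d + 1) :=
    (isBigO_of_le _ fun t => by simp [Prod.norm_mk]).trans hgO
  have hKd : ∀ j, DifferentiableAt ℝ (K j) 0 := fun j => (hK j).differentiableAt hn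
  have hKO : ∀ j, (fun t : ℝ => K j (0, g (t, 0)) - K j 0) =O[𝓝 0] fun t => t ^ (d + 1) := fun j => by
    have := (hKd j).isBigO_sub.comp_tendsto hzg
    simp only [Function.comp_def, sub_zero] at this
    exact this.trans hzgO
  have hid := hz.eventually hGK
  have hK0 : ∀ j, K j 0 = 0 := by
    refine congrFun (fin_poly_eq_zero_of_isBigO (a := fun j => K j 0) ?_)
    have hs : (fun t : ℝ => ∑ j : Fin (d + 1), (K j (0, g (t, 0)) - K j 0) * t ^ j.val)
        =O[𝓝 0] fun t => t ^ (d + 1) :=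
      IsBigO.fun_sum fun j _ => by simpa using (hKO j).mul (hpO j)
    refine (hGO.sub hs).congr' ?_ EventuallyEq.rfl
    filter_upwards [hid] with t ht
    rw [ht, ← Finset.sum_sub_distrib]
    exact Finset.sum_congr rfl fun j _ => by ring
  simp only [hK0, sub_zero] at hKO
  refine ⟨hK0, ?_, fun ξ => ?_⟩
  · set c := fderiv ℝ (K 0) 0 (0, 1) with hc
    have hq : (fun y : ℝ => K 0 ((0 : E), y) - c * y) =O[𝓝 0] fun y => y ^ 2 := by
      have ha : ContDiffAt ℝ (⊤ : ℕ∞) (fun y : ℝ => K 0 ((0 : E), y)) 0 :=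
        ContDiffAt.comp (g := K 0) 0 (hK 0) (contDiffAt_const.prodMk contDiffAt_id)
      have hd : HasDerivAt (fun y : ℝ => K 0 ((0 : E), y)) c 0 :=
        HasFDerivAt.comp_hasDerivAt (l := K 0) 0 (hKd 0).hasFDerivAt
          ((hasDerivAt_const _ _).prodMk (hasDerivAt_id (0 : ℝ)))
      refine isBigO_of_iteratedDeriv_eq_zero ((ha.sub (contDiffAt_const.mul contDiffAt_id)).of_le
        (WithTop.coe_le_coe.2 le_top)) fun j hj => ?_
      interval_cases j
      · simpa [Prod.mk_zero_zero] using hK0 0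
      · rw [iteratedDeriv_one]
        simpa using (hd.fun_sub ((hasDerivAt_id (0 : ℝ)).const_mul c)).deriv
    have hgt : Tendsto (fun t : ℝ => g (t, 0)) (𝓝 0) (𝓝 0) := by
      simpa [hg00] using (hline hg).continuous.tendsto 0
    have hq2 : (fun t : ℝ => K 0 ((0 : E), g (t, 0)) - c * g (t, 0)) =O[𝓝 0] fun t => t ^ (d + 2) := by
      refine (hq.comp_tendsto hgt).trans ?_
      refine ((hgO.pow 2).congr_right fun t => (pow_mul t (d + 1) 2).symm).trans
        (isBigO_pow_of_le (show d + 2 ≤ (d + 1) * 2 by omega))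
    have hmain : (fun t => G (t, 0) - c * g (t, 0)) =O[𝓝 0] fun t => t ^ (d + 2) := by
      have hs : (fun t : ℝ => ∑ j : Fin d, K j.succ (0, g (t, 0)) * t ^ j.succ.val)
          =O[𝓝 0] fun t => t ^ (d + 2) :=
        IsBigO.fun_sum fun j _ =>
          ((hKO j.succ).mul (isBigO_pow_of_le (show 1 ≤ j.succ.val by simp))).congr_right
            fun t => by ring
      refine (hq2.add hs).congr' ?_ EventuallyEq.rfl
      filter_upwards [hid] with t ht
      rw [ht, Fin.sum_univ_succ]
      simp
      ring
    have hsm : ContDiffAt ℝ ((d + 2 : ℕ) : WithTop ℕ∞) (fun t => G (t, 0) - c * g (t, 0)) 0 :=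
      ((hline hG).sub (contDiff_const.mul (hline hg))).contDiffAt.of_le (WithTop.coe_le_coe.2 le_top)
    have hr := iteratedDeriv_eq_zero_of_isBigO hsm hmain (d + 1) (by omega)
    rw [iteratedDeriv_fun_sub ((hline hG).contDiffAt.of_le (WithTop.coe_le_coe.2 le_top))
      ((contDiff_const.mul (hline hg)).contDiffAt.of_le (WithTop.coe_le_coe.2 le_top)),
      iteratedDeriv_const_mul_field] at hr
    linarith
  · have hfG : ∀ᶠ t in 𝓝 (0 : ℝ), fderiv ℝ G (t, 0) (0, ξ) =
        ∑ j, fderiv ℝ (K j) (0, g (t, 0)) (ξ, fderiv ℝ g (t, 0) (0, ξ)) * t ^ j.val := by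
      have hKe : ∀ᶠ t in 𝓝 (0 : ℝ), ∀ j, DifferentiableAt ℝ (K j) (0, g (t, 0)) :=
        eventually_all.2 fun j => hzg.eventually
          ((((hK j).of_le (m := 1) (WithTop.coe_le_coe.2 le_top)).eventually (by simp)).mono
            fun y hy => hy.differentiableAt (by simp))
      filter_upwards [hz.eventually hGK.eventually_nhds, hKe] with t ht hKt
      have hl : HasDerivAt (fun s : ℝ => (t, s • ξ)) ((0 : ℝ), ξ) 0 :=
        (hasDerivAt_const _ _).prodMk (by simpa using (hasDerivAt_id (0 : ℝ)).smul_const ξ)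
      have h1 : HasDerivAt (fun s : ℝ => G (t, s • ξ)) (fderiv ℝ G (t, 0) (0, ξ)) 0 :=
        (hG.differentiable hn (t, 0)).hasFDerivAt.comp_hasDerivAt_of_eq 0 hl (by simp)
      have h2 : HasDerivAt (fun s : ℝ => g (t, s • ξ)) (fderiv ℝ g (t, 0) (0, ξ)) 0 :=
        (hg.differentiable hn (t, 0)).hasFDerivAt.comp_hasDerivAt_of_eq 0 hl (by simp)
      have h3 : HasDerivAt (fun s : ℝ => ∑ j, K j (s • ξ, g (t, s • ξ)) * t ^ j.val)
          (∑ j, fderiv ℝ (K j) (0, g (t, 0)) (ξ, fderiv ℝ g (t, 0) (0, ξ)) * t ^ j.val) 0 :=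
        HasDerivAt.fun_sum fun j _ => HasDerivAt.mul_const
          ((hKt j).hasFDerivAt.comp_hasDerivAt_of_eq 0
            (HasDerivAt.prodMk (by simpa using (hasDerivAt_id (0 : ℝ)).smul_const ξ) h2) (by simp)) _
      refine h1.unique (h3.congr_of_eventuallyEq ?_)
      have hc : Tendsto (fun s : ℝ => (t, s • ξ)) (𝓝 0) (𝓝 (t, 0)) := by
        have : Continuous fun s : ℝ => (t, s • ξ) := by fun_prop
        simpa using this.tendsto 0
      exact hc.eventually ht
    have hγ : Continuous fun t : ℝ => fderiv ℝ g (t, 0) (0, ξ) :=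
      ((hg.continuous_fderiv hn).comp (by fun_prop : Continuous fun t : ℝ => (t, (0 : E)))).clm_apply
        continuous_const
    have hγO : (fun t : ℝ => (ξ, fderiv ℝ g (t, 0) (0, ξ))) =O[𝓝 0] fun _ => (1 : ℝ) :=
      ((continuous_const.prodMk hγ).tendsto 0).isBigO_one ℝ
    have hDO : ∀ j, (fun t : ℝ => (fderiv ℝ (K j) (0, g (t, 0)) - fderiv ℝ (K j) 0)
        (ξ, fderiv ℝ g (t, 0) (0, ξ))) =O[𝓝 0] fun t => t ^ (d + 1) := fun j => by
      have hd : DifferentiableAt ℝ (fderiv ℝ (K j)) 0 :=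
        ((hK j).fderiv_right (m := 1) (by exact WithTop.coe_le_coe.2 le_top)).differentiableAt (by simp)
      have h1 := hd.isBigO_sub.comp_tendsto hzg
      simp only [Function.comp_def, sub_zero] at h1
      have h2 := (h1.trans hzgO).norm_left.mul hγO.norm_left
      simp only [mul_one] at h2
      exact (isBigO_of_le _ fun t => by
        rw [norm_mul, norm_norm, norm_norm]; exact ContinuousLinearMap.le_opNorm _ _).trans h2
    have hs : (fun t : ℝ => ∑ j, (fderiv ℝ (K j) (0, g (t, 0)) - fderiv ℝ (K j) 0)
        (ξ, fderiv ℝ g (t, 0) (0, ξ)) * t ^ j.val) =O[𝓝 0] fun t => t ^ (d + 1) :=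
      IsBigO.fun_sum fun j _ => by simpa using (hDO j).mul (hpO j)
    refine hs.congr' ?_ EventuallyEq.rfl
    filter_upwards [hfG] with t ht
    have e1 : ∀ j, fderiv ℝ (K j) 0 (ξ, fderiv ℝ g (t, 0) (0, ξ)) =
        fderiv ℝ (K j) 0 (ξ, 0) + fderiv ℝ g (t, 0) (0, ξ) * fderiv ℝ (K j) 0 (0, 1) := fun j => by
      rw [← smul_eq_mul, ← map_smul, ← map_add]
      simp
    rw [ht, Finset.sum_mul, ← Finset.sum_add_distrib, ← Finset.sum_sub_distrib]
    refine Finset.sum_congr rfl fun j _ => ?_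
    rw [_root_.sub_apply, e1]
    ring

end PreparationJets

section Family

open Asymptotics

variable {E : Type} [NormedAddCommGroup E] [NormedSpace ℝ E]

theorem contDiff_axis {u : ℝ × E → ℝ} (hu : ContDiff ℝ (⊤ : ℕ∞) u) :
    ContDiff ℝ (⊤ : ℕ∞) fun t => u (t, 0) :=
  hu.comp (contDiff_id.prodMk contDiff_const)

theorem contDiff_fderiv_axis {u : ℝ × E → ℝ} (hu : ContDiff ℝ (⊤ : ℕ∞) u) (v : ℝ × E) :
    ContDiff ℝ (⊤ : ℕ∞) fun t => fderiv ℝ u (t, 0) v :=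
  contDiff_axis ((hu.fderiv_right (m := (⊤ : ℕ∞)) (by simp)).clm_apply contDiff_const)

theorem sum_fin_eq_add_last {r : ℕ} (a : Fin (r + 1) → ℝ) (h : ∀ j, j ≠ 0 → j.val < r → a j = 0)
    (h0 : a 0 = 0) (t : ℝ) : ∑ j, a j * t ^ j.val = a (Fin.last r) * t ^ r := by
  rw [Finset.sum_eq_single (Fin.last r) _ (by simp), Fin.val_last]
  intro j _ hj
  by_cases hj0 : j = 0
  · rw [hj0, h0, zero_mul]
  · rw [h j hj0 (Fin.lt_last_iff_ne_last.2 hj), zero_mul]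

/-- Preparation of a family of functions with respect to its last member. -/
theorem exists_family_preparation [FiniteDimensional ℝ E] {r p : ℕ}
    {F : Fin (p + 1) → ℝ × E → ℝ} (hF : ∀ i, ContDiff ℝ (⊤ : ℕ∞) (F i))
    (hz : ∀ i ξ, fderiv ℝ (F i) 0 (0, ξ) = 0)
    (h0 : ∀ i, ∀ j ≤ r, iteratedDeriv j (fun t => F i (t, 0)) 0 = 0)
    (h1 : iteratedDeriv (r + 1) (fun t => F (Fin.last p) (t, 0)) 0 ≠ 0)
    (h2 : ∀ i, i ≠ Fin.last p → iteratedDeriv (r + 1) (fun t => F i (t, 0)) 0 = 0) :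
    ∃ K : Fin (p + 1) → Fin (r + 1) → E × ℝ → ℝ,
      (∀ i j, ContDiffAt ℝ (⊤ : ℕ∞) (K i j) 0) ∧ (∀ i j, K i j 0 = 0) ∧
      fderiv ℝ (K (Fin.last p) 0) 0 (0, 1) ≠ 0 ∧
      (∀ ξ, fderiv ℝ (K (Fin.last p) 0) 0 (ξ, 0) = 0) ∧
      (∀ i, i ≠ Fin.last p → ∀ᶠ z : ℝ × E in 𝓝 0,
        F i z = ∑ j, K i j (z.2, F (Fin.last p) z) * z.1 ^ j.val) ∧
      (∀ᶠ z : ℝ × E in 𝓝 0,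
        -z.1 ^ (r + 1) = ∑ j, K (Fin.last p) j (z.2, F (Fin.last p) z) * z.1 ^ j.val) ∧
      ∀ ξ, (∀ i j, j ≠ 0 → (i ≠ Fin.last p ∨ j.val < r) → fderiv ℝ (K i j) 0 (ξ, 0) = 0) →
        ∀ i, ∀ s ≤ r, (i ≠ Fin.last p ∨ s < r) →
          iteratedDeriv s (fun t => fderiv ℝ (F i) (t, 0) (0, ξ)) 0 = 0 := by
  set g := F (Fin.last p) with hgdef
  let G : Fin (p + 1) → ℝ × E → ℝ := fun i => if i = Fin.last p then fun z => -z.1 ^ (r + 1) else F i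
  have hGl : G (Fin.last p) = fun z => -z.1 ^ (r + 1) := if_pos rfl
  have hGn : ∀ i, i ≠ Fin.last p → G i = F i := fun i hi => if_neg hi
  have hP : ContDiff ℝ (⊤ : ℕ∞) fun z : ℝ × E => -z.1 ^ (r + 1) := (contDiff_fst.pow _).neg
  have hPder : ∀ (t : ℝ) (ξ : E), fderiv ℝ (fun z : ℝ × E => -z.1 ^ (r + 1)) (t, 0) (0, ξ) = 0 :=
    fun t ξ => by
    have h := ((hasFDerivAt_fst (𝕜 := ℝ) (p := (t, (0 : E)))).pow (r + 1)).fun_neg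
    rw [h.fderiv]
    simp
  have hG : ∀ i, ContDiff ℝ (⊤ : ℕ∞) (G i) := fun i => by
    by_cases hi : i = Fin.last p
    · rw [hi, hGl]; exact hP
    · rw [hGn i hi]; exact hF i
  have hpowder : ∀ j ≤ r, iteratedDeriv j (fun t : ℝ => -t ^ (r + 1)) 0 = 0 := fun j hj =>
    iteratedDeriv_eq_zero_of_isBigO (k := r + 1) (by fun_prop) (isBigO_refl _ _).neg_left j (by omega)
  have hG0 : ∀ i, ∀ j ≤ r, iteratedDeriv j (fun t => G i (t, 0)) 0 = 0 := fun i j hj => by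
    by_cases hi : i = Fin.last p
    · rw [hi, hGl]; exact hpowder j hj
    · rw [hGn i hi]; exact h0 i j hj
  choose K hK hGK using fun i => exists_malgrange_division (hF (Fin.last p)) (h0 _) h1 (hG i)
  have hjets := fun i => malgrange_coeff_jets (hF (Fin.last p)) (hG i) (h0 _) (hG0 i) (hK i) (hGK i)
  have hGz : ∀ i ξ, fderiv ℝ (G i) 0 (0, ξ) = 0 := fun i ξ => by
    by_cases hi : i = Fin.last p
    · rw [hi, hGl]; exact hPder 0 ξ
    · rw [hGn i hi]; exact hz i ξ
  have hξ0 : ∀ i ξ, fderiv ℝ (K i 0) 0 (ξ, 0) = 0 := fun i ξ => by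
    obtain ⟨c, hc⟩ := ((hjets i).2.2 ξ).bound
    have h := hc.self_of_nhds
    have h5 : fderiv ℝ (F (Fin.last p)) (0, 0) (0, ξ) = 0 := hz _ ξ
    have h6 : fderiv ℝ (G i) (0, 0) (0, ξ) = 0 := hGz i ξ
    rw [h5, h6, Finset.sum_eq_single 0 (fun j _ hj => by simp [Fin.val_ne_zero_iff.2 hj]) (by simp)]
      at h
    simpa using h
  have hl : fderiv ℝ (K (Fin.last p) 0) 0 (0, 1) ≠ 0 := fun h => by
    have h3 := (hjets (Fin.last p)).2.1
    rw [h, zero_mul, hGl] at h3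
    have h4 := iteratedDeriv_eq_of_isBigO (k := r + 2) (a := fun j => if j = r + 1 then -1 else 0)
      (u := fun t : ℝ => -t ^ (r + 1)) (by fun_prop) (by simp [isBigO_zero]) (r + 1) (by omega)
    rw [h3, if_pos rfl] at h4
    simp at h4
    exact Nat.factorial_ne_zero _ h4
  refine ⟨K, hK, fun i => (hjets i).1, hl, hξ0 _, fun i hi => ?_, ?_, fun ξ hξ => ?_⟩
  · have := hGK i
    rwa [hGn i hi] at this
  · have := hGK (Fin.last p)
    rwa [hGl] at this
  have hpO : ∀ j : ℕ, (fun t : ℝ => t ^ j) =O[𝓝 0] fun _ => (1 : ℝ) := fun j => by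
    simpa using isBigO_pow_of_le (Nat.zero_le j)
  have hgO : (fun t : ℝ => fderiv ℝ g (t, 0) (0, ξ)) =O[𝓝 0] fun t => t ^ r := by
    have h3 := (hjets (Fin.last p)).2.2 ξ
    simp only [hGl, hPder, zero_sub] at h3
    set U : ℝ → ℝ := fun t => ∑ j, fderiv ℝ (K (Fin.last p) j) 0 (0, 1) * t ^ j.val with hU
    have h4 : (fun t : ℝ => U t * fderiv ℝ g (t, 0) (0, ξ)) =O[𝓝 0] fun t => t ^ r := by
      have h5 := (h3.neg_left.trans (isBigO_pow_of_le r.le_succ)).sub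
        (isBigO_const_mul_self (fderiv ℝ (K (Fin.last p) (Fin.last r)) 0 (ξ, 0))
          (fun t : ℝ => t ^ r) (𝓝 0))
      refine h5.congr_left fun t => ?_
      rw [sum_fin_eq_add_last (fun j => fderiv ℝ (K (Fin.last p) j) 0 (ξ, 0))
        (fun j hj hjr => hξ _ j hj (Or.inr hjr)) (hξ0 _ ξ)]
      ring
    have hUc : Continuous U := by fun_prop
    have hU0 : U 0 ≠ 0 := by
      have : U 0 = fderiv ℝ (K (Fin.last p) 0) 0 (0, 1) := by
        simp only [hU]
        rw [Finset.sum_eq_single 0] <;> simp +contextual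
      rwa [this]
    have hinv : (fun t => (U t)⁻¹) =O[𝓝 0] fun _ => (1 : ℝ) :=
      ((hUc.tendsto 0).inv₀ hU0).isBigO_one ℝ
    have := h4.mul hinv
    simp only [mul_one] at this
    refine this.congr' ?_ EventuallyEq.rfl
    filter_upwards [(hUc.tendsto 0).eventually_ne hU0] with t ht
    field_simp
  intro i s hs hi
  by_cases hil : i = Fin.last p
  · subst hil
    exact iteratedDeriv_eq_zero_of_isBigO (k := r)
      ((contDiff_fderiv_axis (hF _) _).contDiffAt.of_le (WithTop.coe_le_coe.2 le_top)) hgO s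
      (hi.resolve_left (by simp))
  · have h3 := (hjets i).2.2 ξ
    rw [hGn i hil] at h3
    have hKi : fderiv ℝ (K i 0) 0 (0, 1) = 0 := by
      have h4 := (hjets i).2.1
      rw [hGn i hil, h2 i hil] at h4
      exact (mul_eq_zero.1 h4.symm).resolve_right h1
    refine iteratedDeriv_eq_zero_of_isBigO (k := r + 1)
      ((contDiff_fderiv_axis (hF _) _).contDiffAt.of_le (WithTop.coe_le_coe.2 le_top)) ?_ s (by omega)
    have h4 : (fun t : ℝ => (∑ j : Fin (r + 1), fderiv ℝ (K i j) 0 (0, 1) * t ^ j.val) *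
        fderiv ℝ g (t, 0) (0, ξ)) =O[𝓝 0] fun t => t ^ (r + 1) := by
      have h5 : (fun t : ℝ => ∑ j : Fin (r + 1), fderiv ℝ (K i j) 0 (0, 1) * t ^ j.val)
          =O[𝓝 0] fun t => t ^ 1 := by
        refine IsBigO.fun_sum fun j _ => ?_
        rcases Fin.eq_zero_or_eq_succ j with rfl | ⟨l, rfl⟩
        · simp only [hKi, zero_mul]; exact isBigO_zero _ _
        · exact (isBigO_pow_of_le (by simp)).const_mul_left _
      exact (h5.mul hgO).congr_right fun t => by ring
    have h6 : ∀ t : ℝ, ∑ j : Fin (r + 1), fderiv ℝ (K i j) 0 (ξ, 0) * t ^ j.val = 0 := fun t =>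
      Finset.sum_eq_zero fun j _ => by
        by_cases hj : j = 0
        · rw [hj, hξ0, zero_mul]
        · rw [hξ i j hj (Or.inl hil), zero_mul]
    refine (h3.add h4).congr_left fun t => ?_
    rw [h6]
    ring

end Family

section Reduced

variable {E : Type} [NormedAddCommGroup E] [NormedSpace ℝ E]

theorem sum_mul_sub_pow (n : ℕ) (k : Fin n → ℝ) (a T : ℝ) :
    ∑ j, k j * (T - a) ^ j.val =
      ∑ l : Fin n, (∑ j, k j * (j.val.choose l.val * (-a) ^ (j.val - l.val))) * T ^ l.val := by
  have h : ∀ j : Fin n, (T - a) ^ j.val =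
      ∑ l : Fin n, T ^ l.val * (j.val.choose l.val * (-a) ^ (j.val - l.val)) := fun j => by
    rw [sub_eq_add_neg, add_pow,
      Fin.sum_univ_eq_sum_range (fun l => T ^ l * (j.val.choose l * (-a) ^ (j.val - l))) n]
    refine Eq.trans (Finset.sum_congr rfl fun l _ => by ring)
      (Finset.sum_subset (Finset.range_mono j.isLt) fun l _ hl => ?_)
    rw [Nat.choose_eq_zero_of_lt (by simpa using hl)]
    simp
  simp only [h, Finset.mul_sum, Finset.sum_mul]
  rw [Finset.sum_comm]
  exact Finset.sum_congr rfl fun l _ => Finset.sum_congr rfl fun j _ => by ring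

theorem hasFDerivAt_mul_of_eq_zero {u v : E → ℝ} (hu : DifferentiableAt ℝ u 0)
    (hv : DifferentiableAt ℝ v 0) (hu0 : u 0 = 0) (hv0 : v 0 = 0) :
    HasFDerivAt (fun x => u x * v x) (0 : E →L[ℝ] ℝ) 0 := by
  have h := hu.hasFDerivAt.fun_mul hv.hasFDerivAt
  simpa [hu0, hv0] using h

/-- The coefficient of `T ^ l` in `∑ j, k j * (T - a) ^ j`, plus that of `e * (T - a) ^ n`. -/
def shiftCoeff {n : ℕ} (e : ℝ) (k : Fin n → E → ℝ) (a : E → ℝ) (l : Fin n) (y : E) : ℝ :=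
  ∑ j, k j y * (j.val.choose l.val * (-a y) ^ (j.val - l.val)) +
    e * (n.choose l.val * (-a y) ^ (n - l.val))

theorem sum_shiftCoeff {n : ℕ} (e : ℝ) (k : Fin n → E → ℝ) (a : E → ℝ) (y : E) (T : ℝ) :
    ∑ l, shiftCoeff e k a l y * T ^ l.val =
      ∑ j, k j y * (T - a y) ^ j.val + e * ((T - a y) ^ n - T ^ n) := by
  have h := sum_mul_sub_pow (n + 1) (fun j => if j = Fin.last n then (1 : ℝ) else 0) (a y) T
  simp [Fin.sum_univ_castSucc] at h
  rw [sum_mul_sub_pow, h, add_sub_cancel_right, Finset.mul_sum, ← Finset.sum_add_distrib]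
  exact Finset.sum_congr rfl fun l _ => by rw [shiftCoeff]; ring

theorem contDiffAt_shiftCoeff {n : ℕ} {e : ℝ} {k : Fin n → E → ℝ} {a : E → ℝ}
    (hk : ∀ j, ContDiffAt ℝ (⊤ : ℕ∞) (k j) 0) (ha : ContDiffAt ℝ (⊤ : ℕ∞) a 0) (l : Fin n) :
    ContDiffAt ℝ (⊤ : ℕ∞) (shiftCoeff e k a l) 0 := by
  unfold shiftCoeff
  fun_prop

theorem shiftCoeff_zero {n : ℕ} {e : ℝ} {k : Fin n → E → ℝ} {a : E → ℝ}
    (hk : ∀ j, k j 0 = 0) (ha : a 0 = 0) (l : Fin n) : shiftCoeff e k a l 0 = 0 := by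
  have : n - l.val ≠ 0 := by omega
  simp [shiftCoeff, hk, ha, this]

theorem fderiv_shiftCoeff {n : ℕ} {e : ℝ} {k : Fin n → E → ℝ} {a : E → ℝ}
    (hk : ∀ j, DifferentiableAt ℝ (k j) 0) (hk0 : ∀ j, k j 0 = 0) (ha : DifferentiableAt ℝ a 0)
    (ha0 : a 0 = 0) (l : Fin n) (hl : e = 0 ∨ l.val + 1 < n) :
    fderiv ℝ (shiftCoeff e k a l) 0 = fderiv ℝ (k l) 0 := by
  have h1 : ∀ j, HasFDerivAt
      (fun y => k j y * (j.val.choose l.val * (-a y) ^ (j.val - l.val)))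
      (if j = l then fderiv ℝ (k l) 0 else 0) 0 := fun j => by
    rcases lt_trichotomy j l with h | h | h
    · rw [if_neg h.ne, Nat.choose_eq_zero_of_lt h]
      simpa using hasFDerivAt_const (0 : ℝ) (0 : E)
    · subst h
      simpa using (hk j).hasFDerivAt
    · rw [if_neg h.ne']
      refine hasFDerivAt_mul_of_eq_zero (hk j) (by fun_prop) (hk0 j) ?_
      have : j.val - l.val ≠ 0 := Nat.sub_ne_zero_of_lt h
      simp [ha0, this]
  have h2 : HasFDerivAt (fun y => e * (n.choose l.val * (-a y) ^ (n - l.val)))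
      (0 : E →L[ℝ] ℝ) 0 := by
    rcases hl with rfl | hl
    · simpa using hasFDerivAt_const (0 : ℝ) (0 : E)
    · obtain ⟨d, hd⟩ : ∃ d, n - l.val = d + 1 + 1 := ⟨n - l.val - 2, by omega⟩
      have := hasFDerivAt_mul_of_eq_zero (u := fun y => e * (n.choose l.val * (-a y) ^ (d + 1)))
        (v := fun y => -a y) (by fun_prop) (by fun_prop) (by simp [ha0]) (by simp [ha0])
      refine this.congr_of_eventuallyEq (Eventually.of_forall fun y => ?_)
      simp only [hd]
      ring
  have h := (HasFDerivAt.fun_sum fun j (_ : j ∈ Finset.univ) => h1 j).fun_add h2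
  have h3 := h.fderiv
  simp only [Finset.sum_ite_eq', Finset.mem_univ, if_true, add_zero] at h3
  exact h3

/-- Preparation of a family with respect to its last member, with the subleading coefficient
removed by a translation of the distinguished variable. -/
theorem exists_reduced_family_preparation [FiniteDimensional ℝ E] {r p : ℕ} (hr : 1 ≤ r)
    {F : Fin (p + 1) → ℝ × E → ℝ} (hF : ∀ i, ContDiff ℝ (⊤ : ℕ∞) (F i))
    (hz : ∀ i ξ, fderiv ℝ (F i) 0 (0, ξ) = 0)
    (h0 : ∀ i, ∀ j ≤ r, iteratedDeriv j (fun t => F i (t, 0)) 0 = 0)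
    (h1 : iteratedDeriv (r + 1) (fun t => F (Fin.last p) (t, 0)) 0 ≠ 0)
    (h2 : ∀ i, i ≠ Fin.last p → iteratedDeriv (r + 1) (fun t => F i (t, 0)) 0 = 0) :
    ∃ (C : Fin (p + 1) → Fin (r + 1) → E × ℝ → ℝ) (τ : E × ℝ → ℝ),
      ContDiffAt ℝ (⊤ : ℕ∞) τ 0 ∧ τ 0 = 0 ∧
      (∀ i j, ContDiffAt ℝ (⊤ : ℕ∞) (C i j) 0) ∧ (∀ i j, C i j 0 = 0) ∧
      fderiv ℝ (C (Fin.last p) 0) 0 (0, 1) ≠ 0 ∧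
      (∀ ξ, fderiv ℝ (C (Fin.last p) 0) 0 (ξ, 0) = 0) ∧
      (∀ y, C (Fin.last p) (Fin.last r) y = 0) ∧
      (∀ i, i ≠ Fin.last p → ∀ᶠ z : ℝ × E in 𝓝 0, F i z =
        ∑ j, C i j (z.2, F (Fin.last p) z) * (z.1 + τ (z.2, F (Fin.last p) z)) ^ j.val) ∧
      (∀ᶠ z : ℝ × E in 𝓝 0, -(z.1 + τ (z.2, F (Fin.last p) z)) ^ (r + 1) =
        ∑ j, C (Fin.last p) j (z.2, F (Fin.last p) z) *
          (z.1 + τ (z.2, F (Fin.last p) z)) ^ j.val) ∧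
      ∀ ξ, (∀ i j, j ≠ 0 → (i ≠ Fin.last p ∨ j.val < r) → fderiv ℝ (C i j) 0 (ξ, 0) = 0) →
        ∀ i, ∀ s ≤ r, (i ≠ Fin.last p ∨ s < r) →
          iteratedDeriv s (fun t => fderiv ℝ (F i) (t, 0) (0, ξ)) 0 = 0 := by
  obtain ⟨K, hK, hK0, hd, hd0, hKF, hKl, hker⟩ := exists_family_preparation hF hz h0 h1 h2
  let τ : E × ℝ → ℝ := fun y => K (Fin.last p) (Fin.last r) y / (r + 1)
  have hτ : ContDiffAt ℝ (⊤ : ℕ∞) τ 0 := (hK _ _).div_const _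
  have hτ0 : τ 0 = 0 := by simp [τ, hK0]
  let C : Fin (p + 1) → Fin (r + 1) → E × ℝ → ℝ := fun i =>
    shiftCoeff (if i = Fin.last p then 1 else 0) (K i) τ
  have hdiff : ∀ i j, (i ≠ Fin.last p ∨ j.val < r) →
      fderiv ℝ (C i j) 0 = fderiv ℝ (K i j) 0 := fun i j h =>
    fderiv_shiftCoeff (fun j => (hK i j).differentiableAt (by simp)) (hK0 i)
      (hτ.differentiableAt (by simp)) hτ0 j (h.imp (fun h => if_neg h) (by omega))
  have hl0 : fderiv ℝ (C (Fin.last p) 0) 0 = fderiv ℝ (K (Fin.last p) 0) 0 :=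
    hdiff _ _ (Or.inr (Nat.lt_of_succ_le hr))
  refine ⟨C, τ, hτ, hτ0, fun i j => contDiffAt_shiftCoeff (hK i) hτ j,
    fun i j => shiftCoeff_zero (hK0 i) hτ0 j, hl0 ▸ hd, hl0 ▸ hd0, fun y => ?_, fun i hi => ?_, ?_,
    fun ξ hξ => hker ξ fun i j hj h => hdiff i j h ▸ hξ i j hj h⟩
  · simp only [C, shiftCoeff, if_true]
    rw [Finset.sum_eq_single (Fin.last r)]
    · have : (r : ℝ) + 1 ≠ 0 := by positivity
      simp [τ]
      field_simp
      ring
    · intro j _ hj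
      rw [Nat.choose_eq_zero_of_lt (Fin.lt_last_iff_ne_last.2 hj)]
      simp
    · simp
  · filter_upwards [hKF i hi] with z hz
    simp only [C]
    rw [sum_shiftCoeff, if_neg hi, zero_mul, add_zero, add_sub_cancel_right, hz]
  · filter_upwards [hKl] with z hz
    simp only [C]
    rw [sum_shiftCoeff, if_true, one_mul, add_sub_cancel_right, ← hz]
    ring

end Reduced

section LastDerivative

/-- The unit vector in the last coordinate direction. -/
def lastVec (m : ℕ) : Fin m → ℝ := fun l => if l.val = m - 1 then 1 else 0

theorem contDiff_DlIter {m : ℕ} {g : (Fin m → ℝ) → ℝ} (hg : ContDiff ℝ (⊤ : ℕ∞) g) (j : ℕ) :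
    ContDiff ℝ (⊤ : ℕ∞) (DlIter g j) := by
  induction j with
  | zero => exact hg
  | succ j ih => exact (ih.fderiv_right (m := (⊤ : ℕ∞)) (by simp)).clm_apply contDiff_const

theorem hasDerivAt_axis {m : ℕ} {g : (Fin m → ℝ) → ℝ} (hg : ContDiff ℝ (⊤ : ℕ∞) g) (t : ℝ) :
    HasDerivAt (fun t : ℝ => g (t • lastVec m)) (Dl g (t • lastVec m)) t := by
  have h1 : HasDerivAt (fun t : ℝ => t • lastVec m) (lastVec m) t := by
    simpa using (hasDerivAt_id t).smul_const (lastVec m)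
  exact ((hg.differentiable (by simp)) _).hasFDerivAt.comp_hasDerivAt t h1

theorem iteratedDeriv_axis {m : ℕ} {g : (Fin m → ℝ) → ℝ} (hg : ContDiff ℝ (⊤ : ℕ∞) g) (j : ℕ) :
    iteratedDeriv j (fun t : ℝ => g (t • lastVec m)) = fun t => DlIter g j (t • lastVec m) := by
  induction j with
  | zero => simp [DlIter]
  | succ j ih =>
    rw [iteratedDeriv_succ, ih]
    exact funext fun t => (hasDerivAt_axis (contDiff_DlIter hg j) t).deriv

theorem fderiv_fderiv_apply_comm {E : Type} [NormedAddCommGroup E] [NormedSpace ℝ E] {g : E → ℝ}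
    (hg : ContDiff ℝ (⊤ : ℕ∞) g) (x v w : E) :
    fderiv ℝ (fun y => fderiv ℝ g y w) x v = fderiv ℝ (fun y => fderiv ℝ g y v) x w := by
  have h : DifferentiableAt ℝ (fderiv ℝ g) x :=
    ((hg.fderiv_right (m := (⊤ : ℕ∞)) (by simp)).differentiable (by simp)) x
  have h2 : ∀ u v, fderiv ℝ (fun y => fderiv ℝ g y u) x v = fderiv ℝ (fderiv ℝ g) x v u :=
    fun u v => by
    rw [fderiv_clm_apply h (by fun_prop)]
    simp
  rw [h2, h2]
  have h3 : minSmoothness ℝ 2 ≤ ((⊤ : ℕ∞) : WithTop ℕ∞) := by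
    simpa using WithTop.coe_le_coe.2 (le_top : (2 : ℕ∞) ≤ ⊤)
  exact (hg.contDiffAt.isSymmSndFDerivAt h3).eq v w

theorem fderiv_DlIter {m : ℕ} {g : (Fin m → ℝ) → ℝ} (hg : ContDiff ℝ (⊤ : ℕ∞) g) (j : ℕ)
    (v : Fin m → ℝ) :
    (fun x => fderiv ℝ (DlIter g j) x v) = DlIter (fun x => fderiv ℝ g x v) j := by
  induction j with
  | zero => rfl
  | succ j ih =>
    funext x
    have h := fderiv_fderiv_apply_comm (contDiff_DlIter hg j) x v (lastVec m)
    rw [ih] at h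
    exact h

/-- Iterated derivatives along the last axis of a directional derivative. -/
theorem iteratedDeriv_fderiv_axis {m : ℕ} {g : (Fin m → ℝ) → ℝ} (hg : ContDiff ℝ (⊤ : ℕ∞) g)
    (j : ℕ) (v : Fin m → ℝ) :
    iteratedDeriv j (fun t : ℝ => fderiv ℝ g (t • lastVec m) v) 0 =
      fderiv ℝ (DlIter g j) 0 v := by
  have h : ContDiff ℝ (⊤ : ℕ∞) fun x => fderiv ℝ g x v :=
    (hg.fderiv_right (m := (⊤ : ℕ∞)) (by simp)).clm_apply contDiff_const
  rw [iteratedDeriv_axis h, ← fderiv_DlIter hg]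
  simp

theorem sum_pd_mul {m : ℕ} (g : (Fin m → ℝ) → ℝ) (p v : Fin m → ℝ) :
    ∑ l : Fin m, pd g p l.val * v l = fderiv ℝ g p v := by
  have h := (fderiv ℝ g p).toLinearMap.pi_apply_eq_sum_univ v
  simp only [ContinuousLinearMap.coe_coe] at h
  rw [h]
  refine Finset.sum_congr rfl fun l _ => ?_
  rw [pd, smul_eq_mul, mul_comm]
  congr 3
  funext k
  simp [Fin.ext_iff, eq_comm]

theorem contDiff_comp {m n : ℕ} {f : (Fin m → ℝ) → (Fin n → ℝ)} (hf : ContDiff ℝ (⊤ : ℕ∞) f)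
    (q : ℕ) : ContDiff ℝ (⊤ : ℕ∞) (comp f q) := by
  unfold _root_.comp
  split_ifs with h
  · exact contDiff_pi.1 hf ⟨q, h⟩
  · exact contDiff_const

theorem isDiffeoGerm_of_injective {k : ℕ} {σ : (Fin k → ℝ) → (Fin k → ℝ)} (h0 : σ 0 = 0)
    (hσ : ContDiffAt ℝ (⊤ : ℕ∞) σ 0) (hinj : ∀ v, fderiv ℝ σ 0 v = 0 → v = 0) :
    IsDiffeoGerm σ := by
  refine ⟨h0, hσ, fun h => ?_⟩
  have h1 : LinearMap.ker (fderiv ℝ σ 0).toLinearMap = ⊥ := LinearMap.ker_eq_bot'.2 hinj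
  exact (LinearMap.bot_lt_ker_of_det_eq_zero h).ne' h1

theorem IsDiffeoGerm.injective {k : ℕ} {σ : (Fin k → ℝ) → (Fin k → ℝ)} (h : IsDiffeoGerm σ)
    (v : Fin k → ℝ) (hv : fderiv ℝ σ 0 v = 0) : v = 0 := by
  have h2 : LinearMap.ker (fderiv ℝ σ 0).toLinearMap = ⊥ :=
    ((fderiv ℝ σ 0).toLinearMap.equivOfDetNeZero h.2.2).ker
  exact LinearMap.ker_eq_bot'.1 h2 v hv

theorem IsDiffeoGerm.exists_inverse {k : ℕ} {σ : (Fin k → ℝ) → (Fin k → ℝ)}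
    (h : IsDiffeoGerm σ) : ∃ S, IsDiffeoGerm S ∧ (∀ᶠ x in 𝓝 0, S (σ x) = x) ∧
      ∀ᶠ y in 𝓝 0, σ (S y) = y := by
  obtain ⟨S, hS, hS0, h1, h2⟩ := exists_local_inverse h.2.1 h.1 h.injective
  refine ⟨S, isDiffeoGerm_of_injective hS0 hS fun v hv => ?_, h1, h2⟩
  have hd : HasFDerivAt S (fderiv ℝ S 0) 0 := (hS.differentiableAt (by simp)).hasFDerivAt
  have hd2 : HasFDerivAt σ (fderiv ℝ σ 0) (S 0) := by
    rw [hS0]; exact (h.2.1.differentiableAt (by simp)).hasFDerivAt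
  have h3 := (hd2.comp (0 : Fin k → ℝ) hd).congr_of_eventuallyEq
    (f₁ := id) (h2.mono fun y hy => hy.symm)
  have h4 := congrArg (fun A => A v) (h3.unique (hasFDerivAt_id _))
  simpa [hv] using h4.symm

end LastDerivative

section Coordinates

theorem exists_completing_functionals {V : Type} [AddCommGroup V] [Module ℝ V]
    [FiniteDimensional ℝ V] (S : Submodule ℝ V) {d : ℕ} (hd : Module.finrank ℝ S ≤ d) :
    ∃ c : ℕ → V →ₗ[ℝ] ℝ, ∀ v ∈ S, (∀ i < d, c i v = 0) → v = 0 := by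
  let b := Module.finBasis ℝ S
  choose c hc using fun i => LinearMap.exists_extend (b.coord i)
  refine ⟨fun i => if h : i < Module.finrank ℝ S then c ⟨i, h⟩ else 0, fun v hv h => ?_⟩
  suffices h1 : (⟨v, hv⟩ : S) = 0 from congrArg Subtype.val h1
  refine b.forall_coord_eq_zero_iff.1 fun i => ?_
  have h2 := h i.val (i.isLt.trans_le hd)
  beta_reduce at h2
  rw [dif_pos i.isLt] at h2
  rw [← hc i]
  exact h2

/-- The coordinates of the normal form: the prescribed coefficients, completed by linear
functionals. -/
theorem exists_completed_coordinates {N p r : ℕ} (hdim : r * (p + 1) ≤ N + 1)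
    {C : Fin (p + 1) → Fin (r + 1) → (Fin N → ℝ) × ℝ → ℝ}
    (hC : ∀ i j, ContDiffAt ℝ (⊤ : ℕ∞) (C i j) 0) (hC0 : ∀ i j, C i j 0 = 0)
    (S : Submodule ℝ (Fin N → ℝ)) (hS : Module.finrank ℝ S + r * (p + 1) ≤ N + 1)
    (hker : ∀ ξ, (∀ i j, j ≠ 0 → (i ≠ Fin.last p ∨ j.val < r) →
      fderiv ℝ (C i j) 0 (ξ, 0) = 0) → ξ ∈ S) :
    ∃ X : ℕ → (Fin N → ℝ) × ℝ → ℝ,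
      (∀ q, ContDiffAt ℝ (⊤ : ℕ∞) (X q) 0) ∧ (∀ q, X q 0 = 0) ∧
      (∀ (i : Fin (p + 1)) (j : Fin (r + 1)), j ≠ 0 → (i ≠ Fin.last p ∨ j.val < r) →
        i.val * r + (j.val - 1) < N ∧ X (i.val * r + (j.val - 1)) = C i j) ∧
      ∀ ξ, (∀ q < N, fderiv ℝ (X q) 0 (ξ, 0) = 0) → ξ = 0 := by
  rcases Nat.eq_zero_or_pos r with rfl | hr
  · obtain ⟨c, hc⟩ := exists_completing_functionals (⊤ : Submodule ℝ (Fin N → ℝ)) (d := N)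
      (by simp)
    let c' : ℕ → (Fin N → ℝ) × ℝ →L[ℝ] ℝ := fun q =>
      (LinearMap.toContinuousLinearMap (c q)).comp (ContinuousLinearMap.fst ℝ _ _)
    refine ⟨fun q => c' q, fun q => (c' q).contDiff.contDiffAt, fun q => map_zero _,
      fun i j hj _ => absurd (Fin.fin_one_eq_zero j) hj,
      fun ξ h => hc ξ trivial fun q hq => ?_⟩
    have := h q hq
    rw [(c' q).fderiv] at this
    exact this
  set M := r * (p + 1) - 1 with hM
  have hMp : 0 < r * (p + 1) := by positivity
  obtain ⟨c, hc⟩ := exists_completing_functionals S (d := N - M) (by omega)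
  let c' : ℕ → (Fin N → ℝ) × ℝ →L[ℝ] ℝ := fun q =>
    (LinearMap.toContinuousLinearMap (c q)).comp (ContinuousLinearMap.fst ℝ _ _)
  let X : ℕ → (Fin N → ℝ) × ℝ → ℝ := fun q =>
    if q < M then C (Fin.ofNat (p + 1) (q / r)) (Fin.ofNat (r + 1) (q % r + 1)) else c' (q - M)
  have hXC : ∀ (i : Fin (p + 1)) (j : Fin (r + 1)), j ≠ 0 → (i ≠ Fin.last p ∨ j.val < r) →
      i.val * r + (j.val - 1) < N ∧ X (i.val * r + (j.val - 1)) = C i j := fun i j hj h => by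
    have hj1 : 1 ≤ j.val := Nat.one_le_iff_ne_zero.2 (Fin.val_ne_zero_iff.2 hj)
    have hjr := j.isLt
    have hlt : i.val * r + (j.val - 1) < M := by
      rcases h with h | h
      · have h2 : i.val + 1 ≤ p := Fin.lt_last_iff_ne_last.2 h
        have h3 : (i.val + 1) * r ≤ p * r := Nat.mul_le_mul_right r h2
        have h4 : r * (p + 1) = p * r + r := by ring
        have h5 : (i.val + 1) * r = i.val * r + r := by ring
        omega
      · have h3 : i.val * r ≤ p * r := Nat.mul_le_mul_right r (Nat.lt_succ_iff.1 i.isLt)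
        have h4 : r * (p + 1) = p * r + r := by ring
        omega
    refine ⟨by omega, ?_⟩
    simp only [X, if_pos hlt]
    have h6 : (i.val * r + (j.val - 1)) / r = i.val := by
      rw [mul_comm, Nat.mul_add_div hr, Nat.div_eq_of_lt (by omega), add_zero]
    have h7 : (i.val * r + (j.val - 1)) % r + 1 = j.val := by
      rw [mul_comm, Nat.mul_add_mod, Nat.mod_eq_of_lt (by omega)]
      omega
    rw [h6, h7]
    congr 1 <;> exact Fin.ext (Nat.mod_eq_of_lt (Fin.isLt _))
  refine ⟨X, fun q => ?_, fun q => ?_, hXC, fun ξ h => hc ξ (hker ξ fun i j hj hij => ?_)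
    fun q hq => ?_⟩
  · simp only [X]
    split_ifs
    · exact hC _ _
    · exact (c' _).contDiff.contDiffAt
  · simp only [X]
    split_ifs
    · exact hC0 _ _
    · exact map_zero _
  · obtain ⟨h1, h2⟩ := hXC i j hj hij
    exact h2 ▸ h _ h1
  · have := h (M + q) (by omega)
    simp only [X] at this
    rw [if_neg (by omega), Nat.add_sub_cancel_left, (c' q).fderiv] at this
    exact this

/-- Splitting off the last coordinate. -/
def lastChart (N : ℕ) : (Fin (N + 1) → ℝ) ≃L[ℝ] ℝ × (Fin N → ℝ) :=
  LinearEquiv.toContinuousLinearEquiv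
    { toFun := fun x => (x (Fin.last N), fun q => x q.castSucc)
      invFun := fun z => Fin.snoc (α := fun _ => ℝ) z.2 z.1
      map_add' := fun _ _ => rfl
      map_smul' := fun _ _ => rfl
      left_inv := fun x => by
        funext l
        refine Fin.lastCases ?_ (fun l => ?_) l <;> simp
      right_inv := fun z => by simp }

theorem lastChart_apply {N : ℕ} (x : Fin (N + 1) → ℝ) :
    lastChart N x = (x (Fin.last N), fun q => x q.castSucc) := rfl

theorem lastChart_symm_apply {N : ℕ} (z : ℝ × (Fin N → ℝ)) :
    (lastChart N).symm z = Fin.snoc (α := fun _ => ℝ) z.2 z.1 := rfl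

theorem lastChart_symm_axis {N : ℕ} (t : ℝ) :
    (lastChart N).symm (t, 0) = t • lastVec (N + 1) := by
  funext l
  rw [lastChart_symm_apply]
  refine Fin.lastCases ?_ (fun l => ?_) l
  · simp [lastVec]
  · simp [lastVec, l.isLt.ne]

end Coordinates

section Assembly

theorem comp_apply_of_lt {m n : ℕ} (f : (Fin m → ℝ) → (Fin n → ℝ)) {q : ℕ} (h : q < n)
    (x : Fin m → ℝ) : _root_.comp f q x = f x ⟨q, h⟩ := dif_pos h

/-- The source coordinate change of the Morin normal form. -/
theorem isDiffeoGerm_source {N : ℕ} {g : ℝ × (Fin N → ℝ) → ℝ} (hg : ContDiff ℝ (⊤ : ℕ∞) g)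
    (hg0 : g 0 = 0) (hdg : fderiv ℝ g 0 = 0) {τ : (Fin N → ℝ) × ℝ → ℝ}
    (hτ : ContDiffAt ℝ (⊤ : ℕ∞) τ 0) (hτ0 : τ 0 = 0) {X : ℕ → (Fin N → ℝ) × ℝ → ℝ}
    (hX : ∀ q, ContDiffAt ℝ (⊤ : ℕ∞) (X q) 0) (hX0 : ∀ q, X q 0 = 0)
    (hXker : ∀ ξ, (∀ q < N, fderiv ℝ (X q) 0 (ξ, 0) = 0) → ξ = 0) :
    IsDiffeoGerm fun x => (lastChart N).symm
      ((lastChart N x).1 + τ ((lastChart N x).2, g (lastChart N x)),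
        fun q : Fin N => X q.val ((lastChart N x).2, g (lastChart N x))) := by
  set A : (Fin (N + 1) → ℝ) → (Fin N → ℝ) × ℝ := fun x => ((lastChart N x).2, g (lastChart N x))
  have hA : ContDiff ℝ (⊤ : ℕ∞) A :=
    (lastChart N).contDiff.snd.prodMk (hg.comp (lastChart N).contDiff)
  have hA0 : A 0 = 0 := by simp [A, hg0]
  set A' : (Fin (N + 1) → ℝ) →L[ℝ] (Fin N → ℝ) × ℝ :=
    ((ContinuousLinearMap.snd ℝ _ _).comp (lastChart N).toContinuousLinearMap).prod 0
  have hdA : HasFDerivAt A A' 0 := by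
    refine HasFDerivAt.prodMk ?_ ?_
    · exact ((ContinuousLinearMap.snd ℝ _ _).comp
        (lastChart N).toContinuousLinearMap).hasFDerivAt
    · have h1 : HasFDerivAt g (0 : _ →L[ℝ] ℝ) (lastChart N 0) := by
        rw [map_zero, ← hdg]
        exact (hg.differentiable (by simp) 0).hasFDerivAt
      have h2 := h1.comp (0 : Fin (N + 1) → ℝ) (lastChart N).hasFDerivAt
      rwa [ContinuousLinearMap.zero_comp] at h2
  have hcomp : ∀ {u : (Fin N → ℝ) × ℝ → ℝ}, ContDiffAt ℝ (⊤ : ℕ∞) u 0 →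
      ContDiffAt ℝ (⊤ : ℕ∞) (fun x => u (A x)) 0 ∧
      HasFDerivAt (fun x => u (A x)) ((fderiv ℝ u 0).comp A') 0 := fun {u} hu => by
    have hu' : ContDiffAt ℝ (⊤ : ℕ∞) u (A 0) := by rwa [hA0]
    refine ⟨hu'.comp (0 : Fin (N + 1) → ℝ) hA.contDiffAt, ?_⟩
    have h1 : HasFDerivAt u (fderiv ℝ u 0) (A 0) := by
      rw [hA0]; exact (hu.differentiableAt (by simp)).hasFDerivAt
    exact h1.comp (0 : Fin (N + 1) → ℝ) hdA
  have hd : HasFDerivAt (fun x => ((lastChart N x).1 + τ (A x), fun q : Fin N => X q.val (A x)))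
      (((ContinuousLinearMap.fst ℝ _ _).comp (lastChart N).toContinuousLinearMap +
        (fderiv ℝ τ 0).comp A').prod
        (ContinuousLinearMap.pi fun q : Fin N => (fderiv ℝ (X q.val) 0).comp A')) 0 :=
    (((ContinuousLinearMap.fst ℝ _ _).comp
      (lastChart N).toContinuousLinearMap).hasFDerivAt.fun_add (hcomp hτ).2).prodMk
      (hasFDerivAt_pi.2 fun q => (hcomp (hX q)).2)
  refine isDiffeoGerm_of_injective ?_ ?_ fun v hv => ?_
  · change (lastChart N).symm ((lastChart N 0).1 + τ (A 0), fun q : Fin N => X q.val (A 0)) = 0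
    rw [hA0, hτ0, map_zero, Prod.fst_zero, add_zero]
    simp only [hX0]
    exact map_zero _
  · refine (lastChart N).symm.contDiff.contDiffAt.comp (0 : Fin (N + 1) → ℝ) ?_
    exact ((lastChart N).contDiff.fst.contDiffAt.add (hcomp hτ).1).prodMk
      (contDiffAt_pi.2 fun q => (hcomp (hX q)).1)
  · have h1 := (lastChart N).symm.hasFDerivAt.comp (0 : Fin (N + 1) → ℝ) hd
    have h2 := h1.fderiv
    simp only [Function.comp_def] at h2
    rw [h2] at hv
    have h3 := (lastChart N).symm.map_eq_zero_iff.1 hv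
    have h4 := congrArg Prod.snd h3
    have h5 : (lastChart N v).2 = 0 := hXker _ fun q hq => congrFun h4 ⟨q, hq⟩
    have h6 := congrArg Prod.fst h3
    have h7 : A' v = 0 := Prod.ext h5 rfl
    have h8 : (lastChart N v).1 = 0 := by
      have : (lastChart N v).1 + fderiv ℝ τ 0 (A' v) = 0 := h6
      rwa [h7, map_zero, add_zero] at this
    exact (lastChart N).map_eq_zero_iff.1 (Prod.ext h8 h5)

/-- The target coordinate change of the Morin normal form. -/
def morinTarget {N p n : ℕ} (hn : n = N + 1 + p)
    (L : (Fin (p + 1) → ℝ) ≃L[ℝ] (Fin (p + 1) → ℝ)) (X : ℕ → (Fin N → ℝ) × ℝ → ℝ)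
    (C : Fin (p + 1) → (Fin N → ℝ) × ℝ → ℝ) (Y : Fin n → ℝ) (k : Fin n) : ℝ :=
  let z := L fun i => Y ⟨N + i.val, by omega⟩
  let y : (Fin N → ℝ) × ℝ := (fun q => Y ⟨q.val, by omega⟩, z (Fin.last p))
  if k.val < N then X k.val y
  else (if k.val = N + p then 0 else z (Fin.ofNat (p + 1) (k.val - N))) -
    C (Fin.ofNat (p + 1) (k.val - N)) y

theorem isDiffeoGerm_morinTarget {N p n : ℕ} (hn : n = N + 1 + p)
    (L : (Fin (p + 1) → ℝ) ≃L[ℝ] (Fin (p + 1) → ℝ)) {X : ℕ → (Fin N → ℝ) × ℝ → ℝ}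
    {C : Fin (p + 1) → (Fin N → ℝ) × ℝ → ℝ}
    (hC : ∀ i, ContDiffAt ℝ (⊤ : ℕ∞) (C i) 0) (hC0 : ∀ i, C i 0 = 0)
    (hd : fderiv ℝ (C (Fin.last p)) 0 (0, 1) ≠ 0)
    (hd0 : ∀ ξ, fderiv ℝ (C (Fin.last p)) 0 (ξ, 0) = 0)
    (hX : ∀ q, ContDiffAt ℝ (⊤ : ℕ∞) (X q) 0) (hX0 : ∀ q, X q 0 = 0)
    (hXker : ∀ ξ, (∀ q < N, fderiv ℝ (X q) 0 (ξ, 0) = 0) → ξ = 0) :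
    IsDiffeoGerm (morinTarget hn L X C) := by
  let Z : (Fin n → ℝ) →L[ℝ] (Fin (p + 1) → ℝ) := L.toContinuousLinearMap.comp
    (ContinuousLinearMap.pi fun i => ContinuousLinearMap.proj ⟨N + i.val, by omega⟩)
  let B : (Fin n → ℝ) →L[ℝ] (Fin N → ℝ) × ℝ :=
    (ContinuousLinearMap.pi fun q => ContinuousLinearMap.proj ⟨q.val, by omega⟩).prod
      ((ContinuousLinearMap.proj (Fin.last p)).comp Z)
  let Zc : Fin n → (Fin n → ℝ) →L[ℝ] ℝ := fun k => if k.val = N + p then 0 else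
    (ContinuousLinearMap.proj (Fin.ofNat (p + 1) (k.val - N))).comp Z
  have hM : ∀ Y k, morinTarget hn L X C Y k = if k.val < N then X k.val (B Y) else
      Zc k Y - C (Fin.ofNat (p + 1) (k.val - N)) (B Y) := fun Y k => by
    simp only [morinTarget, Zc]
    by_cases h1 : k.val < N
    · simp only [if_pos h1]; rfl
    · simp only [if_neg h1]
      by_cases h2 : k.val = N + p
      · simp only [if_pos h2]; rfl
      · simp only [if_neg h2]; rfl
  have hcomp : ∀ {u : (Fin N → ℝ) × ℝ → ℝ}, ContDiffAt ℝ (⊤ : ℕ∞) u 0 →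
      ContDiffAt ℝ (⊤ : ℕ∞) (fun x => u (B x)) 0 ∧
      HasFDerivAt (fun x => u (B x)) ((fderiv ℝ u 0).comp B) 0 := fun {u} hu => by
    have hu' : ContDiffAt ℝ (⊤ : ℕ∞) u (B 0) := by rwa [map_zero]
    refine ⟨hu'.comp (0 : Fin n → ℝ) B.contDiff.contDiffAt, ?_⟩
    have h1 : HasFDerivAt u (fderiv ℝ u 0) (B 0) := by
      rw [map_zero]; exact (hu.differentiableAt (by simp)).hasFDerivAt
    exact h1.comp (0 : Fin n → ℝ) B.hasFDerivAt
  have hs : ContDiffAt ℝ (⊤ : ℕ∞) (morinTarget hn L X C) 0 := contDiffAt_pi.2 fun k => by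
    by_cases h1 : k.val < N
    · simp only [hM, if_pos h1]; exact (hcomp (hX _)).1
    · simp only [hM, if_neg h1]; exact (Zc k).contDiff.contDiffAt.sub (hcomp (hC _)).1
  refine isDiffeoGerm_of_injective ?_ hs fun v hv => ?_
  · funext k
    rw [hM, map_zero, map_zero, hX0, hC0]
    simp
  have hk : ∀ k, HasFDerivAt (fun Y => morinTarget hn L X C Y k)
      ((ContinuousLinearMap.proj k).comp (fderiv ℝ (morinTarget hn L X C) 0)) 0 := fun k =>
    hasFDerivAt_pi'.1 (hs.differentiableAt (by simp)).hasFDerivAt k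
  have hX1 : ∀ q < N, fderiv ℝ (X q) 0 (B v) = 0 := fun q hq => by
    have h1 := hk ⟨q, by omega⟩
    simp only [hM, if_pos hq] at h1
    have h2 := congrArg (fun A => A v) (h1.unique (hcomp (hX q)).2)
    simpa [hv] using h2.symm
  have hC1 : ∀ i : Fin (p + 1), (if i = Fin.last p then 0 else Z v i) -
      fderiv ℝ (C i) 0 (B v) = 0 := fun i => by
    have hi := i.isLt
    have h1 := hk ⟨N + i.val, by omega⟩
    have h3 : Fin.ofNat (p + 1) i.val = i := Fin.ext (Nat.mod_eq_of_lt i.isLt)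
    simp only [hM, if_neg (show ¬ N + i.val < N by omega), Nat.add_sub_cancel_left, h3] at h1
    have h2 := congrArg (fun A => A v) (h1.unique ((Zc _).hasFDerivAt.fun_sub (hcomp (hC i)).2))
    simp only [ContinuousLinearMap.comp_apply, hv, map_zero] at h2
    rw [_root_.sub_apply] at h2
    refine Eq.trans ?_ h2.symm
    congr 1
    simp only [Zc, Nat.add_sub_cancel_left, h3, Nat.add_left_cancel_iff]
    by_cases h : i = Fin.last p
    · rw [if_pos h, if_pos (by rw [h, Fin.val_last] : i.val = p)]; rfl
    · rw [if_neg h, if_neg (fun h' => h (Fin.ext h') : ¬ i.val = p)]; rfl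
  have hB2 : (B v).2 = 0 := by
    have h1 := hC1 (Fin.last p)
    rw [if_pos rfl, zero_sub, neg_eq_zero] at h1
    have h2 : B v = ((B v).1, 0) + (B v).2 • ((0, 1) : (Fin N → ℝ) × ℝ) := by ext <;> simp
    rw [h2, map_add, hd0, map_smul, zero_add, smul_eq_mul] at h1
    exact (mul_eq_zero.1 h1).resolve_right hd
  have hB1 : (B v).1 = 0 := hXker _ fun q hq => by
    have h1 := hX1 q hq
    rwa [show B v = ((B v).1, 0) from Prod.ext rfl hB2] at h1
  have hB : B v = 0 := Prod.ext hB1 hB2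
  have hZ : Z v = 0 := by
    funext i
    by_cases h : i = Fin.last p
    · rw [h]; exact hB2
    · have h1 := hC1 i
      rw [if_neg h, hB, map_zero, sub_zero] at h1
      exact h1
  have hZ' := L.map_eq_zero_iff.1 hZ
  funext k
  by_cases h : k.val < N
  · exact congrFun hB1 ⟨k.val, h⟩
  · have h1 := congrFun hZ' ⟨k.val - N, by omega⟩
    have h2 : (⟨N + (k.val - N), by omega⟩ : Fin n) = k := Fin.ext (by simp; omega)
    rw [← h2]
    exact h1

end Assembly

section Sufficiency

theorem hMorinNF_of_lt {m n r : ℕ} (x : Fin m → ℝ) {k : Fin n} (h : k.val < m - 1) :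
    hMorinNF m n r x k = xhat x k.val := if_pos h

theorem hMorinNF_of_mid {N n p r : ℕ} (hn : n = N + 1 + p) (x : Fin (N + 1) → ℝ) {k : Fin n}
    {i : ℕ} (hk : k.val = N + i) (hi : i < p) :
    hMorinNF (N + 1) n r x k =
      ∑ j ∈ Finset.range r, xhat x (i * r + j) * xhat x N ^ (j + 1) := by
  have h1 : ¬ k.val < N + 1 - 1 := by omega
  have h2 : k.val - (N + 1 - 1) = i := by omega
  have h3 : i < n - (N + 1) := by omega
  rw [hMorinNF, if_neg h1, h2, if_pos h3]
  rfl

theorem hMorinNF_of_last {N n p r : ℕ} (hn : n = N + 1 + p) (x : Fin (N + 1) → ℝ) {k : Fin n}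
    (hk : k.val = N + p) :
    hMorinNF (N + 1) n r x k =
      ∑ j ∈ Finset.range (r - 1), xhat x (p * r + j) * xhat x N ^ (j + 1) + xhat x N ^ (r + 1) := by
  have h1 : ¬ k.val < N + 1 - 1 := by omega
  have h2 : k.val - (N + 1 - 1) = p := by omega
  have h3 : n - (N + 1) = p := by omega
  rw [hMorinNF, if_neg h1, h2, h3, if_neg (lt_irrefl p)]
  rfl

theorem xhat_symm_of_lt {N : ℕ} (z : ℝ × (Fin N → ℝ)) {q : ℕ} (h : q < N) :
    xhat ((lastChart N).symm z) q = z.2 ⟨q, h⟩ := by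
  rw [xhat, dif_pos (by omega : q < N + 1), lastChart_symm_apply]
  exact Fin.snoc_castSucc (α := fun _ => ℝ) z.1 z.2 ⟨q, h⟩

theorem xhat_symm_last {N : ℕ} (z : ℝ × (Fin N → ℝ)) :
    xhat ((lastChart N).symm z) N = z.1 := by
  rw [xhat, dif_pos (by omega : N < N + 1), lastChart_symm_apply]
  exact Fin.snoc_last (α := fun _ => ℝ) z.1 z.2

theorem sum_fin_succ_eq_range (r : ℕ) (a : Fin (r + 1) → ℝ) (T : ℝ) (b : ℕ → ℝ)
    (h : ∀ (j : ℕ) (hj : j < r), b j = a ⟨j + 1, by omega⟩) :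
    ∑ j, a j * T ^ j.val = a 0 + ∑ j ∈ Finset.range r, b j * T ^ (j + 1) := by
  rw [Fin.sum_univ_succ, ← Fin.sum_univ_eq_sum_range (fun j => b j * T ^ (j + 1))]
  simp only [Fin.val_zero, pow_zero, mul_one]
  congr 1
  exact Finset.sum_congr rfl fun j _ => by rw [h j.val j.isLt]; rfl

theorem aEquiv_of_coordinates {N p n r : ℕ} (hn : n = N + 1 + p) (hr : 1 ≤ r)
    {f : (Fin (N + 1) → ℝ) → (Fin n → ℝ)}
    (hform : ∀ᶠ x in 𝓝 (0 : Fin (N + 1) → ℝ), ∀ k : Fin n, k.val < N → f x k = xhat x k.val)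
    (L : (Fin (p + 1) → ℝ) ≃L[ℝ] (Fin (p + 1) → ℝ))
    {F : Fin (p + 1) → ℝ × (Fin N → ℝ) → ℝ}
    (hF : ∀ i z, F i z = L (fun k => _root_.comp f (N + k.val) ((lastChart N).symm z)) i)
    (hFs : ∀ i, ContDiff ℝ (⊤ : ℕ∞) (F i)) (hF0 : F (Fin.last p) 0 = 0)
    (hdF : fderiv ℝ (F (Fin.last p)) 0 = 0)
    {C : Fin (p + 1) → Fin (r + 1) → (Fin N → ℝ) × ℝ → ℝ} {τ : (Fin N → ℝ) × ℝ → ℝ}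
    (hτ : ContDiffAt ℝ (⊤ : ℕ∞) τ 0) (hτ0 : τ 0 = 0)
    (hC : ∀ i j, ContDiffAt ℝ (⊤ : ℕ∞) (C i j) 0) (hC0 : ∀ i j, C i j 0 = 0)
    (hd : fderiv ℝ (C (Fin.last p) 0) 0 (0, 1) ≠ 0)
    (hd0 : ∀ ξ, fderiv ℝ (C (Fin.last p) 0) 0 (ξ, 0) = 0)
    (hCl : ∀ y, C (Fin.last p) (Fin.last r) y = 0)
    (hCF : ∀ i, i ≠ Fin.last p → ∀ᶠ z : ℝ × (Fin N → ℝ) in 𝓝 0, F i z =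
      ∑ j, C i j (z.2, F (Fin.last p) z) * (z.1 + τ (z.2, F (Fin.last p) z)) ^ j.val)
    (hCT : ∀ᶠ z : ℝ × (Fin N → ℝ) in 𝓝 0, -(z.1 + τ (z.2, F (Fin.last p) z)) ^ (r + 1) =
      ∑ j, C (Fin.last p) j (z.2, F (Fin.last p) z) *
        (z.1 + τ (z.2, F (Fin.last p) z)) ^ j.val)
    {X : ℕ → (Fin N → ℝ) × ℝ → ℝ}
    (hX : ∀ q, ContDiffAt ℝ (⊤ : ℕ∞) (X q) 0) (hX0 : ∀ q, X q 0 = 0)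
    (hXC : ∀ (i : Fin (p + 1)) (j : Fin (r + 1)), j ≠ 0 → (i ≠ Fin.last p ∨ j.val < r) →
      i.val * r + (j.val - 1) < N ∧ X (i.val * r + (j.val - 1)) = C i j)
    (hXker : ∀ ξ, (∀ q < N, fderiv ℝ (X q) 0 (ξ, 0) = 0) → ξ = 0) :
    AEquiv f (hMorinNF (N + 1) n r) := by
  obtain ⟨φ, hφ, -, hφψ⟩ :=
    (isDiffeoGerm_source (hFs (Fin.last p)) hF0 hdF hτ hτ0 hX hX0 hXker).exists_inverse
  refine ⟨φ, morinTarget hn L X fun i => C i 0, hφ,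
    isDiffeoGerm_morinTarget hn L (fun i => hC i 0) (fun i => hC0 i 0) hd hd0 hX hX0 hXker, ?_⟩
  have hφ0 : Tendsto φ (𝓝 0) (𝓝 0) := by
    have := hφ.2.1.continuousAt.tendsto
    rwa [hφ.1] at this
  have hφ1 : Tendsto (fun x => lastChart N (φ x)) (𝓝 0) (𝓝 0) := by
    have := ((lastChart N).continuous.tendsto 0).comp hφ0
    rwa [map_zero] at this
  have hCF' : ∀ᶠ z : ℝ × (Fin N → ℝ) in 𝓝 0, ∀ i, i ≠ Fin.last p → F i z =
      ∑ j, C i j (z.2, F (Fin.last p) z) * (z.1 + τ (z.2, F (Fin.last p) z)) ^ j.val :=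
    eventually_all.2 fun i => by
      by_cases hi : i = Fin.last p
      · exact Eventually.of_forall fun _ h => absurd hi h
      · exact (hCF i hi).mono fun _ h _ => h
  filter_upwards [hφψ, hφ0.eventually hform, hφ1.eventually hCF', hφ1.eventually hCT]
    with x hx hfx hCx hTx
  set z := lastChart N (φ x) with hz
  set y : (Fin N → ℝ) × ℝ := (z.2, F (Fin.last p) z) with hy
  set T := z.1 + τ y with hT
  have hLF : L (fun i : Fin (p + 1) => f (φ x) ⟨N + i.val, by omega⟩) = fun i => F i z := by
    funext i
    rw [hF]
    refine congrFun (congrArg L (funext fun k => ?_)) i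
    rw [comp_apply_of_lt f (by omega), hz, ContinuousLinearEquiv.symm_apply_apply]
  have hy' : (fun q : Fin N => f (φ x) ⟨q.val, by omega⟩) = z.2 := by
    funext q
    rw [hfx _ q.isLt, xhat, dif_pos (q.isLt.trans (Nat.lt_succ_self N)), hz, lastChart_apply]
    rfl
  refine Eq.trans ?_ (congrArg (hMorinNF (N + 1) n r) hx)
  have hXlast : xhat ((lastChart N).symm (T, fun q : Fin N => X q.val y)) N = T :=
    xhat_symm_last _
  have hXlt : ∀ q, q < N → xhat ((lastChart N).symm (T, fun q : Fin N => X q.val y)) q = X q y :=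
    fun q hq => xhat_symm_of_lt _ hq
  funext k
  simp only [morinTarget, hLF, hy']
  by_cases hk : k.val < N
  · rw [if_pos hk, hMorinNF_of_lt _ hk, hXlt _ hk]
  rw [if_neg hk]
  by_cases hkp : k.val = N + p
  · have h1 : Fin.ofNat (p + 1) (k.val - N) = Fin.last p := Fin.ext (by
      simp [hkp])
    rw [if_pos hkp, hMorinNF_of_last hn _ hkp, h1, hXlast]
    have h2 := sum_fin_succ_eq_range r (fun j => C (Fin.last p) j y) T
      (fun j => if j < r - 1 then X (p * r + j) y else 0) fun j hj => by
        by_cases hj1 : j < r - 1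
        · rw [if_pos hj1]
          have := (hXC (Fin.last p) ⟨j + 1, by omega⟩ (by simp [Fin.ext_iff])
            (Or.inr (by simp; omega))).2
          simp only [Fin.val_last, Nat.add_sub_cancel] at this
          rw [this]
        · rw [if_neg hj1, ← hCl y]
          congr 1
          exact Fin.ext (by simp; omega)
    obtain ⟨s, rfl⟩ : ∃ s, r = s + 1 := ⟨r - 1, by omega⟩
    rw [← hTx, Finset.sum_range_succ] at h2
    simp only [Nat.add_sub_cancel, lt_irrefl, if_false, zero_mul, add_zero] at h2 ⊢
    have h3 : ∑ j ∈ Finset.range s, xhat ((lastChart N).symm (T, fun q : Fin N => X q.val y))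
        (p * (s + 1) + j) * T ^ (j + 1) =
        ∑ j ∈ Finset.range s, (if j < s then X (p * (s + 1) + j) y else 0) * T ^ (j + 1) :=
      Finset.sum_congr rfl fun j hj => by
        have hj' := Finset.mem_range.1 hj
        have := (hXC (Fin.last p) ⟨j + 1, by omega⟩ (by simp [Fin.ext_iff])
            (Or.inr (by simp; omega))).1
        simp only [Fin.val_last, Nat.add_sub_cancel] at this
        rw [hXlt _ this, if_pos hj']
    rw [h3]
    linarith
  · have hi : k.val - N < p := by omega
    rw [if_neg hkp, hMorinNF_of_mid hn _ (by omega : k.val = N + (k.val - N)) hi, hXlast]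
    have h0 : (Fin.ofNat (p + 1) (k.val - N)).val = k.val - N := Nat.mod_eq_of_lt (by omega)
    have hil : Fin.ofNat (p + 1) (k.val - N) ≠ Fin.last p := fun h => by
      rw [h, Fin.val_last] at h0
      omega
    rw [hCx _ hil, sum_fin_succ_eq_range r (fun j => C (Fin.ofNat (p + 1) (k.val - N)) j y) T
      (fun j => xhat ((lastChart N).symm (T, fun q : Fin N => X q.val y)) ((k.val - N) * r + j))]
    · ring
    · intro j hj
      have := hXC _ ⟨j + 1, by omega⟩ (by simp [Fin.ext_iff]) (Or.inl hil)
      rw [h0] at this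
      simp only [Nat.add_sub_cancel] at this
      rw [hXlt _ this.1, this.2]

end Sufficiency

section Conditions

theorem iteratedDeriv_clm_pi {ι : Type} [Fintype ι] (ℓ : (ι → ℝ) →L[ℝ] ℝ) {u : ι → ℝ → ℝ}
    (hu : ∀ k, ContDiff ℝ (⊤ : ℕ∞) (u k)) (j : ℕ) :
    iteratedDeriv j (fun t => ℓ fun k => u k t) = fun t => ℓ fun k => iteratedDeriv j (u k) t := by
  induction j with
  | zero => simp
  | succ j ih =>
    rw [iteratedDeriv_succ, ih]
    funext t
    have h : HasDerivAt (fun t k => iteratedDeriv j (u k) t)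
        (fun k => iteratedDeriv (j + 1) (u k) t) t := hasDerivAt_pi.2 fun k => by
      rw [iteratedDeriv_succ]
      exact ((hu k).differentiable_iteratedDeriv j (WithTop.coe_lt_coe.2 (WithTop.coe_lt_top _))
        t).hasDerivAt
    exact (ℓ.hasFDerivAt.comp_hasDerivAt t h).deriv

/-- The matrix of Morin's rank condition. -/
def morinMatrix {m n : ℕ} (f : (Fin m → ℝ) → (Fin n → ℝ)) (r p : ℕ) :
    Matrix (Fin r × Fin (p + 1)) (Fin m) ℝ :=
  Matrix.of fun si l => pd (DlIter (_root_.comp f (m - 1 + si.2.val)) (si.1.val + 1)) 0 l.val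

theorem morinMatrix_mulVec {m n : ℕ} (f : (Fin m → ℝ) → (Fin n → ℝ)) (r p : ℕ) (v : Fin m → ℝ)
    (si : Fin r × Fin (p + 1)) : (morinMatrix f r p *ᵥ v) si =
      fderiv ℝ (DlIter (_root_.comp f (m - 1 + si.2.val)) (si.1.val + 1)) 0 v :=
  sum_pd_mul _ _ _

/-- The subspace of directions, transverse to the last axis, annihilated by the derivatives
entering the rank condition, has the expected dimension. -/
theorem finrank_annihilated_le {N p n r : ℕ} {f : (Fin (N + 1) → ℝ) → (Fin n → ℝ)} (hr : 1 ≤ r)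
    (L : (Fin (p + 1) → ℝ) ≃L[ℝ] (Fin (p + 1) → ℝ))
    (c1 : ∀ k : Fin (p + 1), ∀ j, 1 ≤ j → j ≤ r → DlIter (_root_.comp f (N + k.val)) j 0 = 0)
    (hL : L (fun k => DlIter (_root_.comp f (N + k.val)) (r + 1) 0) = Pi.single (Fin.last p) 1)
    (c3 : (morinMatrix f r p).rank = r * (p + 1)) :
    ∃ S : Submodule ℝ (Fin N → ℝ), Module.finrank ℝ S + r * (p + 1) ≤ N + 1 ∧
      ∀ ξ, (∀ i, ∀ s ≤ r, (i ≠ Fin.last p ∨ s < r) →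
        L (fun k => fderiv ℝ (DlIter (_root_.comp f (N + k.val)) s) 0
          ((lastChart N).symm (0, ξ))) i = 0) → ξ ∈ S := by
  let D : (s : ℕ) → (Fin (N + 1) → ℝ) →ₗ[ℝ] (Fin (p + 1) → ℝ) := fun s =>
    L.toLinearMap ∘ₗ LinearMap.pi fun k =>
      (fderiv ℝ (DlIter (_root_.comp f (N + k.val)) s) 0).toLinearMap
  let inc : (Fin N → ℝ) →ₗ[ℝ] (Fin (N + 1) → ℝ) :=
    (lastChart N).symm.toLinearMap ∘ₗ LinearMap.inr ℝ ℝ (Fin N → ℝ)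
  let S : Submodule ℝ (Fin N → ℝ) :=
    { carrier := {ξ | ∀ i, ∀ s ≤ r, (i ≠ Fin.last p ∨ s < r) → D s (inc ξ) i = 0}
      zero_mem' := fun i s _ _ => by simp
      add_mem' := fun {a b} ha hb i s h1 h2 => by
        rw [map_add, map_add, Pi.add_apply, ha i s h1 h2, hb i s h1 h2, add_zero]
      smul_mem' := fun c a ha i s h1 h2 => by
        rw [map_smul, map_smul, Pi.smul_apply, ha i s h1 h2, smul_zero] }
  refine ⟨S, ?_, fun ξ h => h⟩
  have hw : ∀ s, D s (lastVec (N + 1)) = L fun k => DlIter (_root_.comp f (N + k.val)) (s + 1) 0 :=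
    fun s => rfl
  let P : S →ₗ[ℝ] (Fin (N + 1) → ℝ) := (inc - ((LinearMap.proj (Fin.last p) ∘ₗ D r ∘ₗ
    inc).smulRight (lastVec (N + 1)))) ∘ₗ S.subtype
  have hP : ∀ ξ : S, P ξ = inc ξ - D r (inc ξ) (Fin.last p) • lastVec (N + 1) := fun ξ => rfl
  have hDP : ∀ (ξ : S) (s : ℕ), 1 ≤ s → s ≤ r → D s (P ξ) = 0 := fun ξ s h1 h2 => by
    rw [hP, map_sub, map_smul, hw]
    funext i
    rcases h2.lt_or_eq with h2 | rfl
    · have h3 : (fun k : Fin (p + 1) => DlIter (_root_.comp f (N + k.val)) (s + 1) 0) = 0 :=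
        funext fun k => c1 k (s + 1) (by omega) h2
      rw [h3, map_zero, smul_zero, sub_zero]
      exact ξ.2 i s h2.le (Or.inr h2)
    · rw [hL]
      by_cases hi : i = Fin.last p
      · rw [hi]
        simp
      · have := ξ.2 i s le_rfl (Or.inl hi)
        simp [this, hi]
  have hker : ∀ ξ : S, P ξ ∈ LinearMap.ker (morinMatrix f r p).mulVecLin := fun ξ => by
    rw [LinearMap.mem_ker, Matrix.mulVecLin_apply]
    funext si
    rw [morinMatrix_mulVec]
    have h1 := L.map_eq_zero_iff.1 (hDP ξ (si.1.val + 1) (by omega) si.1.isLt)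
    exact congrFun h1 si.2
  have hinj : Function.Injective (P.codRestrict _ hker) := by
    refine (injective_iff_map_eq_zero _).2 fun ξ hξ => ?_
    have h1 : P ξ = 0 := congrArg Subtype.val hξ
    refine Subtype.ext (funext fun q => ?_)
    have h2 := congrFun h1 q.castSucc
    have h3 : inc ξ q.castSucc = ξ.1 q :=
      Fin.snoc_castSucc (α := fun _ => ℝ) (0 : ℝ) ξ.1 q
    have h4 : lastVec (N + 1) q.castSucc = 0 := by simp [lastVec, q.isLt.ne]
    rw [hP, Pi.sub_apply, Pi.smul_apply, h4, smul_zero, sub_zero, h3] at h2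
    exact h2
  have h1 := LinearMap.finrank_le_finrank_of_injective hinj
  have h2 := (morinMatrix f r p).mulVecLin.finrank_range_add_finrank_ker
  rw [Module.finrank_fin_fun] at h2
  rw [Matrix.rank] at c3
  omega

theorem aEquiv_of_conditions {N p n r : ℕ} (hn : n = N + 1 + p) (hr : 1 ≤ r)
    (hdim : r * (p + 1) ≤ N + 1) {f : (Fin (N + 1) → ℝ) → (Fin n → ℝ)}
    (hf : ContDiff ℝ (⊤ : ℕ∞) f) (hf0 : f 0 = 0)
    (hform : ∀ᶠ x in 𝓝 (0 : Fin (N + 1) → ℝ), ∀ k : Fin n, k.val < N → f x k = xhat x k.val)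
    (hdz : ∀ k : Fin (p + 1), fderiv ℝ (_root_.comp f (N + k.val)) 0 = 0)
    (c1 : ∀ k : Fin (p + 1), ∀ j, 1 ≤ j → j ≤ r → DlIter (_root_.comp f (N + k.val)) j 0 = 0)
    (c2 : ∃ k : Fin (p + 1), DlIter (_root_.comp f (N + k.val)) (r + 1) 0 ≠ 0)
    (c3 : (morinMatrix f r p).rank = r * (p + 1)) :
    AEquiv f (hMorinNF (N + 1) n r) := by
  let G : Fin (p + 1) → (Fin (N + 1) → ℝ) → ℝ := fun k => _root_.comp f (N + k.val)
  have hG : ∀ k, ContDiff ℝ (⊤ : ℕ∞) (G k) := fun k => contDiff_comp hf _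
  have hG0 : ∀ k, G k 0 = 0 := fun k => by
    simp only [G, _root_.comp, hf0]
    split_ifs <;> rfl
  have he : (fun k => DlIter (G k) (r + 1) 0) ≠ 0 := fun h => by
    obtain ⟨k, hk⟩ := c2
    exact hk (congrFun h k)
  obtain ⟨L, hL⟩ := SeparatingDual.exists_continuousLinearEquiv_apply_eq (R := ℝ) he
    (y := Pi.single (Fin.last p) (1 : ℝ)) (by simp)
  let ℓ : Fin (p + 1) → (Fin (p + 1) → ℝ) →L[ℝ] ℝ := fun i =>
    (ContinuousLinearMap.proj i).comp L.toContinuousLinearMap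
  let F : Fin (p + 1) → ℝ × (Fin N → ℝ) → ℝ := fun i z => ℓ i fun k => G k ((lastChart N).symm z)
  have hFs : ∀ i, ContDiff ℝ (⊤ : ℕ∞) (F i) := fun i =>
    (ℓ i).contDiff.comp (contDiff_pi.2 fun k => (hG k).comp (lastChart N).symm.contDiff)
  have hdF : ∀ i z v, fderiv ℝ (F i) z v =
      ℓ i fun k => fderiv ℝ (G k) ((lastChart N).symm z) ((lastChart N).symm v) := fun i z v => by
    have h : HasFDerivAt (fun z k => G k ((lastChart N).symm z)) (ContinuousLinearMap.pi fun k =>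
        (fderiv ℝ (G k) ((lastChart N).symm z)).comp (lastChart N).symm.toContinuousLinearMap) z :=
      hasFDerivAt_pi.2 fun k => (((hG k).differentiable (by simp)) _).hasFDerivAt.comp z
        (lastChart N).symm.hasFDerivAt
    have h2 : HasFDerivAt (F i) _ z := (ℓ i).hasFDerivAt.comp z h
    rw [h2.fderiv]
    rfl
  have hdF0 : ∀ i, fderiv ℝ (F i) 0 = 0 := fun i => by
    ext v
    · rw [ContinuousLinearMap.comp_apply, hdF, map_zero]
      simp only [G, hdz]
      exact map_zero (ℓ i)
    · rw [ContinuousLinearMap.comp_apply, hdF, map_zero]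
      simp only [G, hdz]
      exact map_zero (ℓ i)
  have hFt : ∀ i j, iteratedDeriv j (fun t => F i (t, 0)) 0 = ℓ i fun k => DlIter (G k) j 0 :=
    fun i j => by
    simp only [F, lastChart_symm_axis]
    rw [iteratedDeriv_clm_pi (ℓ i) (u := fun k t => G k (t • lastVec (N + 1))) fun k =>
      (hG k).comp (contDiff_id.smul contDiff_const)]
    simp only [iteratedDeriv_axis (hG _), zero_smul]
  have h0 : ∀ i, ∀ j ≤ r, iteratedDeriv j (fun t => F i (t, 0)) 0 = 0 := fun i j hj => by
    rw [hFt]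
    have : (fun k => DlIter (G k) j 0) = 0 := funext fun k => by
      rcases Nat.eq_zero_or_pos j with rfl | hj0
      · exact hG0 k
      · exact c1 k j hj0 hj
    rw [this, map_zero]
  have hr1 : ∀ i, iteratedDeriv (r + 1) (fun t => F i (t, 0)) 0 =
      (Pi.single (Fin.last p) 1 : Fin (p + 1) → ℝ) i := fun i => by
    rw [hFt, ← hL]
    rfl
  have hF0 : F (Fin.last p) 0 = 0 := by
    have h1 := h0 (Fin.last p) 0 (Nat.zero_le r)
    rwa [iteratedDeriv_zero] at h1
  obtain ⟨C, τ, hτ, hτ0, hC, hC0, hd, hd0, hCl, hCF, hCT, hker⟩ :=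
    exists_reduced_family_preparation hr hFs (fun i ξ => by rw [hdF0]; rfl) h0
      (by rw [hr1]; simp) (fun i hi => by rw [hr1]; simp [hi])
  obtain ⟨S, hS, hSmem⟩ := finrank_annihilated_le hr L c1 hL c3
  obtain ⟨X, hX, hX0, hXC, hXker⟩ := exists_completed_coordinates hdim hC hC0 S hS
    fun ξ hξ => hSmem ξ fun i s hs his => by
      have h1 := hker ξ hξ i s hs his
      simp only [hdF, lastChart_symm_axis] at h1
      rw [iteratedDeriv_clm_pi (ℓ i)] at h1
      · simp only [iteratedDeriv_fderiv_axis (hG _)] at h1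
        exact h1
      · intro k
        exact ((hG k).fderiv_right (m := (⊤ : ℕ∞)) (by simp)).clm_apply contDiff_const |>.comp
          (contDiff_id.smul contDiff_const)
  exact aEquiv_of_coordinates hn hr hform L (fun i z => rfl) hFs
    hF0 (hdF0 _) hτ hτ0 hC hC0 hd hd0 hCl hCF hCT
    hX hX0 hXC hXker

end Conditions

section Curves

open Asymptotics

theorem isBigO_comp_sub {E F : Type} [NormedAddCommGroup E] [NormedSpace ℝ E]
    [NormedAddCommGroup F] [NormedSpace ℝ F] {g : E → F} {a : E}
    (hg : ContDiffAt ℝ (⊤ : ℕ∞) g a) {u v : ℝ → E} (hu : Tendsto u (𝓝 0) (𝓝 a))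
    (hv : Tendsto v (𝓝 0) (𝓝 a)) :
    (fun t => g (u t) - g (v t)) =O[𝓝 0] fun t => u t - v t :=
  (hg.hasStrictFDerivAt (by simp)).isBigO_sub.comp_tendsto (hu.prodMk_nhds hv)

theorem isBigO_id_of_differentiableAt {E : Type} [NormedAddCommGroup E] [NormedSpace ℝ E]
    {u : ℝ → E} (hu : DifferentiableAt ℝ u 0) :
    (fun t => u t - u 0) =O[𝓝 0] fun t : ℝ => t ^ 1 := by
  simpa using hu.isBigO_sub

theorem isBigO_sub_axis {N n k : ℕ} (hNn : N ≤ n) {g : (Fin (N + 1) → ℝ) → (Fin n → ℝ)}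
    (hform : ∀ᶠ x in 𝓝 (0 : Fin (N + 1) → ℝ), ∀ k : Fin n, k.val < N → g x k = xhat x k.val)
    {γ : ℝ → Fin (N + 1) → ℝ} (hγ : Tendsto γ (𝓝 0) (𝓝 0))
    (h : (fun t => g (γ t)) =O[𝓝 0] fun t : ℝ => t ^ k) :
    (fun t => γ t - γ t (Fin.last N) • lastVec (N + 1)) =O[𝓝 0] fun t : ℝ => t ^ k := by
  refine isBigO_pi.2 fun q => ?_
  refine Fin.lastCases ?_ (fun q => ?_) q
  · refine (isBigO_zero _ _).congr_left fun t => ?_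
    simp [lastVec]
  · refine (isBigO_pi.1 h ⟨q.val, q.isLt.trans_le hNn⟩).congr' ?_ EventuallyEq.rfl
    filter_upwards [hγ.eventually hform] with t ht
    rw [ht _ q.isLt]
    simp [lastVec, q.isLt.ne, xhat, q.isLt.le, Fin.castSucc, Fin.castAdd, Fin.castLE]

theorem deriv_last_ne_zero {N k : ℕ} (hk : 2 ≤ k) {γ : ℝ → Fin (N + 1) → ℝ}
    (hγ : DifferentiableAt ℝ γ 0) (hγ0 : γ 0 = 0) (hd : deriv γ 0 ≠ 0)
    (h : (fun t => γ t - γ t (Fin.last N) • lastVec (N + 1)) =O[𝓝 0] fun t : ℝ => t ^ k) :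
    deriv (fun t => γ t (Fin.last N)) 0 ≠ 0 := fun h0 => by
  have h1 : HasDerivAt (fun t => γ t (Fin.last N)) 0 0 := by
    have h2 := (differentiableAt_pi.1 hγ (Fin.last N)).hasDerivAt
    rwa [h0] at h2
  have h2 := hγ.hasDerivAt.fun_sub (h1.smul_const (lastVec (N + 1)))
  have h3 : HasDerivAt (fun t => γ t - γ t (Fin.last N) • lastVec (N + 1)) 0 0 := by
    rw [hasDerivAt_iff_isLittleO]
    have h4 := h.trans_isLittleO (g := fun t : ℝ => t ^ k) (k := fun t : ℝ => t)
      (by simpa using isLittleO_pow_pow (𝕜 := ℝ) (show 1 < k by omega))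
    simpa [hγ0] using h4
  have h4 := h2.unique h3
  rw [zero_smul, sub_zero] at h4
  exact hd h4

theorem exists_inverse_of_deriv_ne_zero {T : ℝ → ℝ} (hT : ContDiffAt ℝ (⊤ : ℕ∞) T 0)
    (hT0 : T 0 = 0) (hd : deriv T 0 ≠ 0) :
    ∃ S : ℝ → ℝ, ContDiffAt ℝ (⊤ : ℕ∞) S 0 ∧ S 0 = 0 ∧ (∀ᶠ x in 𝓝 0, S (T x) = x) ∧
      ∀ᶠ y in 𝓝 0, T (S y) = y := by
  refine exists_local_inverse hT hT0 fun v hv => ?_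
  rw [fderiv_eq_smul_deriv, smul_eq_mul] at hv
  exact (mul_eq_zero.1 hv).resolve_right hd

theorem isBigO_pow_comp {T : ℝ → ℝ} (hT : ContDiffAt ℝ (⊤ : ℕ∞) T 0) (hT0 : T 0 = 0) (k : ℕ) :
    (fun t => T t ^ k) =O[𝓝 0] fun t : ℝ => t ^ k := by
  have h := isBigO_id_of_differentiableAt (hT.differentiableAt (by simp))
  simp only [hT0, sub_zero, pow_one] at h
  exact h.pow k

theorem tendsto_of_contDiffAt {E F : Type} [NormedAddCommGroup E] [NormedSpace ℝ E]
    [NormedAddCommGroup F] [NormedSpace ℝ F] {u : E → F}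
    (hu : ContDiffAt ℝ (⊤ : ℕ∞) u 0) (h0 : u 0 = 0) : Tendsto u (𝓝 0) (𝓝 0) := by
  have h := hu.continuousAt.tendsto
  rwa [h0] at h

theorem exists_expansion {T u : ℝ → ℝ} (hT : ContDiffAt ℝ (⊤ : ℕ∞) T 0)
    (hT0 : T 0 = 0) (hd : deriv T 0 ≠ 0) (hu : ContDiffAt ℝ (⊤ : ℕ∞) u 0) (k : ℕ) :
    ∃ a : ℕ → ℝ, (fun t => u t - ∑ j ∈ Finset.range k, a j * T t ^ j) =O[𝓝 0]
      fun t : ℝ => t ^ k := by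
  obtain ⟨S, hS, hS0, hST, hTS⟩ := exists_inverse_of_deriv_ne_zero hT hT0 hd
  have huS : ContDiffAt ℝ k (fun t => u (S t)) 0 :=
    ((hS0.symm ▸ hu : ContDiffAt ℝ (⊤ : ℕ∞) u (S 0)).comp 0 hS).of_le (WithTop.coe_le_coe.2 le_top)
  have h1 := (taylor_isBigO huS).comp_tendsto (tendsto_of_contDiffAt hT hT0)
  refine ⟨fun j => iteratedDeriv j (fun t => u (S t)) 0 / j.factorial, ?_⟩
  refine (h1.trans (isBigO_pow_comp hT hT0 k)).congr' ?_ EventuallyEq.rfl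
  filter_upwards [hST] with t ht
  simp only [Function.comp_apply, ht]

theorem tendsto_smul_lastVec {m : ℕ} {T : ℝ → ℝ} (hT : ContDiffAt ℝ (⊤ : ℕ∞) T 0)
    (hT0 : T 0 = 0) : Tendsto (fun t => T t • lastVec m) (𝓝 0) (𝓝 0) :=
  tendsto_of_contDiffAt (hT.smul contDiffAt_const) (by rw [hT0, zero_smul])

/-- The order of contact along the last axis is at least the order along any regular curve. -/
theorem isBigO_axis_of_curve {N n k : ℕ} (hk : 2 ≤ k) (hNn : N ≤ n)
    {g : (Fin (N + 1) → ℝ) → (Fin n → ℝ)} (hg : ContDiff ℝ (⊤ : ℕ∞) g)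
    (hform : ∀ᶠ x in 𝓝 (0 : Fin (N + 1) → ℝ), ∀ k : Fin n, k.val < N → g x k = xhat x k.val)
    {γ : ℝ → Fin (N + 1) → ℝ} (hγ : ContDiffAt ℝ (⊤ : ℕ∞) γ 0) (hγ0 : γ 0 = 0)
    (hd : deriv γ 0 ≠ 0) (h : (fun t => g (γ t)) =O[𝓝 0] fun t : ℝ => t ^ k) :
    (fun t : ℝ => g (t • lastVec (N + 1))) =O[𝓝 0] fun t : ℝ => t ^ k := by
  have hγt := tendsto_of_contDiffAt hγ hγ0
  have h1 := isBigO_sub_axis hNn hform hγt h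
  have h2 := deriv_last_ne_zero hk (hγ.differentiableAt (by simp)) hγ0 hd h1
  have hT : ContDiffAt ℝ (⊤ : ℕ∞) (fun t => γ t (Fin.last N)) 0 := contDiffAt_pi.1 hγ _
  have hT0 : γ 0 (Fin.last N) = 0 := by rw [hγ0]; rfl
  have h3 := (isBigO_comp_sub hg.contDiffAt hγt (tendsto_smul_lastVec hT hT0)).trans h1
  have h4 := h.sub h3
  simp only [sub_sub_cancel] at h4
  obtain ⟨S, hS, hS0, hST, hTS⟩ := exists_inverse_of_deriv_ne_zero hT hT0 h2
  refine ((h4.comp_tendsto (tendsto_of_contDiffAt hS hS0)).trans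
    (isBigO_pow_comp hS hS0 k)).congr' ?_ EventuallyEq.rfl
  filter_upwards [hTS] with t ht
  simp only [Function.comp_apply, ht]

end Curves

section Transport

open Asymptotics

theorem isDiffeoGerm_eventuallyEq_inverse {m n : ℕ} {f h : (Fin m → ℝ) → (Fin n → ℝ)}
    (hf : ContDiff ℝ (⊤ : ℕ∞) f) (hf0 : f 0 = 0) (hfh : AEquiv f h) :
    ∃ (φ ψ : (Fin m → ℝ) → (Fin m → ℝ)) (Φ Ψ : (Fin n → ℝ) → (Fin n → ℝ)),
      IsDiffeoGerm φ ∧ IsDiffeoGerm ψ ∧ IsDiffeoGerm Φ ∧ IsDiffeoGerm Ψ ∧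
      (∀ᶠ x in 𝓝 0, φ (ψ x) = x) ∧ (∀ᶠ x in 𝓝 0, h (ψ x) = Φ (f x)) ∧
      ∀ᶠ x in 𝓝 0, f (φ x) = Ψ (h x) := by
  obtain ⟨φ, Φ, hφ, hΦ, heq⟩ := hfh
  obtain ⟨ψ, hψ, h1, h2⟩ := hφ.exists_inverse
  obtain ⟨Ψ, hΨ, h3, h4⟩ := hΦ.exists_inverse
  refine ⟨φ, ψ, Φ, Ψ, hφ, hψ, hΦ, hΨ, h2, ?_, ?_⟩
  · filter_upwards [(tendsto_of_contDiffAt hψ.2.1 hψ.1).eventually heq, h2] with x hx hx2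
    rw [← hx, hx2]
  · have h5 : Tendsto (fun x => f (φ x)) (𝓝 0) (𝓝 0) :=
      (tendsto_of_contDiffAt hf.contDiffAt hf0).comp (tendsto_of_contDiffAt hφ.2.1 hφ.1)
    filter_upwards [heq, h5.eventually h3] with x hx hx2
    rw [← hx, hx2]

theorem AEquiv.symm {m n : ℕ} {f h : (Fin m → ℝ) → (Fin n → ℝ)}
    (hf : ContDiff ℝ (⊤ : ℕ∞) f) (hf0 : f 0 = 0) (hfh : AEquiv f h) : AEquiv h f := by
  obtain ⟨φ, ψ, Φ, Ψ, hφ, hψ, hΦ, hΨ, h1, h2, h3⟩ := isDiffeoGerm_eventuallyEq_inverse hf hf0 hfh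
  refine ⟨ψ, Ψ, hψ, hΨ, ?_⟩
  filter_upwards [(tendsto_of_contDiffAt hψ.2.1 hψ.1).eventually h3, h1] with x hx hx1
  rw [← hx, hx1]

theorem contDiffAt_axis {m : ℕ} : ContDiffAt ℝ (⊤ : ℕ∞) (fun t : ℝ => t • lastVec m) 0 :=
  contDiffAt_id.smul contDiffAt_const

theorem tendsto_axis {m : ℕ} : Tendsto (fun t : ℝ => t • lastVec m) (𝓝 0) (𝓝 0) :=
  tendsto_smul_lastVec contDiffAt_id rfl

theorem lastVec_ne_zero {N : ℕ} : lastVec (N + 1) ≠ 0 := fun h => by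
  have := congrFun h (Fin.last N)
  simp [lastVec] at this

theorem isBigO_image_axis {m n k : ℕ} {f h : (Fin m → ℝ) → (Fin n → ℝ)} (hf0 : f 0 = 0)
    (hf : ContDiff ℝ (⊤ : ℕ∞) f)
    {ψ : (Fin m → ℝ) → (Fin m → ℝ)} {Φ : (Fin n → ℝ) → (Fin n → ℝ)} (hΦ : IsDiffeoGerm Φ)
    (h2 : ∀ᶠ x in 𝓝 0, h (ψ x) = Φ (f x))
    (ho : (fun t : ℝ => f (t • lastVec m)) =O[𝓝 0] fun t : ℝ => t ^ k) :
    (fun t : ℝ => h (ψ (t • lastVec m))) =O[𝓝 0] fun t : ℝ => t ^ k := by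
  have h4 := isBigO_comp_sub hΦ.2.1 ((tendsto_of_contDiffAt hf.contDiffAt hf0).comp
    (tendsto_axis (m := m))) tendsto_const_nhds
  simp only [hΦ.1, sub_zero, Function.comp_apply] at h4
  refine (h4.trans ho).congr' ?_ EventuallyEq.rfl
  filter_upwards [tendsto_axis.eventually h2] with t ht
  exact ht.symm

theorem deriv_diffeo_axis_ne_zero {N : ℕ} {ψ : (Fin (N + 1) → ℝ) → (Fin (N + 1) → ℝ)}
    (hψ : IsDiffeoGerm ψ) : deriv (fun t : ℝ => ψ (t • lastVec (N + 1))) 0 ≠ 0 := by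
  have h1 : HasDerivAt (fun t : ℝ => t • lastVec (N + 1)) (lastVec (N + 1)) 0 := by
    simpa using (hasDerivAt_id (0 : ℝ)).smul_const (lastVec (N + 1))
  have h2 : HasFDerivAt ψ (fderiv ℝ ψ 0) ((0 : ℝ) • lastVec (N + 1)) := by
    rw [zero_smul]
    exact (hψ.2.1.differentiableAt (by simp)).hasFDerivAt
  have h3 : HasDerivAt (fun t : ℝ => ψ (t • lastVec (N + 1))) _ 0 := h2.comp_hasDerivAt 0 h1
  rw [h3.deriv]
  exact fun h => lastVec_ne_zero (hψ.injective _ h)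

theorem contDiffAt_diffeo_axis {m : ℕ} {ψ : (Fin m → ℝ) → (Fin m → ℝ)} (hψ : IsDiffeoGerm ψ) :
    ContDiffAt ℝ (⊤ : ℕ∞) (fun t : ℝ => ψ (t • lastVec m)) 0 :=
  ((zero_smul ℝ (lastVec m)).symm ▸ hψ.2.1 :
    ContDiffAt ℝ (⊤ : ℕ∞) ψ ((0 : ℝ) • lastVec m)).comp 0 contDiffAt_axis

theorem isBigO_axis_of_aEquiv {N n k : ℕ} (hk : 2 ≤ k) (hNn : N ≤ n)
    {f h : (Fin (N + 1) → ℝ) → (Fin n → ℝ)} (hf : ContDiff ℝ (⊤ : ℕ∞) f) (hf0 : f 0 = 0)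
    (hh : ContDiff ℝ (⊤ : ℕ∞) h)
    (hform : ∀ᶠ x in 𝓝 (0 : Fin (N + 1) → ℝ), ∀ k : Fin n, k.val < N → h x k = xhat x k.val)
    (hfh : AEquiv f h)
    (ho : (fun t : ℝ => f (t • lastVec (N + 1))) =O[𝓝 0] fun t : ℝ => t ^ k) :
    (fun t : ℝ => h (t • lastVec (N + 1))) =O[𝓝 0] fun t : ℝ => t ^ k := by
  obtain ⟨φ, ψ, Φ, Ψ, hφ, hψ, hΦ, hΨ, h1, h2, h3⟩ := isDiffeoGerm_eventuallyEq_inverse hf hf0 hfh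
  exact isBigO_axis_of_curve hk hNn hh hform (contDiffAt_diffeo_axis hψ)
    (by rw [zero_smul, hψ.1]) (deriv_diffeo_axis_ne_zero hψ) (isBigO_image_axis hf0 hf hΦ h2 ho)

/-- Every vector field along `f ∘ γ` is, up to order `k`, the sum of a constant field and the image
under `df` of a field along `γ`. -/
def VersalAlong {m n : ℕ} (f : (Fin m → ℝ) → (Fin n → ℝ)) (γ : ℝ → Fin m → ℝ) (k : ℕ) : Prop :=
  ∀ ω : ℝ → Fin n → ℝ, ContDiffAt ℝ (⊤ : ℕ∞) ω 0 → ∃ (ζ : ℝ → Fin m → ℝ) (c : Fin n → ℝ),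
    ContDiffAt ℝ (⊤ : ℕ∞) ζ 0 ∧
      (fun t => ω t - fderiv ℝ f (γ t) (ζ t) - c) =O[𝓝 0] fun t : ℝ => t ^ k

theorem isBigO_clm_apply {E F : Type} [NormedAddCommGroup E] [NormedSpace ℝ E]
    [NormedAddCommGroup F] [NormedSpace ℝ F] {A : ℝ → E →L[ℝ] F} {ζ : ℝ → E} {k : ℕ}
    (hA : A =O[𝓝 0] fun t : ℝ => t ^ k) (hζ : ContinuousAt ζ 0) :
    (fun t => A t (ζ t)) =O[𝓝 0] fun t : ℝ => t ^ k := by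
  have h1 : (fun t => A t (ζ t)) =O[𝓝 0] fun t => ‖A t‖ * ‖ζ t‖ :=
    isBigO_of_le _ fun t => ((A t).le_opNorm _).trans (le_abs_self _)
  have h2 := hA.norm_left.mul (hζ.norm.tendsto.isBigO_one ℝ)
  simp only [mul_one] at h2
  exact h1.trans h2

theorem VersalAlong.congr {m n k : ℕ} {f : (Fin m → ℝ) → (Fin n → ℝ)}
    (hf : ContDiff ℝ (⊤ : ℕ∞) f) {γ δ : ℝ → Fin m → ℝ} (hγ : Tendsto γ (𝓝 0) (𝓝 0))
    (hδ : Tendsto δ (𝓝 0) (𝓝 0)) (h : (fun t => γ t - δ t) =O[𝓝 0] fun t : ℝ => t ^ k)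
    (hv : VersalAlong f γ k) : VersalAlong f δ k := fun ω hω => by
  obtain ⟨ζ, c, hζ, ho⟩ := hv ω hω
  have h1 := (isBigO_comp_sub (hf.fderiv_right (m := (⊤ : ℕ∞)) (by simp)).contDiffAt hγ hδ).trans h
  refine ⟨ζ, c, hζ, (ho.add (isBigO_clm_apply h1 hζ.continuousAt)).congr_left fun t => ?_⟩
  rw [_root_.sub_apply]
  abel

/-- Versality is transported by coordinate changes. -/
theorem VersalAlong.of_diffeo {m n k : ℕ} {f h : (Fin m → ℝ) → (Fin n → ℝ)}
    (hf : ContDiff ℝ (⊤ : ℕ∞) f) (hh : ContDiff ℝ (⊤ : ℕ∞) h) (hh0 : h 0 = 0)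
    {φ : (Fin m → ℝ) → (Fin m → ℝ)} {Ψ : (Fin n → ℝ) → (Fin n → ℝ)} (hφ : IsDiffeoGerm φ)
    (hΨ : IsDiffeoGerm Ψ) (heq : ∀ᶠ x in 𝓝 0, f (φ x) = Ψ (h x)) {γ δ : ℝ → Fin m → ℝ}
    (hγ : ContDiffAt ℝ (⊤ : ℕ∞) γ 0) (hγ0 : γ 0 = 0) (hδ : ∀ᶠ t in 𝓝 0, φ (γ t) = δ t)
    (ho : (fun t => h (γ t)) =O[𝓝 0] fun t : ℝ => t ^ k)
    (hv : VersalAlong h γ k) : VersalAlong f δ k := fun ω hω => by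
  have hγt := tendsto_of_contDiffAt hγ hγ0
  let e := (LinearEquiv.ofInjectiveEndo (fderiv ℝ Ψ 0).toLinearMap
    ((injective_iff_map_eq_zero _).2 hΨ.injective)).toContinuousLinearEquiv
  have he : ∀ v, fderiv ℝ Ψ 0 (e.symm v) = v := fun v => e.apply_symm_apply v
  obtain ⟨ζ, c, hζ, hζo⟩ := hv (fun t => e.symm (ω t)) (e.symm.contDiff.contDiffAt.comp 0 hω)
  have hht : Tendsto (fun t => h (γ t)) (𝓝 0) (𝓝 0) :=
    (tendsto_of_contDiffAt hh.contDiffAt hh0).comp hγt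
  have hφ' : ContDiffAt ℝ (⊤ : ℕ∞) (fderiv ℝ φ) 0 := hφ.2.1.fderiv_right (by simp)
  have hΨ' : ContDiffAt ℝ (⊤ : ℕ∞) (fderiv ℝ Ψ) 0 := hΨ.2.1.fderiv_right (by simp)
  have hh' : ContDiffAt ℝ (⊤ : ℕ∞) (fderiv ℝ h) 0 := hh.contDiffAt.fderiv_right (by simp)
  have hdh : ContinuousAt (fun t => fderiv ℝ h (γ t) (ζ t)) 0 :=
    (((hγ0.symm ▸ hh' : ContDiffAt ℝ (⊤ : ℕ∞) (fderiv ℝ h) (γ 0)).comp 0 hγ).clm_apply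
      hζ).continuousAt
  have h1 := isBigO_comp_sub hΨ' hht tendsto_const_nhds
  simp only [sub_zero] at h1
  have h2 := isBigO_clm_apply (h1.trans ho) hdh
  have h3 := ((fderiv ℝ Ψ 0).isBigO_comp _ _).trans hζo
  refine ⟨fun t => fderiv ℝ φ (γ t) (ζ t), fderiv ℝ Ψ 0 c,
    ((hγ0.symm ▸ hφ' : ContDiffAt ℝ (⊤ : ℕ∞) (fderiv ℝ φ) (γ 0)).comp 0 hγ).clm_apply hζ,
    (h3.sub h2).congr' ?_ EventuallyEq.rfl⟩
  filter_upwards [hγt.eventually heq.eventually_nhds, hδ,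
    hγt.eventually ((hφ.2.1.of_le (m := 1) (WithTop.coe_le_coe.2 le_top)).eventually (by simp)),
    hht.eventually ((hΨ.2.1.of_le (m := 1) (WithTop.coe_le_coe.2 le_top)).eventually (by simp))]
    with t ht1 ht2 ht3 ht4
  have h5 : HasFDerivAt (fun x => f (φ x)) _ (γ t) :=
    ((hf.differentiable (by simp)) (φ (γ t))).hasFDerivAt.comp (γ t)
      (ht3.differentiableAt (by simp)).hasFDerivAt
  have h6 : HasFDerivAt (fun x => Ψ (h x)) _ (γ t) :=
    (ht4.differentiableAt (by simp)).hasFDerivAt.comp (γ t)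
      ((hh.differentiable (by simp)) (γ t)).hasFDerivAt
  have h7 := DFunLike.congr_fun ((h6.congr_of_eventuallyEq ht1).unique h5) (ζ t)
  simp only [ContinuousLinearMap.comp_apply, ht2] at h7
  rw [← h7, map_sub, map_sub, he, _root_.sub_apply]
  abel

end Transport

section NormalForm

open Asymptotics

theorem contDiff_xhat {m : ℕ} (q : ℕ) : ContDiff ℝ (⊤ : ℕ∞) fun x : Fin m → ℝ => xhat x q := by
  unfold xhat
  split_ifs with h
  · exact contDiff_apply ℝ ℝ _
  · exact contDiff_const

theorem contDiff_hMorinNF (m n r : ℕ) : ContDiff ℝ (⊤ : ℕ∞) (hMorinNF m n r) := by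
  refine contDiff_pi.2 fun k => ?_
  unfold hMorinNF
  have h : ∀ q j, ContDiff ℝ (⊤ : ℕ∞) fun x : Fin m → ℝ => xhat x q * xhat x (m - 1) ^ (j + 1) :=
    fun q j => (contDiff_xhat q).mul ((contDiff_xhat _).pow _)
  split_ifs
  · exact contDiff_xhat _
  · exact ContDiff.sum fun j _ => h _ _
  · exact (ContDiff.sum fun j _ => h _ _).add ((contDiff_xhat _).pow _)

theorem hMorinNF_zero (m n r : ℕ) : hMorinNF m n r 0 = 0 := by
  have h : ∀ q, xhat (0 : Fin m → ℝ) q = 0 := fun q => by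
    unfold xhat
    split_ifs <;> rfl
  funext k
  simp [hMorinNF, h]

theorem xhat_add_smul {m : ℕ} (x v : Fin m → ℝ) (s : ℝ) (q : ℕ) :
    xhat (x + s • v) q = xhat x q + s * xhat v q := by
  unfold xhat
  split_ifs <;> simp

theorem xhat_axis {N : ℕ} (t : ℝ) (q : ℕ) :
    xhat (t • lastVec (N + 1)) q = if q = N then t else 0 := by
  unfold xhat lastVec
  by_cases h : q = N
  · simp [h]
  · simp [h]

theorem hasDerivAt_hMorinNF_term (a b T : ℝ) (j : ℕ) :
    HasDerivAt (fun s : ℝ => s * a * (T + s * b) ^ (j + 1)) (a * T ^ (j + 1)) 0 := by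
  have h1 : HasDerivAt (fun s : ℝ => s * a) a 0 := by
    simpa using (hasDerivAt_id (0 : ℝ)).mul_const a
  have h2 : HasDerivAt (fun s : ℝ => T + s * b) b 0 := by
    simpa using ((hasDerivAt_id (0 : ℝ)).mul_const b).const_add T
  exact (h1.fun_mul (h2.fun_pow (j + 1))).congr_deriv (by simp)

theorem fderiv_apply_eq_of_line {m n : ℕ} {h : (Fin m → ℝ) → (Fin n → ℝ)} {x v : Fin m → ℝ}
    (hh : DifferentiableAt ℝ h x) {k : Fin n} {d : ℝ}
    (hd : HasDerivAt (fun s : ℝ => h (x + s • v) k) d 0) : fderiv ℝ h x v k = d := by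
  have h1 : HasDerivAt (fun s : ℝ => x + s • v) v 0 := by
    simpa using ((hasDerivAt_id (0 : ℝ)).smul_const v).const_add x
  have h2 : HasFDerivAt h (fderiv ℝ h x) (x + (0 : ℝ) • v) := by
    rw [zero_smul, add_zero]
    exact hh.hasFDerivAt
  exact (hasDerivAt_pi.1 (h2.comp_hasDerivAt 0 h1) k).unique hd

theorem fderiv_hMorinNF_of_lt {N n r : ℕ} (T : ℝ) (v : Fin (N + 1) → ℝ) {k : Fin n}
    (hk : k.val < N) :
    fderiv ℝ (hMorinNF (N + 1) n r) (T • lastVec (N + 1)) v k = xhat v k.val := by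
  refine fderiv_apply_eq_of_line ((contDiff_hMorinNF _ _ _).differentiable (by simp) _) ?_
  simp only [hMorinNF_of_lt (m := N + 1) _ hk, xhat_add_smul]
  simpa using ((hasDerivAt_id (0 : ℝ)).mul_const (xhat v k.val)).const_add
    (xhat (T • lastVec (N + 1)) k.val)

theorem fderiv_hMorinNF_of_mid {N n p r : ℕ} (hn : n = N + 1 + p) (hdim : r * (p + 1) ≤ N + 1)
    (T : ℝ) (v : Fin (N + 1) → ℝ) {k : Fin n} {i : ℕ} (hk : k.val = N + i) (hi : i < p) :
    fderiv ℝ (hMorinNF (N + 1) n r) (T • lastVec (N + 1)) v k =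
      ∑ j ∈ Finset.range r, xhat v (i * r + j) * T ^ (j + 1) := by
  refine fderiv_apply_eq_of_line ((contDiff_hMorinNF _ _ _).differentiable (by simp) _) ?_
  simp only [hMorinNF_of_mid hn _ hk hi, xhat_add_smul, xhat_axis, if_true]
  refine HasDerivAt.fun_sum fun j hj => ?_
  have hj := Finset.mem_range.1 hj
  have h1 : i * r + j ≠ N := by
    have : (i + 1) * r ≤ p * r := Nat.mul_le_mul_right _ hi
    nlinarith
  simp only [if_neg h1, zero_add]
  exact hasDerivAt_hMorinNF_term _ _ _ _

theorem fderiv_hMorinNF_of_last {N n p r : ℕ} (hn : n = N + 1 + p) (hdim : r * (p + 1) ≤ N + 1)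
    (T : ℝ) (v : Fin (N + 1) → ℝ) {k : Fin n} (hk : k.val = N + p) :
    fderiv ℝ (hMorinNF (N + 1) n r) (T • lastVec (N + 1)) v k =
      ∑ j ∈ Finset.range (r - 1), xhat v (p * r + j) * T ^ (j + 1) +
        (r + 1) * T ^ r * xhat v N := by
  refine fderiv_apply_eq_of_line ((contDiff_hMorinNF _ _ _).differentiable (by simp) _) ?_
  simp only [hMorinNF_of_last hn _ hk, xhat_add_smul, xhat_axis, if_true]
  refine (HasDerivAt.fun_sum fun j hj => ?_).fun_add ?_
  · have hj := Finset.mem_range.1 hj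
    have h1 : p * r + j ≠ N := by
      have : p * r + r ≤ N + 1 := by linarith
      omega
    simp only [if_neg h1, zero_add]
    exact hasDerivAt_hMorinNF_term _ _ _ _
  · have h2 : HasDerivAt (fun s : ℝ => T + s * xhat v N) (xhat v N) 0 := by
      simpa using ((hasDerivAt_id (0 : ℝ)).mul_const (xhat v N)).const_add T
    exact (h2.fun_pow (r + 1)).congr_deriv (by simp)

theorem hMorinNF_axis {N n p r : ℕ} (hn : n = N + 1 + p) (hdim : r * (p + 1) ≤ N + 1) (t : ℝ)
    (k : Fin n) :
    hMorinNF (N + 1) n r (t • lastVec (N + 1)) k = if k.val = N + p then t ^ (r + 1) else 0 := by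
  rcases lt_or_ge k.val N with h | h
  · rw [hMorinNF_of_lt _ h, xhat_axis, if_neg h.ne, if_neg (by omega)]
  obtain ⟨i, hi⟩ := Nat.exists_eq_add_of_le h
  rcases eq_or_ne i p with rfl | hip
  · rw [hMorinNF_of_last hn _ hi, if_pos hi, xhat_axis, if_pos rfl, Finset.sum_eq_zero, zero_add]
    intro j hj
    have hj := Finset.mem_range.1 hj
    have h2 : i * r + r ≤ N + 1 := by linarith
    rw [xhat_axis, if_neg (by omega), zero_mul]
  · have hip : i < p := by omega
    rw [hMorinNF_of_mid hn _ hi hip, if_neg (by omega), Finset.sum_eq_zero]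
    intro j hj
    have hj := Finset.mem_range.1 hj
    have h2 : p * r + r ≤ N + 1 := by linarith
    have h3 : (i + 1) * r ≤ p * r := Nat.mul_le_mul_right _ hip
    have h4 : i * r + r = (i + 1) * r := by ring
    rw [xhat_axis, if_neg (by omega), zero_mul]

theorem isBigO_hMorinNF_axis {N n p r : ℕ} (hn : n = N + 1 + p) (hdim : r * (p + 1) ≤ N + 1) :
    (fun t : ℝ => hMorinNF (N + 1) n r (t • lastVec (N + 1))) =O[𝓝 0] fun t : ℝ => t ^ (r + 1) := by
  refine isBigO_pi.2 fun k => ?_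
  simp only [hMorinNF_axis hn hdim]
  split_ifs
  · exact isBigO_refl _ _
  · exact isBigO_zero _ _

/-- The Morin normal form is versal along every reparametrisation of the last axis. -/
theorem versalAlong_hMorinNF {N n p r : ℕ} (hn : n = N + 1 + p) (hr : 1 ≤ r)
    (hdim : r * (p + 1) ≤ N + 1) {T : ℝ → ℝ} (hT : ContDiffAt ℝ (⊤ : ℕ∞) T 0) (hT0 : T 0 = 0)
    (hd : deriv T 0 ≠ 0) :
    VersalAlong (hMorinNF (N + 1) n r) (fun t => T t • lastVec (N + 1)) (r + 1) := fun ω hω => by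
  let w : ℝ → Fin (N + 1) → ℝ := fun t l => if h : l.val < N then ω t ⟨l.val, by omega⟩ else 0
  have hw : ContDiffAt ℝ (⊤ : ℕ∞) w 0 := contDiffAt_pi.2 fun l => by
    by_cases h : l.val < N
    · simp only [w, dif_pos h]
      exact contDiffAt_pi.1 hω _
    · simp only [w, dif_neg h]
      exact contDiffAt_const
  have hρ : ∀ k : Fin n, ContDiffAt ℝ (⊤ : ℕ∞) (fun t => ω t k -
      fderiv ℝ (hMorinNF (N + 1) n r) (T t • lastVec (N + 1)) (w t) k) 0 := fun k =>
    (contDiffAt_pi.1 hω k).sub (contDiffAt_pi.1 ((((contDiff_hMorinNF (N + 1) n r).fderiv_right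
      (m := (⊤ : ℕ∞)) (by simp)).contDiffAt.comp 0 (hT.smul contDiffAt_const)).clm_apply hw) k)
  choose a ha using fun k => exists_expansion hT hT0 hd (hρ k) (r + 1)
  let b : ℕ → ℕ → ℝ := fun i j => if h : N + i < n then a ⟨N + i, h⟩ j else 0
  have hb : ∀ (k : Fin n) i j, k.val = N + i → b i j = a k j := fun k i j hk => by
    have : k = ⟨N + i, hk ▸ k.isLt⟩ := Fin.ext hk
    rw [this]
    exact dif_pos _
  let v : Fin (N + 1) → ℝ := fun l =>
    if l.val = N then b p r / (r + 1) else b (l.val / r) (l.val % r + 1)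
  have hvN : xhat v N = b p r / (r + 1) := by simp [xhat, v]
  have hv : ∀ i j, j < r → i * r + j < N → xhat v (i * r + j) = b i (j + 1) := fun i j hj h => by
    rw [xhat, dif_pos (by omega)]
    simp only [v]
    rw [if_neg h.ne, mul_comm i r, Nat.mul_add_div (by omega), Nat.mul_add_mod,
      Nat.div_eq_of_lt hj, Nat.mod_eq_of_lt hj, add_zero]
  have hdv : ∀ (k : Fin n) (i : ℕ), k.val = N + i → ∀ s : ℝ,
      fderiv ℝ (hMorinNF (N + 1) n r) (s • lastVec (N + 1)) v k =
        ∑ j ∈ Finset.range r, a k (j + 1) * s ^ (j + 1) := fun k i hk s => by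
    have h2 : p * r + r ≤ N + 1 := by linarith
    rcases eq_or_ne i p with rfl | hip
    · rw [fderiv_hMorinNF_of_last hn hdim s v hk, hvN]
      obtain ⟨r, rfl⟩ := Nat.exists_eq_add_of_le' hr
      rw [Finset.sum_range_succ, hb k _ _ hk, Nat.add_sub_cancel]
      congr 1
      · refine Finset.sum_congr rfl fun j hj => ?_
        have hj := Finset.mem_range.1 hj
        rw [hv _ _ (by omega) (by omega), hb k _ _ hk]
      · have : ((r + 1 : ℕ) : ℝ) + 1 ≠ 0 := by positivity
        field_simp
    · have hip : i < p := by omega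
      rw [fderiv_hMorinNF_of_mid hn hdim s v hk hip]
      refine Finset.sum_congr rfl fun j hj => ?_
      have hj := Finset.mem_range.1 hj
      have h3 : (i + 1) * r ≤ p * r := Nat.mul_le_mul_right _ hip
      have h4 : i * r + r = (i + 1) * r := by ring
      rw [hv _ _ hj (by omega), hb k _ _ hk]
  refine ⟨fun t => w t + v, fun k => if k.val < N then - xhat v k.val else a k 0,
    hw.add contDiffAt_const, isBigO_pi.2 fun k => ?_⟩
  rcases lt_or_ge k.val N with hk | hk
  · refine (isBigO_zero _ _).congr_left fun t => ?_
    simp only [Pi.sub_apply, map_add, Pi.add_apply, fderiv_hMorinNF_of_lt _ _ hk, if_pos hk]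
    have : xhat (w t) k.val = ω t k := by
      rw [xhat, dif_pos (by omega)]
      exact dif_pos hk
    rw [this]
    ring
  · obtain ⟨i, hi⟩ := Nat.exists_eq_add_of_le hk
    refine (ha k).congr_left fun t => ?_
    simp only [Pi.sub_apply, map_add, Pi.add_apply, hdv k i hi, if_neg hk.not_gt]
    rw [Finset.sum_range_succ', pow_zero, mul_one]
    ring

end NormalForm

section Necessity

open Asymptotics

theorem fderiv_apply_of_form {N n : ℕ} {f : (Fin (N + 1) → ℝ) → (Fin n → ℝ)}
    (hf : ContDiff ℝ (⊤ : ℕ∞) f)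
    (hform : ∀ᶠ x in 𝓝 (0 : Fin (N + 1) → ℝ), ∀ k : Fin n, k.val < N → f x k = xhat x k.val)
    (k : Fin n) (hk : k.val < N) :
    ∀ᶠ x in 𝓝 (0 : Fin (N + 1) → ℝ), ∀ v, fderiv ℝ f x v k = v ⟨k.val, by omega⟩ := by
  filter_upwards [hform.eventually_nhds] with x hx v
  have h1 := hasFDerivAt_pi'.1 ((hf.differentiable (by simp)) x).hasFDerivAt k
  have h2 : (fun y => f y k) =ᶠ[𝓝 x] fun y => y ⟨k.val, by omega⟩ := by
    filter_upwards [hx] with y hy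
    rw [hy k hk]
    exact dif_pos _
  have h3 := (h1.congr_of_eventuallyEq h2.symm).unique (hasFDerivAt_apply _ x)
  exact DFunLike.congr_fun h3 v

theorem fderiv_comp_apply {m n : ℕ} {f : (Fin m → ℝ) → (Fin n → ℝ)} (hf : ContDiff ℝ (⊤ : ℕ∞) f)
    (k : Fin n) {q : ℕ} (hq : k.val = q) (x v : Fin m → ℝ) :
    fderiv ℝ (_root_.comp f q) x v = fderiv ℝ f x v k := by
  subst hq
  have h1 := hasFDerivAt_pi'.1 ((hf.differentiable (by simp)) x).hasFDerivAt k
  have h2 : _root_.comp f k.val = fun y => f y k := funext fun y => comp_apply_of_lt f k.isLt y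
  rw [h2, h1.fderiv]
  rfl

theorem DlIter_eq_zero_of_isBigO {N n k : ℕ} {f : (Fin (N + 1) → ℝ) → (Fin n → ℝ)}
    (hf : ContDiff ℝ (⊤ : ℕ∞) f)
    (h : (fun t : ℝ => f (t • lastVec (N + 1))) =O[𝓝 0] fun t : ℝ => t ^ k) {q : ℕ} (hq : q < n) :
    ∀ j < k, DlIter (_root_.comp f q) j 0 = 0 := fun j hj => by
  have hg := contDiff_comp hf q
  have h1 := iteratedDeriv_eq_zero_of_isBigO (u := fun t => _root_.comp f q (t • lastVec (N + 1)))
    (((hg.comp (contDiff_id.smul contDiff_const)).contDiffAt).of_le (WithTop.coe_le_coe.2 le_top))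
    ((isBigO_pi.1 h ⟨q, hq⟩).congr_left fun t => (comp_apply_of_lt f hq _).symm) j hj
  rw [iteratedDeriv_axis hg] at h1
  beta_reduce at h1
  rwa [zero_smul] at h1

/-- Versality along the last axis implies Morin's rank condition. -/
theorem rank_morinMatrix_of_versalAlong {N p n r : ℕ} (hn : n = N + 1 + p)
    {f : (Fin (N + 1) → ℝ) → (Fin n → ℝ)} (hf : ContDiff ℝ (⊤ : ℕ∞) f)
    (hform : ∀ᶠ x in 𝓝 (0 : Fin (N + 1) → ℝ), ∀ k : Fin n, k.val < N → f x k = xhat x k.val)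
    (c1 : ∀ k : Fin (p + 1), ∀ j, 1 ≤ j → j ≤ r → DlIter (_root_.comp f (N + k.val)) j 0 = 0)
    (hv : VersalAlong f (fun t : ℝ => t • lastVec (N + 1)) (r + 1)) :
    (morinMatrix f r p).rank = r * (p + 1) := by
  suffices h : Function.Surjective (morinMatrix f r p).mulVecLin by
    rw [Matrix.rank, LinearMap.range_eq_top.2 h, finrank_top, Module.finrank_fintype_fun_eq_card,
      Fintype.card_prod, Fintype.card_fin, Fintype.card_fin]
  intro b
  let A : Fin (p + 1) → ℕ → ℝ := fun i j =>
    if h : j - 1 < r then (if j = 0 then 0 else b (⟨j - 1, h⟩, i) / j.factorial) else 0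
  obtain ⟨ζ, c, hζ, ho⟩ := hv (fun t k => if h : N ≤ k.val then
      ∑ j ∈ Finset.range r, A ⟨k.val - N, by omega⟩ (j + 1) * t ^ (j + 1) else 0) (by
    refine contDiffAt_pi.2 fun k => ?_
    split_ifs
    · exact ContDiffAt.sum fun j _ => contDiffAt_const.mul (contDiffAt_id.pow _)
    · exact contDiffAt_const)
  let v : Fin (N + 1) → ℝ := fun l =>
    if h : l.val < N then - c ⟨l.val, by omega⟩ else ζ 0 (Fin.last N)
  have hsplit : (fun t => ζ t - v - (ζ t (Fin.last N) - ζ 0 (Fin.last N)) • lastVec (N + 1))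
      =O[𝓝 0] fun t : ℝ => t ^ (r + 1) := by
    refine isBigO_pi.2 fun q => ?_
    refine Fin.lastCases ?_ (fun q => ?_) q
    · refine (isBigO_zero _ _).congr_left fun t => ?_
      simp [lastVec, v]
    · have h1 := isBigO_pi.1 ho ⟨q.val, by omega⟩
      refine h1.neg_left.congr' ?_ EventuallyEq.rfl
      filter_upwards [tendsto_axis.eventually (fderiv_apply_of_form hf hform ⟨q.val, by omega⟩
        q.isLt)] with t ht
      simp only [Pi.sub_apply, ht, dif_neg q.isLt.not_ge]
      simp only [v, Fin.val_castSucc, dif_pos q.isLt, Pi.smul_apply, lastVec,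
        Nat.add_sub_cancel, if_neg q.isLt.ne, smul_zero]
      change -(0 - ζ t q.castSucc - _) = _
      ring
  have hlast : (fun t => ζ t (Fin.last N) - ζ 0 (Fin.last N)) =O[𝓝 0] fun t : ℝ => t ^ 1 :=
    isBigO_id_of_differentiableAt (differentiableAt_pi.1 (hζ.differentiableAt (by simp)) _)
  refine ⟨v, funext fun si => ?_⟩
  rw [Matrix.mulVecLin_apply, morinMatrix_mulVec]
  change fderiv ℝ (DlIter (_root_.comp f (N + si.2.val)) (si.1.val + 1)) 0 v = b si
  let k : Fin n := ⟨N + si.2.val, by omega⟩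
  have hg := contDiff_comp hf (N + si.2.val)
  have hgd : ∀ w, ContDiff ℝ (⊤ : ℕ∞) fun t : ℝ =>
      fderiv ℝ (_root_.comp f (N + si.2.val)) (t • lastVec (N + 1)) w := fun w =>
    ((hg.fderiv_right (m := (⊤ : ℕ∞)) (by simp)).clm_apply contDiff_const).comp
      (contDiff_id.smul contDiff_const)
  have hT : (fun t : ℝ => fderiv ℝ (_root_.comp f (N + si.2.val)) (t • lastVec (N + 1))
      (lastVec (N + 1))) =O[𝓝 0] fun t : ℝ => t ^ r :=
    isBigO_of_iteratedDeriv_eq_zero ((hgd _).contDiffAt.of_le (WithTop.coe_le_coe.2 le_top))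
      fun j hj => by
        rw [iteratedDeriv_fderiv_axis hg]
        exact c1 si.2 (j + 1) (by omega) hj
  have hgc : Continuous fun t : ℝ =>
      fderiv ℝ (_root_.comp f (N + si.2.val)) (t • lastVec (N + 1)) :=
    ((hg.fderiv_right (m := (⊤ : ℕ∞)) (by simp)).continuous).comp
      (continuous_id.smul continuous_const)
  have hrest : (fun t : ℝ => fderiv ℝ (_root_.comp f (N + si.2.val)) (t • lastVec (N + 1))
      (ζ t - v - (ζ t (Fin.last N) - ζ 0 (Fin.last N)) • lastVec (N + 1)))
      =O[𝓝 0] fun t : ℝ => t ^ (r + 1) := by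
    have h1 : (fun t : ℝ => fderiv ℝ (_root_.comp f (N + si.2.val)) (t • lastVec (N + 1))
        (ζ t - v - (ζ t (Fin.last N) - ζ 0 (Fin.last N)) • lastVec (N + 1))) =O[𝓝 0] fun t =>
        ‖fderiv ℝ (_root_.comp f (N + si.2.val)) (t • lastVec (N + 1))‖ *
        ‖ζ t - v - (ζ t (Fin.last N) - ζ 0 (Fin.last N)) • lastVec (N + 1)‖ :=
      isBigO_of_le _ fun t => (ContinuousLinearMap.le_opNorm _ _).trans (le_abs_self _)
    have h2 := (hgc.norm.continuousAt.tendsto.isBigO_one ℝ (l := 𝓝 (0 : ℝ))).mul hsplit.norm_left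
    simp only [one_mul] at h2
    exact h1.trans h2
  have hprod := hlast.mul hT
  simp only [← pow_add, add_comm 1 r] at hprod
  have hmain : (fun t : ℝ => fderiv ℝ (_root_.comp f (N + si.2.val)) (t • lastVec (N + 1)) v -
      ∑ j ∈ Finset.range (r + 1), (if j = 0 then - c k else A si.2 j) * t ^ j)
      =O[𝓝 0] fun t : ℝ => t ^ (r + 1) := by
    refine (((isBigO_pi.1 ho k).add hrest).add hprod).neg_left.congr_left fun t => ?_
    have hk : (⟨k.val - N, by omega⟩ : Fin (p + 1)) = si.2 := Fin.ext (by simp [k])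
    simp only [Pi.sub_apply, ← fderiv_comp_apply hf k rfl, map_sub, map_smul, smul_eq_mul,
      Finset.sum_range_succ', dif_pos (show N ≤ k.val by simp [k]), hk, Nat.add_eq_zero_iff,
      one_ne_zero, and_false, if_false, if_true, pow_zero, mul_one]
    change -(_ - fderiv ℝ (_root_.comp f (N + si.2.val)) _ _ - _ + _ + _) = _
    ring
  have h1 := iteratedDeriv_eq_of_isBigO ((hgd v).contDiffAt.of_le (WithTop.coe_le_coe.2 le_top))
    hmain (si.1.val + 1) (by omega)
  rw [iteratedDeriv_fderiv_axis hg, if_neg (Nat.succ_ne_zero _)] at h1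
  rw [h1]
  have : ((si.1.val + 1).factorial : ℝ) ≠ 0 := by positivity
  simp only [A, Nat.add_sub_cancel, dif_pos si.1.isLt, if_neg (Nat.succ_ne_zero _)]
  field_simp

theorem conditions_of_aEquiv {N p n r : ℕ} (hn : n = N + 1 + p) (hr : 1 ≤ r)
    (hdim : r * (p + 1) ≤ N + 1) {f : (Fin (N + 1) → ℝ) → (Fin n → ℝ)}
    (hf : ContDiff ℝ (⊤ : ℕ∞) f) (hf0 : f 0 = 0)
    (hform : ∀ᶠ x in 𝓝 (0 : Fin (N + 1) → ℝ), ∀ k : Fin n, k.val < N → f x k = xhat x k.val)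
    (hfh : AEquiv f (hMorinNF (N + 1) n r)) :
    (∀ k : Fin (p + 1), ∀ j, 1 ≤ j → j ≤ r → DlIter (_root_.comp f (N + k.val)) j 0 = 0) ∧
      (∃ k : Fin (p + 1), DlIter (_root_.comp f (N + k.val)) (r + 1) 0 ≠ 0) ∧
      (morinMatrix f r p).rank = r * (p + 1) := by
  have hh := contDiff_hMorinNF (N + 1) n r
  have hh0 := hMorinNF_zero (N + 1) n r
  have hhform : ∀ᶠ x in 𝓝 (0 : Fin (N + 1) → ℝ), ∀ k : Fin n, k.val < N →
      hMorinNF (N + 1) n r x k = xhat x k.val :=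
    Eventually.of_forall fun x k hk => hMorinNF_of_lt _ hk
  have hho := isBigO_hMorinNF_axis (N := N) (r := r) hn hdim
  have hfo := isBigO_axis_of_aEquiv (by omega) (by omega) hh hh0 hf hform (hfh.symm hf hf0) hho
  have c1 : ∀ k : Fin (p + 1), ∀ j, 1 ≤ j → j ≤ r → DlIter (_root_.comp f (N + k.val)) j 0 = 0 :=
    fun k j _ hj => DlIter_eq_zero_of_isBigO hf hfo (by omega) j (by omega)
  refine ⟨c1, ?_, ?_⟩
  · by_contra! hc
    have h1 : (fun t : ℝ => f (t • lastVec (N + 1))) =O[𝓝 0] fun t : ℝ => t ^ (r + 2) := by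
      refine isBigO_pi.2 fun k => ?_
      rcases lt_or_ge k.val N with hk | hk
      · refine (isBigO_zero _ _).congr' ?_ EventuallyEq.rfl
        filter_upwards [tendsto_axis.eventually hform] with t ht
        rw [ht k hk, xhat_axis, if_neg hk.ne]
      · have hg := contDiff_comp hf k.val
        have h2 : (fun t : ℝ => _root_.comp f k.val (t • lastVec (N + 1))) =O[𝓝 0]
            fun t : ℝ => t ^ (r + 2) :=
          isBigO_of_iteratedDeriv_eq_zero
            ((hg.comp (contDiff_id.smul contDiff_const)).contDiffAt.of_le
              (WithTop.coe_le_coe.2 le_top)) fun j hj => by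
            rw [iteratedDeriv_axis hg]
            beta_reduce
            rw [zero_smul]
            rcases (Nat.lt_succ_iff.1 hj).lt_or_eq with hj | rfl
            · exact DlIter_eq_zero_of_isBigO hf hfo k.isLt j hj
            · have h3 := hc ⟨k.val - N, by omega⟩
              rwa [show N + (k.val - N) = k.val by omega] at h3
        exact h2.congr_left fun t => comp_apply_of_lt f k.isLt _
    have h2 := isBigO_axis_of_aEquiv (by omega) (by omega) hf hf0 hh hhform hfh h1
    have h3 := isBigO_pi.1 h2 ⟨N + p, by omega⟩
    simp only [hMorinNF_axis hn hdim, if_true] at h3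
    have h4 := iteratedDeriv_eq_of_isBigO (u := fun t : ℝ => t ^ (r + 1)) (k := r + 2)
      (a := fun j => if j = r + 1 then 1 else 0) (contDiffAt_id.pow _) (by
        simpa using isBigO_zero _ _) (r + 1) (by omega)
    have h5 := iteratedDeriv_eq_zero_of_isBigO (contDiffAt_id.pow _) h3 (r + 1) (by omega)
    simp only [id] at h5
    rw [h5, if_pos rfl, mul_one] at h4
    exact (Nat.cast_ne_zero.2 (Nat.factorial_ne_zero (r + 1))) h4.symm
  · obtain ⟨φ, ψ, Φ, Ψ, hφ, hψ, hΦ, hΨ, h1, h2, h3⟩ :=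
      isDiffeoGerm_eventuallyEq_inverse hf hf0 hfh
    have hγ := contDiffAt_diffeo_axis hψ
    have hγ0 : ψ ((0 : ℝ) • lastVec (N + 1)) = 0 := by rw [zero_smul, hψ.1]
    have ho := isBigO_image_axis hf0 hf hΦ h2 hfo
    have hsub := isBigO_sub_axis (by omega) hhform (tendsto_of_contDiffAt hγ hγ0) ho
    have hd := deriv_last_ne_zero (by omega) (hγ.differentiableAt (by simp)) hγ0
      (deriv_diffeo_axis_ne_zero hψ) hsub
    have hT : ContDiffAt ℝ (⊤ : ℕ∞) (fun t : ℝ => ψ (t • lastVec (N + 1)) (Fin.last N)) 0 :=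
      contDiffAt_pi.1 hγ _
    have hT0 : ψ ((0 : ℝ) • lastVec (N + 1)) (Fin.last N) = 0 := by rw [hγ0]; rfl
    have hv := (versalAlong_hMorinNF hn hr hdim hT hT0 hd).congr hh (tendsto_smul_lastVec hT hT0)
      (tendsto_of_contDiffAt hγ hγ0) (hsub.neg_left.congr_left fun t => neg_sub _ _)
    exact rank_morinMatrix_of_versalAlong hn hf hform c1
      (hv.of_diffeo hf hh hh0 hφ hΨ h3 hγ hγ0 (tendsto_axis.eventually h1) ho)

end Necessity

/-- Morin's lemma. Let `f` be written in the normalized form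
`f(x) = (x_1, …, x_{m-1}, f_m(x), …, f_n(x))` with `(df_i)_0 = 0` for `i = m, …, n`,
and set `F = (∂f_m/∂x_m, …, ∂f_n/∂x_m)`.  Then `f` is an `r`-Morin singularity at `0` iff
`(∂^j f_m/∂x_m^j, …, ∂^j f_n/∂x_m^j)(0) = 0` for `1 ≤ j ≤ r`,
`(∂^{r+1} f_m/∂x_m^{r+1}, …, ∂^{r+1} f_n/∂x_m^{r+1})(0) ≠ 0`, and
`rank d(F, ∂F/∂x_m, …, ∂^{r-1}F/∂x_m^{r-1})_0 = r(n-m+1)`. -/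
theorem stmt9 {m n r : ℕ} (hm : 0 < m) (hmn : m < n) (hr : 1 ≤ r)
    (hdim : r * (n - m + 1) ≤ m)
    (f : (Fin m → ℝ) → (Fin n → ℝ))
    (hf : ContDiff ℝ (⊤ : ℕ∞) f) (hf0 : f 0 = 0)
    (hform : ∀ᶠ x in 𝓝 (0 : Fin m → ℝ), ∀ k : Fin n, k.val < m - 1 → f x k = xhat x k.val)
    (hdz : ∀ k : Fin n, m - 1 ≤ k.val → ∀ l : Fin m, pd (comp f k.val) 0 l.val = 0) :
    AEquiv f (hMorinNF m n r) ↔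
      ((∀ i : Fin (n - m + 1), ∀ j : ℕ, 1 ≤ j → j ≤ r →
          DlIter (comp f (m - 1 + i.val)) j 0 = 0) ∧
        (∃ i : Fin (n - m + 1), DlIter (comp f (m - 1 + i.val)) (r + 1) 0 ≠ 0) ∧
        Matrix.rank (Matrix.of fun (si : Fin r × Fin (n - m + 1)) (l : Fin m) =>
          pd (DlIter (comp f (m - 1 + si.2.val)) (si.1.val + 1)) 0 l.val)
          = r * (n - m + 1)) := by
  obtain ⟨N, rfl⟩ := Nat.exists_eq_add_of_le' hm
  generalize hp : n - (N + 1) = p at *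
  have hn : n = N + 1 + p := by omega
  have hdz' : ∀ k : Fin (p + 1), fderiv ℝ (_root_.comp f (N + k.val)) 0 = 0 := fun k =>
    ContinuousLinearMap.ext fun v => by
      rw [← sum_pd_mul]
      refine Finset.sum_eq_zero fun l _ => ?_
      have h := hdz ⟨N + k.val, by omega⟩ (Nat.le_add_right N k.val) l
      dsimp only at h
      rw [h, zero_mul]
  exact ⟨conditions_of_aEquiv hn hr hdim hf hf0 hform,
    fun h => aEquiv_of_conditions hn hr hdim hf hf0 hform hdz' h.1 h.2.1 h.2.2⟩
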